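/- Let n ≥ 1 and let ω : (0,∞) → [0,∞) be non-decreasing, doubling (i.e., there is D > 0 with ω(2t) ≤ D·ω(t) for all t > 0), and satisfy the log-Dini(1/4) condition. Let K be a bilinear Calderón–Zygmund kernel of ω type with constant C₀ > 0 on ℝⁿ and T a bilinear operator on pairs of integrable functions with kernel representation by K. Let b₁, b₂ : ℝⁿ → ℝ be locally integrable with finite BMO seminorms, and define the iterated commutator T_{Πb}(f₁,f₂) = b₁b₂·T(f₁,f₂) − b₂·T(b₁f₁, f₂) − b₁·T(f₁, b₂f₂) + T(b₁f₁, b₂f₂). Assume there are C₁′, C₂ > 0 with λ·|{x : |T_{Πb}(f,g)(x)| > λ}| ≤ C₁′‖f‖_{L²}‖g‖_{L²} for all bounded compactly supported f, g and λ > 0, and |{x : |T(f,g)(x)| > λ}| ≤ (C₂‖f‖_{L¹}‖g‖_{L¹}/λ)^{1/2} for all f, g ∈ L¹(ℝⁿ), λ > 0. Then there is C, depending only on n, ω, D, ‖b₁‖_* and ‖b₂‖_*, such that for every λ > 0 and all f₁, f₂ that are finite sums of (1,∞,0)-atoms supported on dyadic cubes with coefficient ℓ¹-sums at most 1, |{x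 ∈ ℝⁿ : |T_{Πb}(f₁,f₂)(x)| > λ}| ≤ C·(C₀+C₁′+C₂)^{1/2}·λ^{−1/2}. -/

import Mathlib

open MeasureTheory Set
open scoped ENNReal

noncomputable section

/-- Euclidean space `ℝⁿ`. -/
abbrev Rn (n : ℕ) : Type := EuclideanSpace ℝ (Fin n)

/-- A dyadic cube `∏ [2^k mᵢ, 2^k (mᵢ+1))` in `ℝⁿ`. -/
def IsDyadicCube {n : ℕ} (Q : Set (Rn n)) : Prop :=
  ∃ (k : ℤ) (m : Fin n → ℤ),
    Q = {x : Rn n | ∀ i, (2:ℝ) ^ k * (m i : ℝ) ≤ x i ∧ x i < (2:ℝ) ^ k * ((m i : ℝ) + 1)}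

/-- The (closed) axis-parallel cube with center `c` and side length `l`. -/
def cube {n : ℕ} (c : Rn n) (l : ℝ) : Set (Rn n) :=
  {x : Rn n | ∀ i, |x i - c i| ≤ l / 2}

/-- The average `b_Q = |Q|⁻¹ ∫_Q b`. -/
def avgOn {n : ℕ} (b : Rn n → ℝ) (Q : Set (Rn n)) : ℝ := ⨍ x in Q, b x

/-- `b` has mean oscillation at most `M` on every cube; i.e. `‖b‖_* ≤ M`. -/
def OscBound {n : ℕ} (b : Rn n → ℝ) (M : ℝ) : Prop :=
  ∀ (c : Rn n) (l : ℝ), 0 < l →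
    ⨍ x in cube c l, |b x - avgOn b (cube c l)| ≤ M

/-- A `(1,∞,0)`-atom supported on the set `Q`. -/
def IsH1Atom {n : ℕ} (Q : Set (Rn n)) (a : Rn n → ℝ) : Prop :=
  Measurable a ∧ (∀ x, x ∉ Q → a x = 0) ∧
    (∀ᵐ x ∂volume, |a x| ≤ ((volume Q).toReal)⁻¹) ∧ (∫ x, a x) = 0

/-- The `L¹` norm. -/
def l1norm {n : ℕ} (f : Rn n → ℝ) : ℝ := ∫ x, |f x|

/-- The `L²` norm. -/
def l2norm {n : ℕ} (f : Rn n → ℝ) : ℝ := (∫ x, (f x) ^ 2) ^ ((1:ℝ)/2)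

/-- A finite sum `∑ λ_k a_k` of `(1,∞,0)`-atoms on dyadic cubes with `∑ |λ_k| ≤ 1`. -/
def FiniteAtomicSum {n : ℕ} (f : Rn n → ℝ) : Prop :=
  ∃ (N : ℕ) (Q : Fin N → Set (Rn n)) (a : Fin N → Rn n → ℝ) (lam : Fin N → ℝ),
    (∀ k, IsDyadicCube (Q k)) ∧ (∀ k, IsH1Atom (Q k) (a k)) ∧
    (∑ k, |lam k|) ≤ 1 ∧ ∀ x, f x = ∑ k, lam k * a k x

/-- A bilinear Calderón–Zygmund kernel of `ω` type with constant `C₀` on `ℝⁿ`. -/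
def IsCZKernel2 {n : ℕ} (C₀ : ℝ) (ω : ℝ → ℝ) (K : Rn n → Rn n → Rn n → ℝ) : Prop :=
  (∀ x y₁ y₂ : Rn n, ¬(x = y₁ ∧ y₁ = y₂) →
      |K x y₁ y₂| ≤ C₀ / (‖x - y₁‖ + ‖x - y₂‖) ^ (2 * n)) ∧
  (∀ x x' y₁ y₂ : Rn n, ¬(x = y₁ ∧ y₁ = y₂) →
      ‖x - x'‖ ≤ (1/2) * max ‖x - y₁‖ ‖x - y₂‖ →
      |K x y₁ y₂ - K x' y₁ y₂| ≤
        C₀ / (‖x - y₁‖ + ‖x - y₂‖) ^ (2 * n) * ω (‖x - x'‖ / (‖x - y₁‖ + ‖x - y₂‖))) ∧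
  (∀ x y₁ y₁' y₂ : Rn n, ¬(x = y₁ ∧ y₁ = y₂) →
      ‖y₁ - y₁'‖ ≤ (1/2) * max ‖x - y₁‖ ‖x - y₂‖ →
      |K x y₁ y₂ - K x y₁' y₂| ≤
        C₀ / (‖x - y₁‖ + ‖x - y₂‖) ^ (2 * n) * ω (‖y₁ - y₁'‖ / (‖x - y₁‖ + ‖x - y₂‖))) ∧
  (∀ x y₁ y₂ y₂' : Rn n, ¬(x = y₁ ∧ y₁ = y₂) →
      ‖y₂ - y₂'‖ ≤ (1/2) * max ‖x - y₁‖ ‖x - y₂‖ →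
      |K x y₁ y₂ - K x y₁ y₂'| ≤
        C₀ / (‖x - y₁‖ + ‖x - y₂‖) ^ (2 * n) * ω (‖y₂ - y₂'‖ / (‖x - y₁‖ + ‖x - y₂‖)))

/-- `T` is additive and homogeneous in each of its two entries (on integrable functions). -/
def Bilin2 {n : ℕ} (T : (Rn n → ℝ) → (Rn n → ℝ) → Rn n → ℝ) : Prop :=
  (∀ f f' g : Rn n → ℝ, Integrable f → Integrable f' → Integrable g → ∀ x,
      T (fun y => f y + f' y) g x = T f g x + T f' g x) ∧
  (∀ (r : ℝ) (f g : Rn n → ℝ), Integrable f → Integrable g → ∀ x,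
      T (fun y => r * f y) g x = r * T f g x) ∧
  (∀ f g g' : Rn n → ℝ, Integrable f → Integrable g → Integrable g' → ∀ x,
      T f (fun y => g y + g' y) x = T f g x + T f g' x) ∧
  (∀ (r : ℝ) (f g : Rn n → ℝ), Integrable f → Integrable g → ∀ x,
      T f (fun y => r * g y) x = r * T f g x)

/-- `T` is represented by the kernel `K` off the support of the arguments. -/
def KernelRep2 {n : ℕ} (K : Rn n → Rn n → Rn n → ℝ)
    (T : (Rn n → ℝ) → (Rn n → ℝ) → Rn n → ℝ) : Prop :=
  ∀ f g : Rn n → ℝ, Integrable f → Integrable g →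
    HasCompactSupport f → HasCompactSupport g →
    ∀ᵐ x ∂volume, x ∉ tsupport f ∩ tsupport g →
      T f g x = ∫ y : Rn n × Rn n, K x y.1 y.2 * f y.1 * g y.2

open Filter Topology
open scoped NNReal

/-! ### Cubes -/

/-- The half-open cube with centre `c` and half side length `r`. -/
def hcube {n : ℕ} (c : Rn n) (r : ℝ) : Set (Rn n) :=
  {x | ∀ i, c i - r ≤ x i ∧ x i < c i + r}

lemma norm_le_of_abs_le {n : ℕ} {v : Rn n} {r : ℝ} (h : ∀ i, |v i| ≤ r) : ‖v‖ ≤ n * r := by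
  rw [EuclideanSpace.norm_eq]
  have h1 : ∑ i, ‖v i‖ ^ 2 ≤ n * r ^ 2 := by
    calc ∑ i, ‖v i‖ ^ 2 ≤ ∑ _i : Fin n, r ^ 2 :=
          Finset.sum_le_sum fun i _ => by
            rw [Real.norm_eq_abs]; exact pow_le_pow_left₀ (abs_nonneg _) (h i) 2
      _ = n * r ^ 2 := by simp
  rcases Nat.eq_zero_or_pos n with rfl | hn
  · simp
  have hr : 0 ≤ r := (abs_nonneg _).trans (h ⟨0, hn⟩)
  have h1n : (1 : ℝ) ≤ n := by exact_mod_cast hn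
  apply Real.sqrt_le_iff.2 ⟨by positivity, h1.trans _⟩
  have : (n : ℝ) * 1 ≤ n * n := by gcongr
  nlinarith [sq_nonneg r]

lemma abs_apply_le_norm {n : ℕ} (v : Rn n) (i : Fin n) : |v i| ≤ ‖v‖ := by
  simpa using PiLp.norm_apply_le v i

lemma norm_sub_le_of_mem_hcube {n : ℕ} {c x : Rn n} {r : ℝ} (h : x ∈ hcube c r) :
    ‖x - c‖ ≤ n * r :=
  norm_le_of_abs_le fun i => by
    have := h i
    simp only [PiLp.sub_apply]
    rw [abs_le]; constructor <;> linarith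

lemma mem_hcube_of_norm_lt {n : ℕ} {c x : Rn n} {r : ℝ} (h : ‖x - c‖ < r) : x ∈ hcube c r := by
  intro i
  have := (abs_lt.1 ((abs_apply_le_norm (x - c) i).trans_lt h))
  simp only [PiLp.sub_apply] at this
  constructor <;> linarith

lemma closedBall_subset_hcube {n : ℕ} (c : Rn n) {r s : ℝ} (h : r < s) :
    Metric.closedBall c r ⊆ hcube c s := fun x hx => by
  rw [mem_closedBall_iff_norm] at hx; exact mem_hcube_of_norm_lt (hx.trans_lt h)

lemma hcube_eq_preimage {n : ℕ} (c : Rn n) (r : ℝ) :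
    hcube c r = WithLp.ofLp ⁻¹' (Set.univ.pi fun i => Ico (c i - r) (c i + r)) := by
  ext x; simp [hcube]

lemma cube_eq_preimage {n : ℕ} (c : Rn n) (r : ℝ) :
    cube c (2 * r) = WithLp.ofLp ⁻¹' (Set.univ.pi fun i => Icc (c i - r) (c i + r)) := by
  ext x
  simp only [cube, mem_ofPred_eq, mem_preimage, mem_univ_pi, mem_Icc]
  refine forall_congr' fun i => ?_
  rw [abs_le]
  constructor <;> rintro ⟨h1, h2⟩ <;> constructor <;> linarith

lemma measurableSet_hcube {n : ℕ} (c : Rn n) (r : ℝ) : MeasurableSet (hcube c r) := by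
  rw [hcube_eq_preimage]
  exact (PiLp.volume_preserving_ofLp (Fin n)).measurable
    (MeasurableSet.univ_pi fun i => measurableSet_Ico)

lemma volume_hcube {n : ℕ} (c : Rn n) {r : ℝ} (hr : 0 ≤ r) :
    volume (hcube c r) = ENNReal.ofReal ((2 * r) ^ n) := by
  rw [hcube_eq_preimage, (PiLp.volume_preserving_ofLp (Fin n)).measure_preimage
    (MeasurableSet.univ_pi fun i => measurableSet_Ico).nullMeasurableSet, volume_pi_pi]
  simp only [Real.volume_Ico]
  rw [ENNReal.ofReal_pow (by positivity)]
  simp [show ∀ i, c i + r - (c i - r) = 2 * r from fun i => by ring]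

lemma volume_cube {n : ℕ} (c : Rn n) {r : ℝ} (hr : 0 ≤ r) :
    volume (cube c (2 * r)) = ENNReal.ofReal ((2 * r) ^ n) := by
  rw [cube_eq_preimage, (PiLp.volume_preserving_ofLp (Fin n)).measure_preimage
    (MeasurableSet.univ_pi fun i => measurableSet_Icc).nullMeasurableSet, volume_pi_pi]
  simp only [Real.volume_Icc]
  rw [ENNReal.ofReal_pow (by positivity)]
  simp [show ∀ i, c i + r - (c i - r) = 2 * r from fun i => by ring]

lemma hcube_subset_cube {n : ℕ} (c : Rn n) (r : ℝ) : hcube c r ⊆ cube c (2 * r) := by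
  intro x hx i
  have := hx i
  rw [abs_le]; constructor <;> linarith

lemma cube_subset_cube {n : ℕ} (c : Rn n) {r s : ℝ} (h : r ≤ s) : cube c r ⊆ cube c s :=
  fun x hx i => (hx i).trans (by linarith)

lemma volume_closedBall_le {n : ℕ} (c : Rn n) {r : ℝ} (hr : 0 < r) :
    volume (Metric.closedBall c r) ≤ ENNReal.ofReal ((4 * r) ^ n) := by
  refine (measure_mono (closedBall_subset_hcube c (show r < 2 * r by linarith))).trans ?_
  rw [volume_hcube c (by linarith)]
  ring_nf; rfl

lemma isCompact_cube {n : ℕ} (c : Rn n) (r : ℝ) : IsCompact (cube c (2 * r)) := by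
  rw [cube_eq_preimage]
  exact (PiLp.homeomorph 2 fun _ : Fin n => ℝ).isCompact_preimage.2
    (isCompact_univ_pi fun i => isCompact_Icc)

/-! ### Dyadic grids -/

/-- The index of the cell of side `s * 2 ^ k` of the grid with origin `o` containing `x`. -/
def gridIdx {n : ℕ} (o : Rn n) (s : ℝ) (k : ℤ) (x : Rn n) : Fin n → ℤ :=
  fun i => ⌊(x i - o i) / (s * 2 ^ k)⌋

/-- The cell with index `m` and side `s * 2 ^ k` of the grid with origin `o`. -/
def gridCell {n : ℕ} (o : Rn n) (s : ℝ) (k : ℤ) (m : Fin n → ℤ) : Set (Rn n) :=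
  {x | gridIdx o s k x = m}

/-- The centre of a grid cell. -/
def gridCentre {n : ℕ} (o : Rn n) (s : ℝ) (k : ℤ) (m : Fin n → ℤ) : Rn n :=
  WithLp.toLp 2 fun i => o i + s * 2 ^ k * (m i + 1 / 2)

lemma gridIdx_add_one {n : ℕ} (o : Rn n) (s : ℝ) (k : ℤ) (x : Rn n) :
    gridIdx o s (k + 1) x = fun i => gridIdx o s k x i / 2 := by
  funext i
  have h : (x i - o i) / (s * 2 ^ (k + 1)) = (x i - o i) / (s * 2 ^ k) / (2 : ℕ) := by
    rw [zpow_add_one₀ (two_ne_zero), div_div]; push_cast; ring_nf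
  simp only [gridIdx, h]
  rw [Int.floor_div_natCast]; rfl

lemma gridIdx_congr {n : ℕ} {o : Rn n} {s : ℝ} {k l : ℤ} (hkl : k ≤ l) {x y : Rn n}
    (h : gridIdx o s k x = gridIdx o s k y) : gridIdx o s l x = gridIdx o s l y := by
  induction l, hkl using Int.leInduction with
  | base => exact h
  | succ l _ ih => rw [gridIdx_add_one, gridIdx_add_one, ih]

lemma gridCell_eq_hcube {n : ℕ} (o : Rn n) {s : ℝ} (hs : 0 < s) (k : ℤ) (m : Fin n → ℤ) :
    gridCell o s k m = hcube (gridCentre o s k m) (s * 2 ^ k / 2) := by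
  have hp : 0 < s * (2 : ℝ) ^ k := by positivity
  ext x
  simp only [gridCell, hcube, gridIdx, gridCentre, mem_ofPred_eq, funext_iff, Int.floor_eq_iff]
  refine forall_congr' fun i => ?_
  rw [le_div_iff₀ hp, div_lt_iff₀ hp]
  constructor <;> rintro ⟨h1, h2⟩ <;> constructor <;> linarith

lemma measurableSet_gridCell {n : ℕ} (o : Rn n) {s : ℝ} (hs : 0 < s) (k : ℤ) (m : Fin n → ℤ) :
    MeasurableSet (gridCell o s k m) := by
  rw [gridCell_eq_hcube o hs]; exact measurableSet_hcube _ _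

lemma volume_gridCell {n : ℕ} (o : Rn n) {s : ℝ} (hs : 0 < s) (k : ℤ) (m : Fin n → ℤ) :
    volume (gridCell o s k m) = ENNReal.ofReal ((s * 2 ^ k) ^ n) := by
  rw [gridCell_eq_hcube o hs, volume_hcube _ (by positivity)]
  ring_nf

lemma volume_gridCell_add_one {n : ℕ} (o : Rn n) {s : ℝ} (hs : 0 < s) (k : ℤ)
    (m m' : Fin n → ℤ) :
    volume (gridCell o s (k + 1) m) = 2 ^ n * volume (gridCell o s k m') := by
  rw [volume_gridCell o hs, volume_gridCell o hs, zpow_add_one₀ two_ne_zero, ← mul_assoc,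
    mul_pow _ (2 : ℝ), mul_comm, ENNReal.ofReal_mul (by positivity),
    ENNReal.ofReal_pow (by positivity)]
  norm_num

lemma gridCell_subset {n : ℕ} {o : Rn n} {s : ℝ} {k l : ℤ} (hkl : k ≤ l) {m : Fin n → ℤ}
    {x : Rn n} (hx : gridIdx o s k x = m) :
    gridCell o s k m ⊆ gridCell o s l (gridIdx o s l x) := fun _ hy =>
  gridIdx_congr hkl (Eq.trans (show _ = m from hy) hx.symm)

/-- Almost every point of `E` lies in arbitrarily small grid cells mostly filled by `E`. -/
lemma ae_exists_gridCell_dense {n : ℕ} (o : Rn n) {s : ℝ} (hs : 0 < s) (k : ℤ)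
    (E : Set (Rn n)) :
    ∀ᵐ x ∂(volume.restrict E), ∃ p : ℕ,
      volume (gridCell o s (k - p) (gridIdx o s (k - p) x)) <
        2 * volume (E ∩ gridCell o s (k - p) (gridIdx o s (k - p) x)) := by
  filter_upwards [Besicovitch.ae_tendsto_measure_inter_div (volume : Measure (Rn n)) E] with x hx
  by_contra! hcon
  set R : ℕ → ℝ := fun p => (n + 1) * (s * 2 ^ (k - p)) with hR
  have hRpos : ∀ p, 0 < R p := fun p => by simp only [hR]; positivity
  have hRlim : Tendsto R atTop (𝓝[>] 0) := by
    refine tendsto_nhdsWithin_iff.2 ⟨?_, Eventually.of_forall hRpos⟩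
    have h1 : R = fun p : ℕ => ((n + 1) * (s * 2 ^ k)) * (1 / 2 : ℝ) ^ p := by
      funext p
      simp only [hR]
      rw [zpow_sub₀ two_ne_zero, zpow_natCast, one_div_pow]; ring
    rw [h1]
    simpa using (tendsto_pow_atTop_nhds_zero_of_lt_one (r := (1 / 2 : ℝ)) (by norm_num)
      (by norm_num)).const_mul ((n + 1) * (s * 2 ^ k))
  set δ : ℝ≥0∞ := ENNReal.ofReal ((2 * (4 * (n + 1)) ^ n)⁻¹) with hδ
  have key : ∀ p, volume (E ∩ Metric.closedBall x (R p)) / volume (Metric.closedBall x (R p))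
      ≤ 1 - δ := by
    intro p
    set Q := gridCell o s (k - p) (gridIdx o s (k - p) x) with hQ
    set B := Metric.closedBall x (R p) with hB
    have hQm : MeasurableSet Q := measurableSet_gridCell o hs _ _
    have hB0 : volume B ≠ 0 := (Metric.measure_closedBall_pos _ _ (hRpos p)).ne'
    have hBt : volume B ≠ ⊤ := measure_closedBall_lt_top.ne
    have hQB : Q ⊆ B := by
      intro y hy
      rw [hB, mem_closedBall_iff_norm]
      have hxQ : x ∈ Q := rfl
      rw [hQ, gridCell_eq_hcube o hs] at hy hxQ
      have : ∀ i, |(y - x) i| ≤ s * 2 ^ (k - p) := fun i => by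
        have h1 := hy i
        have h2 := hxQ i
        simp only [PiLp.sub_apply]
        rw [abs_le]; constructor <;> linarith
      refine (norm_le_of_abs_le this).trans ?_
      simp only [hR]
      gcongr; linarith
    have hQt : volume Q ≠ ⊤ := ne_top_of_le_ne_top hBt (measure_mono hQB)
    have h1 : volume (E ∩ B) + 2⁻¹ * volume Q ≤ volume B := by
      calc volume (E ∩ B) + 2⁻¹ * volume Q
          ≤ (volume (E ∩ Q) + volume (B \ Q)) + 2⁻¹ * volume Q := by
            gcongr
            refine (measure_mono ?_).trans (measure_union_le _ _)
            intro y hy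
            by_cases hyQ : y ∈ Q
            · exact Or.inl ⟨hy.1, hyQ⟩
            · exact Or.inr ⟨hy.2, hyQ⟩
        _ ≤ (2⁻¹ * volume Q + volume (B \ Q)) + 2⁻¹ * volume Q := by
            gcongr
            rw [← ENNReal.div_eq_inv_mul, ENNReal.le_div_iff_mul_le (by simp) (by simp), mul_comm]
            exact hcon p
        _ = (2⁻¹ + 2⁻¹) * volume Q + volume (B \ Q) := by ring
        _ = volume B := by
            rw [ENNReal.inv_two_add_inv_two, one_mul, measure_sdiff hQB hQm.nullMeasurableSet hQt,
              add_tsub_cancel_of_le (measure_mono hQB)]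
    have h2 : δ * volume B ≤ 2⁻¹ * volume Q := by
      have h3 := volume_closedBall_le x (hRpos p)
      rw [volume_gridCell o hs]
      calc δ * volume B ≤ δ * ENNReal.ofReal ((4 * R p) ^ n) := by gcongr
        _ = ENNReal.ofReal (2⁻¹ * (s * 2 ^ (k - p)) ^ n) := by
            rw [hδ, ← ENNReal.ofReal_mul (by positivity)]
            congr 1
            have : 4 * R p = (4 * (n + 1)) * (s * 2 ^ (k - p)) := by simp only [hR]; ring
            rw [this, mul_pow (4 * ((n : ℝ) + 1))]
            field_simp
        _ = _ := by
            rw [ENNReal.ofReal_mul (by norm_num), ENNReal.ofReal_inv_of_pos (by norm_num)]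
            norm_num
    have h3 : volume (E ∩ B) ≤ volume B - δ * volume B :=
      ENNReal.le_sub_of_add_le_right (ENNReal.mul_ne_top ENNReal.ofReal_ne_top hBt)
        ((by gcongr : _ ≤ volume (E ∩ B) + 2⁻¹ * volume Q).trans h1)
    calc volume (E ∩ B) / volume B ≤ (volume B - δ * volume B) / volume B := by gcongr
      _ = 1 - δ := by
        rw [ENNReal.sub_div (fun _ _ => hB0), ENNReal.div_self hB0 hBt,
          ENNReal.mul_div_cancel_right hB0 hBt]
  have h1 : (1 : ℝ≥0∞) ≤ 1 - δ := le_of_tendsto (hx.comp hRlim) (Eventually.of_forall key)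
  have hδ0 : δ ≠ 0 := by
    rw [hδ]; simp only [ne_eq, ENNReal.ofReal_eq_zero, not_le]; positivity
  exact absurd h1 (not_le.2 (ENNReal.sub_lt_self (by simp) (by simp) hδ0))

/-! ### The John–Nirenberg inequality -/

/-- Exponential decay of the distribution function on dyadic cells, from a bound on the
median oscillation on all cells (John–Nirenberg–Strömberg). -/
lemma two_pow_mul_volume_gridCell_le {n : ℕ} (o : Rn n) {s : ℝ} (hs : 0 < s) (h : Rn n → ℝ)
    (a : ℤ → (Fin n → ℤ) → ℝ) {t : ℝ} (ht : 0 ≤ t)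
    (H : ∀ k m, 2 ^ (n + 2) * volume {x ∈ gridCell o s k m | t < |h x - a k m|} ≤
      volume (gridCell o s k m)) (N : ℕ) :
    ∀ k m, 2 ^ N * volume {x ∈ gridCell o s k m | (2 * N + 1) * t < |h x - a k m|} ≤
      volume (gridCell o s k m) := by
  induction N with
  | zero =>
    intro k m
    refine le_trans ?_ (H k m)
    simp only [pow_zero, CharP.cast_eq_zero, mul_zero, zero_add, one_mul]
    exact le_mul_of_one_le_left' (one_le_pow₀ (by norm_num))
  | succ N ih =>
    intro k m
    set E := {x ∈ gridCell o s k m | t < |h x - a k m|} with hE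
    set A := {x ∈ gridCell o s k m | (2 * (N + 1 : ℕ) + 1) * t < |h x - a k m|} with hA
    have hAE : A ⊆ E := fun x hx => ⟨hx.1, lt_of_le_of_lt (by push_cast; nlinarith) hx.2⟩
    let dens : ℕ → (Fin n → ℤ) → Prop := fun p m' =>
      volume (gridCell o s (k - p) m') < 2 ^ (n + 1) * volume (E ∩ gridCell o s (k - p) m')
    let I : Set (ℕ × (Fin n → ℤ)) := {q | dens q.1 q.2 ∧
      ∃ x, gridIdx o s (k - q.1) x = q.2 ∧ ∀ p < q.1, ¬ dens p (gridIdx o s (k - p) x)}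
    let cell : ℕ × (Fin n → ℤ) → Set (Rn n) := fun q => gridCell o s (k - q.1) q.2
    have hcover : ∀ᵐ x ∂(volume.restrict E), x ∈ ⋃ q ∈ I, cell q := by
      filter_upwards [ae_exists_gridCell_dense o hs k E] with x hx
      classical
      have hx' : ∃ p : ℕ, dens p (gridIdx o s (k - p) x) := by
        obtain ⟨p, hp⟩ := hx
        refine ⟨p, hp.trans_le ?_⟩
        gcongr
        exact le_self_pow₀ (by norm_num) (by omega)
      simp only [mem_iUnion]
      exact ⟨(Nat.find hx', gridIdx o s (k - (Nat.find hx' : ℕ)) x),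
        ⟨Nat.find_spec hx', x, rfl, fun p hp => Nat.find_min hx' hp⟩, rfl⟩
    have hdisj : I.PairwiseDisjoint cell := by
      have aux : ∀ q ∈ I, ∀ q' ∈ I, ∀ x ∈ cell q, x ∈ cell q' → ¬ q.1 < q'.1 := by
        rintro q hq q' ⟨-, y, hy, hy'⟩ x hx hx' hlt
        have h1 : gridIdx o s (k - q'.1) x = gridIdx o s (k - q'.1) y := Eq.trans hx' hy.symm
        have h2 : gridIdx o s (k - q.1) x = gridIdx o s (k - q.1) y :=
          gridIdx_congr (by omega) h1
        have h3 : gridIdx o s (k - q.1) x = q.2 := hx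
        exact hy' q.1 hlt (by rw [← h2, h3]; exact hq.1)
      intro q hq q' hq' hne
      refine Set.disjoint_left.2 fun x hx hx' => hne ?_
      have h1 : q.1 = q'.1 :=
        le_antisymm (not_lt.1 (aux q' hq' q hq x hx' hx)) (not_lt.1 (aux q hq q' hq' x hx hx'))
      have h2 : gridIdx o s (k - q.1) x = q.2 := hx
      have h3 : gridIdx o s (k - q'.1) x = q'.2 := hx'
      exact Prod.ext h1 (by rw [← h2, ← h3, h1])
    have hroot : ∀ m', ¬ dens 0 m' := by
      intro m'
      simp only [dens, not_lt, CharP.cast_eq_zero, sub_zero]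
      by_cases hm : m' = m
      · subst hm
        refine le_trans ?_ (H k m')
        gcongr
        · norm_num
        · omega
        · exact fun x hx => hx.1
      · have : E ∩ gridCell o s k m' = ∅ := by
          refine Set.eq_empty_of_forall_notMem fun x hx => hm ?_
          have h1 : gridIdx o s k x = m' := hx.2
          have h2 : gridIdx o s k x = m := hx.1.1
          rw [← h1, h2]
        simp [this]
    have hloc : ∀ q ∈ I, 2 ^ N * volume (A ∩ cell q) ≤
        2 ^ (n + 1) * volume (E ∩ cell q) := by
      rintro ⟨p, m'⟩ ⟨hq, y, hy, hy'⟩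
      have hp : p ≠ 0 := by rintro rfl; exact hroot _ hq
      obtain ⟨p, rfl⟩ := Nat.exists_eq_succ_of_ne_zero hp
      simp only [Nat.succ_eq_add_one] at *
      set Q := gridCell o s (k - (p + 1 : ℕ)) m' with hQ
      have hQt : volume Q ≠ ⊤ := by rw [hQ, volume_gridCell o hs]; exact ENNReal.ofReal_ne_top
      have hQ0 : volume Q ≠ 0 := by
        rw [hQ, volume_gridCell o hs]
        simp only [ne_eq, ENNReal.ofReal_eq_zero, not_le]; positivity
      have hpar : 2 * volume (E ∩ Q) ≤ volume Q := by
        have h1 := hy' p (Nat.lt_succ_self p)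
        simp only [dens, not_lt] at h1
        have hk : k - (p : ℕ) = (k - (p + 1 : ℕ)) + 1 := by push_cast; ring
        have hsub : Q ⊆ gridCell o s (k - p) (gridIdx o s (k - p) y) :=
          gridCell_subset (by omega) hy
        rw [hk, volume_gridCell_add_one o hs _ _ m', ← hk, pow_succ, mul_assoc] at h1
        have h2 := (ENNReal.mul_le_mul_iff_right (by positivity) (by simp)).1 h1
        refine le_trans ?_ h2
        gcongr
      have hpt : ∃ x ∈ Q, x ∉ E ∧ |h x - a (k - (p + 1 : ℕ)) m'| ≤ t := by
        by_contra! hcon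
        have h1 : Q ⊆ (E ∩ Q) ∪ {x ∈ Q | t < |h x - a (k - (p + 1 : ℕ)) m'|} := by
          intro x hx
          by_cases hxE : x ∈ E
          · exact Or.inl ⟨hxE, hx⟩
          · exact Or.inr ⟨hx, hcon x hx hxE⟩
        have h2 := (measure_mono h1).trans (measure_union_le (μ := volume) _ _)
        have h3 : 4 * volume {x ∈ Q | t < |h x - a (k - (p + 1 : ℕ)) m'|} ≤ volume Q := by
          refine le_trans ?_ (H _ m')
          gcongr
          rw [pow_add]
          norm_num
          exact le_mul_of_one_le_left' (one_le_pow₀ (by norm_num))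
        have h4 : 4 * volume Q ≤ 3 * volume Q := by
          calc 4 * volume Q ≤ 4 * (volume (E ∩ Q) +
                volume {x ∈ Q | t < |h x - a (k - (p + 1 : ℕ)) m'|}) := by gcongr
            _ = 2 * (2 * volume (E ∩ Q)) +
                4 * volume {x ∈ Q | t < |h x - a (k - (p + 1 : ℕ)) m'|} := by ring
            _ ≤ 2 * volume Q + volume Q := by gcongr
            _ = 3 * volume Q := by ring
        have h5 := (ENNReal.mul_le_mul_iff_left hQ0 hQt).1 h4
        norm_num at h5
      have hEQ : (E ∩ Q).Nonempty := by
        rw [Set.nonempty_iff_ne_empty]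
        intro h0
        simp only [dens] at hq
        rw [← hQ, h0] at hq
        simp at hq
      obtain ⟨z, hzE, hzQ⟩ := hEQ
      have hQsub : Q ⊆ gridCell o s k m := by
        have h1 : gridIdx o s k z = m := hzE.1
        have := gridCell_subset (o := o) (s := s) (k := k - (p + 1 : ℕ)) (l := k) (by omega)
          (m := m') (x := z) hzQ
        rwa [h1] at this
      have hcst : |a (k - (p + 1 : ℕ)) m' - a k m| ≤ 2 * t := by
        obtain ⟨x, hxQ, hxE, hx⟩ := hpt
        have h1 : |h x - a k m| ≤ t := by
          by_contra! h2
          exact hxE ⟨hQsub hxQ, h2⟩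
        rw [abs_le] at *
        constructor <;> linarith
      calc 2 ^ N * volume (A ∩ Q)
          ≤ 2 ^ N * volume {x ∈ Q | (2 * N + 1) * t < |h x - a (k - (p + 1 : ℕ)) m'|} := by
            gcongr
            rintro x ⟨hxA, hxQ⟩
            refine ⟨hxQ, ?_⟩
            have h1 := hxA.2
            push_cast at h1
            have h2 := abs_sub_abs_le_abs_sub (h x - a k m) (h x - a (k - (p + 1 : ℕ)) m')
            have h3 : h x - a k m - (h x - a (k - (p + 1 : ℕ)) m') =
              a (k - (p + 1 : ℕ)) m' - a k m := by ring
            rw [h3] at h2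
            linarith
        _ ≤ volume Q := ih _ _
        _ ≤ _ := hq.le
    have hA1 : volume A ≤ volume (⋃ q ∈ I, A ∩ cell q) := by
      have h1 : (volume.restrict E) (⋃ q ∈ I, cell q)ᶜ = 0 := hcover
      rw [Measure.restrict_apply (MeasurableSet.compl (MeasurableSet.biUnion
        (Set.to_countable _) fun q _ => measurableSet_gridCell o hs _ _))] at h1
      calc volume A ≤ volume ((⋃ q ∈ I, A ∩ cell q) ∪ ((⋃ q ∈ I, cell q)ᶜ ∩ E)) := by
            apply measure_mono
            intro x hx
            by_cases hxI : x ∈ ⋃ q ∈ I, cell q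
            · left
              simp only [mem_iUnion] at hxI ⊢
              obtain ⟨q, hq, hxq⟩ := hxI
              exact ⟨q, hq, hx, hxq⟩
            · exact Or.inr ⟨hxI, hAE hx⟩
        _ ≤ _ := measure_union_le _ _
        _ = _ := by rw [h1, add_zero]
    have hsum : ∑' q : I, volume (E ∩ cell q) ≤ volume E := by
      have h1 : ∀ q : I, volume (E ∩ cell q) = (volume.restrict E) (cell q) := fun q => by
        rw [Measure.restrict_apply (measurableSet_gridCell o hs _ _), inter_comm]
      simp_rw [h1]
      rw [← measure_biUnion (Set.to_countable I) hdisj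
        fun q _ => measurableSet_gridCell o hs _ _]
      exact (measure_mono (subset_univ _)).trans (by simp)
    calc 2 ^ (N + 1) * volume A ≤ 2 ^ (N + 1) * ∑' q : I, volume (A ∩ cell q) := by
          gcongr
          exact hA1.trans (measure_biUnion_le _ (Set.to_countable I) _)
      _ = 2 * ∑' q : I, 2 ^ N * volume (A ∩ cell q) := by
          rw [ENNReal.tsum_mul_left]; ring
      _ ≤ 2 * ∑' q : I, 2 ^ (n + 1) * volume (E ∩ cell q) := by
          gcongr 2 * ?_
          exact ENNReal.tsum_le_tsum fun q => hloc q q.2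
      _ = 2 ^ (n + 2) * ∑' q : I, volume (E ∩ cell q) := by
          rw [ENNReal.tsum_mul_left]; ring
      _ ≤ 2 ^ (n + 2) * volume E := by gcongr
      _ ≤ _ := H k m

/-- The absolute constant in the quadratic John–Nirenberg inequality. -/
def jnConst : ℝ := 1 + ∑' N : ℕ, (2 * (N : ℝ) + 3) ^ 2 * (1 / 2) ^ N

lemma summable_jn : Summable fun N : ℕ => (2 * (N : ℝ) + 3) ^ 2 * (1 / 2 : ℝ) ^ N := by
  have h : ∀ k : ℕ, Summable fun N : ℕ => (N : ℝ) ^ k * (1 / 2 : ℝ) ^ N := fun k =>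
    summable_pow_mul_geometric_of_norm_lt_one k (by norm_num)
  refine (((h 2).mul_left 4).add (((h 1).mul_left 12).add ((h 0).mul_left 9))).congr fun N => ?_
  ring

/-- The quadratic John–Nirenberg inequality on cubes. -/
lemma lintegral_hcube_sq_le {n : ℕ} {h : Rn n → ℝ} (hm : AEMeasurable h)
    (a : Rn n → ℝ → ℝ) {t : ℝ} (ht : 0 < t)
    (H : ∀ c r, 0 < r → 2 ^ (n + 2) * volume {x ∈ hcube c r | t < |h x - a c r|} ≤
      volume (hcube c r)) (c : Rn n) {r : ℝ} (hr : 0 < r) :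
    ∫⁻ x in hcube c r, ENNReal.ofReal ((h x - a c r) ^ 2) ≤
      ENNReal.ofReal (jnConst * t ^ 2) * volume (hcube c r) := by
  set Q := hcube c r with hQ
  set A : ℕ → Set (Rn n) := fun N => {x | (2 * N + 1) * t < |h x - a c r|} with hA
  have hAm : ∀ N, NullMeasurableSet (A N) volume := fun N =>
    nullMeasurableSet_lt aemeasurable_const
      (continuous_abs.measurable.comp_aemeasurable (hm.sub_const _))
  have hdecay : ∀ N : ℕ, volume (A N ∩ Q) ≤ ENNReal.ofReal ((1 / 2) ^ N) * volume Q := by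
    intro N
    set o : Rn n := WithLp.toLp 2 fun i => c i - r with ho
    have hcell : gridCell o (2 * r) 0 0 = Q := by
      rw [gridCell_eq_hcube o (by positivity), hQ]
      congr 1
      · ext i; simp [gridCentre, ho]; ring
      · simp
    have h1 := two_pow_mul_volume_gridCell_le o (show 0 < 2 * r by positivity) h
      (fun k m => a (gridCentre o (2 * r) k m) (2 * r * 2 ^ k / 2)) ht.le
      (fun k m => by
        rw [gridCell_eq_hcube o (by positivity)]
        exact H _ _ (by positivity)) N 0 0
    have hc : gridCentre o (2 * r) 0 0 = c := by
      ext i; simp [gridCentre, ho]; ring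
    rw [hcell, hc] at h1
    have h2 : 2 * r * (2 : ℝ) ^ (0 : ℤ) / 2 = r := by simp
    rw [h2] at h1
    have h3 : {x ∈ Q | (2 * (N : ℝ) + 1) * t < |h x - a c r|} = A N ∩ Q := by
      ext x; simp [hA, and_comm]
    rw [h3] at h1
    have h4 : ENNReal.ofReal ((1 / 2) ^ N) = (2 ^ N)⁻¹ := by
      rw [one_div_pow, one_div, ENNReal.ofReal_inv_of_pos (by positivity),
        ENNReal.ofReal_pow (by norm_num)]
      norm_num
    rw [h4, mul_comm _ (volume Q), ← div_eq_mul_inv, ENNReal.le_div_iff_mul_le (by simp) (by simp),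
      mul_comm]
    exact h1
  have hpt : ∀ x, ENNReal.ofReal ((h x - a c r) ^ 2) ≤ ENNReal.ofReal (t ^ 2) +
      ∑' N : ℕ, (A N).indicator (fun _ => ENNReal.ofReal (((2 * N + 3) * t) ^ 2)) x := by
    intro x
    set u := |h x - a c r| with hu
    have hu0 : 0 ≤ u := abs_nonneg _
    rw [← sq_abs, ← hu]
    by_cases h1 : u ≤ t
    · exact le_add_right (ENNReal.ofReal_le_ofReal (by gcongr))
    push Not at h1
    have hex : ∃ N : ℕ, u ≤ (2 * N + 3) * t := by
      obtain ⟨N, hN⟩ := exists_nat_ge (u / t)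
      refine ⟨N, ?_⟩
      rw [div_le_iff₀ ht] at hN
      nlinarith
    classical
    obtain ⟨N, hN, hlt⟩ : ∃ N : ℕ, u ≤ (2 * N + 3) * t ∧ (2 * N + 1) * t < u := by
      refine ⟨Nat.find hex, Nat.find_spec hex, ?_⟩
      rcases Nat.eq_zero_or_pos (Nat.find hex) with h0 | h0
      · rw [h0]; simpa using h1
      · have := Nat.find_min hex (m := Nat.find hex - 1) (by omega)
        push Not at this
        rw [Nat.cast_sub (by omega)] at this
        push_cast at this
        linarith
    refine le_add_left (le_trans ?_ (ENNReal.le_tsum N))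
    rw [Set.indicator_of_mem (by exact hlt)]
    exact ENNReal.ofReal_le_ofReal (by gcongr)
  calc ∫⁻ x in Q, ENNReal.ofReal ((h x - a c r) ^ 2)
      ≤ ∫⁻ x in Q, (ENNReal.ofReal (t ^ 2) +
        ∑' N : ℕ, (A N).indicator (fun _ => ENNReal.ofReal (((2 * N + 3) * t) ^ 2)) x) :=
        lintegral_mono hpt
    _ = ENNReal.ofReal (t ^ 2) * volume Q +
        ∑' N : ℕ, ENNReal.ofReal (((2 * N + 3) * t) ^ 2) * volume (A N ∩ Q) := by
        rw [lintegral_add_left measurable_const, lintegral_const, Measure.restrict_apply_univ,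
          lintegral_tsum fun N => (aemeasurable_const.indicator₀ ((hAm N).mono_ac
            Measure.restrict_le_self.absolutelyContinuous))]
        congr 1
        refine tsum_congr fun N => ?_
        rw [lintegral_indicator₀ ((hAm N).mono_ac
            Measure.restrict_le_self.absolutelyContinuous), lintegral_const,
          Measure.restrict_apply_univ, Measure.restrict_apply₀ ((hAm N).mono_ac
            Measure.restrict_le_self.absolutelyContinuous)]
    _ ≤ ENNReal.ofReal (t ^ 2) * volume Q +
        ∑' N : ℕ, ENNReal.ofReal ((2 * N + 3) ^ 2 * (1 / 2) ^ N) *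
          (ENNReal.ofReal (t ^ 2) * volume Q) := by
        refine add_le_add le_rfl (ENNReal.tsum_le_tsum fun N => ?_)
        calc ENNReal.ofReal (((2 * N + 3) * t) ^ 2) * volume (A N ∩ Q)
            ≤ ENNReal.ofReal (((2 * N + 3) * t) ^ 2) *
              (ENNReal.ofReal ((1 / 2) ^ N) * volume Q) := by gcongr; exact hdecay N
          _ = ENNReal.ofReal ((2 * N + 3) ^ 2 * (1 / 2) ^ N) *
              (ENNReal.ofReal (t ^ 2) * volume Q) := by
              rw [← mul_assoc, ← mul_assoc, ← ENNReal.ofReal_mul (by positivity),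
                ← ENNReal.ofReal_mul (by positivity)]
              congr 2; ring
    _ = _ := by
        rw [ENNReal.tsum_mul_right, ← ENNReal.ofReal_tsum_of_nonneg (fun N => by positivity)
          summable_jn]
        have h0 : 0 ≤ ∑' N : ℕ, (2 * (N : ℝ) + 3) ^ 2 * (1 / 2 : ℝ) ^ N :=
          tsum_nonneg fun N => by positivity
        rw [jnConst, ENNReal.ofReal_mul (by positivity), ENNReal.ofReal_add zero_le_one h0,
          ENNReal.ofReal_one]
        ring

lemma jnConst_pos : 0 < jnConst := by
  have h0 : 0 ≤ ∑' N : ℕ, (2 * (N : ℝ) + 3) ^ 2 * (1 / 2 : ℝ) ^ N :=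
    tsum_nonneg fun N => by positivity
  unfold jnConst; linarith

/-- A globally monotone, doubling modulus of continuity with a summability property. -/
structure Modulus (ω : ℝ → ℝ) (D : ℝ) : Prop where
  mono : Monotone ω
  nonneg : ∀ t, 0 ≤ ω t
  one_le : 1 ≤ D
  doubling : ∀ t, ω (2 * t) ≤ D * ω t
  summable : Summable fun k : ℕ => √(ω ((1 / 2) ^ k)) * (1 + (k : ℝ)) ^ 2

/-- `b` is locally integrable with mean oscillation at most `M`. -/
structure IsBMO {n : ℕ} (b : Rn n → ℝ) (M : ℝ) : Prop where
  locallyIntegrable : LocallyIntegrable b volume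
  osc : OscBound b M
  nonneg : 0 ≤ M

lemma Modulus.exists_le {ω : ℝ → ℝ} {D : ℝ} (hω : Modulus ω D) {ε : ℝ} (hε : 0 < ε) :
    ∃ δ > 0, ∀ t ≤ δ, ω t ≤ ε := by
  have h := hω.summable.tendsto_atTop_zero
  obtain ⟨k, hk⟩ := (h.eventually (gt_mem_nhds (Real.sqrt_pos.2 hε))).exists
  refine ⟨(1 / 2) ^ k, by positivity, fun t ht => (hω.mono ht).trans ?_⟩
  have h1 : √(ω ((1 / 2) ^ k)) ≤ √(ω ((1 / 2) ^ k)) * (1 + (k : ℝ)) ^ 2 :=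
    le_mul_of_one_le_right (Real.sqrt_nonneg _) (one_le_pow₀ (by simp))
  exact (Real.sqrt_le_sqrt_iff hε.le).1 (h1.trans hk.le)

section BMO

variable {n : ℕ} {b : Rn n → ℝ} {M : ℝ}

lemma IsBMO.integrableOn_cube (hb : IsBMO b M) (c : Rn n) (r : ℝ) :
    IntegrableOn b (cube c (2 * r)) :=
  hb.locallyIntegrable.integrableOn_isCompact (isCompact_cube c r)

lemma IsBMO.aemeasurable (hb : IsBMO b M) : AEMeasurable b :=
  hb.locallyIntegrable.aestronglyMeasurable.aemeasurable

lemma IsBMO.integral_cube_le (hb : IsBMO b M) (c : Rn n) {r : ℝ} (hr : 0 < r) :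
    ∫ x in cube c (2 * r), |b x - avgOn b (cube c (2 * r))| ≤ M * (2 * r) ^ n := by
  have h := hb.osc c (2 * r) (by positivity)
  rw [setAverage_eq, measureReal_def, volume_cube c hr.le,
    ENNReal.toReal_ofReal (by positivity), smul_eq_mul, inv_mul_le_iff₀ (by positivity)] at h
  linarith

lemma IsBMO.integrableOn_abs (hb : IsBMO b M) (c : Rn n) (r β : ℝ) :
    IntegrableOn (fun x => |b x - β|) (cube c (2 * r)) := by
  refine ((hb.integrableOn_cube c r).sub (integrableOn_const ?_)).abs
  exact (isCompact_cube c r).measure_lt_top.ne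

/-- The mean oscillation over a cube, as a lower integral. -/
lemma IsBMO.lintegral_cube_le (hb : IsBMO b M) (c : Rn n) {r : ℝ} (hr : 0 < r) :
    ∫⁻ x in cube c (2 * r), ‖b x - avgOn b (cube c (2 * r))‖ₑ ≤
      ENNReal.ofReal (M * (2 * r) ^ n) := by
  have h := hb.integral_cube_le c hr
  have h2 := ofReal_integral_eq_lintegral_ofReal (hb.integrableOn_abs c r
    (avgOn b (cube c (2 * r)))) (Filter.Eventually.of_forall fun x => abs_nonneg _)
  simp_rw [Real.enorm_eq_ofReal_abs]
  rw [← h2]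
  exact ENNReal.ofReal_le_ofReal h

lemma IsBMO.abs_avgOn_sub_le (hb : IsBMO b M) (c : Rn n) {r : ℝ} (hr : 0 < r) :
    |avgOn b (cube c (2 * r)) - avgOn b (cube c (2 * (2 * r)))| ≤ 2 ^ n * M := by
  set β := avgOn b (cube c (2 * (2 * r)))
  have hv : volume.real (cube c (2 * r)) = (2 * r) ^ n := by
    rw [measureReal_def, volume_cube c hr.le, ENNReal.toReal_ofReal (by positivity)]
  have h1 : avgOn b (cube c (2 * r)) - β =
      ((2 * r) ^ n)⁻¹ * ∫ x in cube c (2 * r), (b x - β) := by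
    rw [integral_sub (hb.integrableOn_cube c r)
      (integrableOn_const (isCompact_cube c r).measure_lt_top.ne), avgOn, setAverage_eq, hv,
      setIntegral_const, hv, smul_eq_mul, smul_eq_mul]
    field_simp
  have h2 : |∫ x in cube c (2 * r), (b x - β)| ≤ M * (2 * (2 * r)) ^ n :=
    calc |∫ x in cube c (2 * r), (b x - β)| ≤ ∫ x in cube c (2 * r), |b x - β| :=
          abs_integral_le_integral_abs
      _ ≤ ∫ x in cube c (2 * (2 * r)), |b x - β| :=
          setIntegral_mono_set (hb.integrableOn_abs c _ _)
            (Filter.Eventually.of_forall fun x => abs_nonneg _)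
            (cube_subset_cube c (by linarith)).eventuallyLE
      _ ≤ _ := hb.integral_cube_le c (by positivity)
  rw [h1, abs_mul, abs_of_pos (by positivity : (0:ℝ) < ((2 * r) ^ n)⁻¹),
    inv_mul_le_iff₀ (by positivity)]
  refine h2.trans (le_of_eq ?_)
  rw [mul_pow 2 (2 * r)]; ring

lemma IsBMO.abs_avgOn_pow_sub_le (hb : IsBMO b M) (c : Rn n) {r : ℝ} (hr : 0 < r) (k : ℕ) :
    |avgOn b (cube c (2 * (2 ^ k * r))) - avgOn b (cube c (2 * r))| ≤ k * (2 ^ n * M) := by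
  induction k with
  | zero => simp
  | succ k ih =>
    have h := hb.abs_avgOn_sub_le c (r := 2 ^ k * r) (by positivity)
    rw [show 2 * (2 * (2 ^ k * r)) = 2 * (2 ^ (k + 1) * r) by rw [pow_succ]; ring,
      abs_sub_comm] at h
    push_cast
    calc _ ≤ _ := abs_sub_le _ (avgOn b (cube c (2 * (2 ^ k * r)))) _
      _ ≤ _ := by linarith

/-- The exponent-two John–Nirenberg constant of a `BMO` function. -/
def bmoConst (n : ℕ) (M : ℝ) : ℝ := jnConst * (2 ^ (n + 2) * (M + 1)) ^ 2

lemma IsBMO.lintegral_hcube_sq_le (hb : IsBMO b M) (c : Rn n) {r : ℝ} (hr : 0 < r) :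
    ∫⁻ x in hcube c r, ENNReal.ofReal ((b x - avgOn b (cube c (2 * r))) ^ 2) ≤
      ENNReal.ofReal (bmoConst n M) * volume (hcube c r) := by
  have hM := hb.nonneg
  refine _root_.lintegral_hcube_sq_le hb.aemeasurable (fun c r => avgOn b (cube c (2 * r)))
    (t := 2 ^ (n + 2) * (M + 1)) (by positivity) (fun c r hr => ?_) c hr
  set β := avgOn b (cube c (2 * r))
  have h1 := mul_meas_ge_le_lintegral₀ (μ := volume.restrict (cube c (2 * r)))
    (f := fun x => ‖b x - β‖ₑ) (hb.aemeasurable.restrict.sub_const β).enorm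
    (ENNReal.ofReal (2 ^ (n + 2) * (M + 1)))
  have h2 := h1.trans (hb.lintegral_cube_le c hr)
  have h3 : volume {x ∈ hcube c r | 2 ^ (n + 2) * (M + 1) < |b x - β|} ≤
      volume.restrict (cube c (2 * r))
        {x | ENNReal.ofReal (2 ^ (n + 2) * (M + 1)) ≤ ‖b x - β‖ₑ} := by
    refine le_trans (measure_mono fun x hx => ?_) (Measure.le_restrict_apply _ _)
    refine ⟨?_, hcube_subset_cube c r hx.1⟩
    simp only [mem_ofPred_eq, Real.enorm_eq_ofReal_abs]
    exact ENNReal.ofReal_le_ofReal hx.2.le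
  rw [volume_hcube c hr.le]
  have hp : ENNReal.ofReal (M + 1) ≠ 0 := by simp; positivity
  refine (ENNReal.mul_le_mul_iff_right hp ENNReal.ofReal_ne_top).1 ?_
  calc ENNReal.ofReal (M + 1) *
        (2 ^ (n + 2) * volume {x ∈ hcube c r | 2 ^ (n + 2) * (M + 1) < |b x - β|})
      = ENNReal.ofReal (2 ^ (n + 2) * (M + 1)) *
        volume {x ∈ hcube c r | 2 ^ (n + 2) * (M + 1) < |b x - β|} := by
        rw [ENNReal.ofReal_mul (by positivity), ENNReal.ofReal_pow (by norm_num)]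
        norm_num; ring
    _ ≤ _ := (mul_le_mul' le_rfl h3).trans h2
    _ ≤ _ := by
        rw [← ENNReal.ofReal_mul (by positivity)]
        exact ENNReal.ofReal_le_ofReal (by gcongr; linarith)

lemma bmoConst_nonneg (hM : 0 ≤ M) : 0 ≤ bmoConst n M := by
  have := jnConst_pos
  unfold bmoConst; positivity

lemma IsBMO.lintegral_hcube_pow_sq_le (hb : IsBMO b M) (c : Rn n) {r : ℝ} (hr : 0 < r) (k : ℕ) :
    ∫⁻ x in hcube c (2 ^ k * r), ENNReal.ofReal ((b x - avgOn b (cube c (2 * r))) ^ 2) ≤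
      ENNReal.ofReal ((2 * bmoConst n M + 2 * (2 ^ n * M) ^ 2) * (1 + (k : ℝ)) ^ 2) *
        volume (hcube c (2 ^ k * r)) := by
  have hM := hb.nonneg
  have hB := bmoConst_nonneg (n := n) hM
  set β := avgOn b (cube c (2 * r))
  set β' := avgOn b (cube c (2 * (2 ^ k * r)))
  have hk := hb.abs_avgOn_pow_sub_le c hr k
  calc ∫⁻ x in hcube c (2 ^ k * r), ENNReal.ofReal ((b x - β) ^ 2)
      ≤ ∫⁻ x in hcube c (2 ^ k * r), (2 * ENNReal.ofReal ((b x - β') ^ 2) +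
          ENNReal.ofReal (2 * (k * (2 ^ n * M)) ^ 2)) := by
        refine lintegral_mono fun x => ?_
        have h2 : (2 : ℝ≥0∞) = ENNReal.ofReal 2 := by simp
        rw [h2, ← ENNReal.ofReal_mul (by norm_num), ← ENNReal.ofReal_add (by positivity)
          (by positivity)]
        refine ENNReal.ofReal_le_ofReal ?_
        have h3 : (β' - β) ^ 2 ≤ (k * (2 ^ n * M)) ^ 2 := by
          rw [← sq_abs]; exact pow_le_pow_left₀ (abs_nonneg _) hk 2
        nlinarith [sq_nonneg ((b x - β') - (β' - β))]
    _ = 2 * (∫⁻ x in hcube c (2 ^ k * r), ENNReal.ofReal ((b x - β') ^ 2)) +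
          ENNReal.ofReal (2 * (k * (2 ^ n * M)) ^ 2) * volume (hcube c (2 ^ k * r)) := by
        rw [lintegral_add_right _ measurable_const, lintegral_const_mul' _ _ (by simp),
          lintegral_const, Measure.restrict_apply_univ]
    _ ≤ 2 * (ENNReal.ofReal (bmoConst n M) * volume (hcube c (2 ^ k * r))) +
          ENNReal.ofReal (2 * (k * (2 ^ n * M)) ^ 2) * volume (hcube c (2 ^ k * r)) := by
        gcongr
        exact hb.lintegral_hcube_sq_le c (by positivity)
    _ = ENNReal.ofReal (2 * bmoConst n M + 2 * (k * (2 ^ n * M)) ^ 2) *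
          volume (hcube c (2 ^ k * r)) := by
        rw [ENNReal.ofReal_add (by positivity) (by positivity), ENNReal.ofReal_mul (by norm_num)]
        norm_num; ring
    _ ≤ _ := by
        gcongr
        have hk0 : (0 : ℝ) ≤ k := by positivity
        have h1 : 2 * bmoConst n M * 1 ≤ 2 * bmoConst n M * (1 + (k : ℝ)) ^ 2 := by
          gcongr; nlinarith
        have h2 : (k * (2 ^ n * M)) ^ 2 ≤ (2 ^ n * M) ^ 2 * (1 + (k : ℝ)) ^ 2 := by
          rw [mul_pow, mul_comm]; gcongr; linarith
        linarith

end BMO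

/-- The integrable weight attached to the ball of centre `c` and radius `ρ`. -/
def wt {n : ℕ} (ω : ℝ → ℝ) (c : Rn n) (ρ : ℝ) (x : Rn n) : ℝ≥0∞ :=
  ENNReal.ofReal (√(ω (ρ / (ρ + ‖x - c‖))) / (ρ + ‖x - c‖) ^ n)

section Weight

variable {n : ℕ} {ω : ℝ → ℝ} {D : ℝ}

lemma Modulus.measurable_wt (hω : Modulus ω D) (c : Rn n) (ρ : ℝ) : Measurable (wt ω c ρ) := by
  have h := hω.mono.measurable
  have h2 : Measurable fun x : Rn n => ρ / (ρ + ‖x - c‖) := by fun_prop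
  unfold wt
  have h3 := h.comp h2
  have h4 : Measurable fun x : Rn n => (ρ + ‖x - c‖) ^ n := by fun_prop
  exact (h3.sqrt.div h4).ennreal_ofReal

lemma Modulus.wt_le_tsum (hω : Modulus ω D) (c : Rn n) {ρ : ℝ} (hρ : 0 < ρ) (x : Rn n) :
    wt ω c ρ x ≤ ∑' k : ℕ, (hcube c (2 ^ k * ρ)).indicator (fun _ => ENNReal.ofReal
      (√D * √(ω ((1 / 2) ^ k)) * 2 ^ n / (2 ^ k * ρ) ^ n)) x := by
  classical
  have hex : ∃ k : ℕ, x ∈ hcube c (2 ^ k * ρ) := by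
    obtain ⟨k, hk⟩ := pow_unbounded_of_one_lt (‖x - c‖ / ρ) (one_lt_two)
    exact ⟨k, mem_hcube_of_norm_lt ((div_lt_iff₀ hρ).1 hk)⟩
  set k := Nat.find hex with hk
  have hR : 2 ^ k * ρ / 2 ≤ ρ + ‖x - c‖ := by
    have h0 := norm_nonneg (x - c)
    rcases Nat.eq_zero_or_pos k with h | h
    · rw [h]; linarith
    · have := Nat.find_min hex (m := k - 1) (by omega)
      have h1 : 2 ^ (k - 1) * ρ ≤ ‖x - c‖ := by
        by_contra hc
        exact this (mem_hcube_of_norm_lt (not_le.1 hc))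
      have h2 : (2 : ℝ) ^ k = 2 * 2 ^ (k - 1) := by rw [← pow_succ']; congr 1; omega
      rw [h2]; linarith
  refine le_trans ?_ (ENNReal.le_tsum k)
  rw [Set.indicator_of_mem (Nat.find_spec hex)]
  refine ENNReal.ofReal_le_ofReal ?_
  have hpos : 0 < 2 ^ k * ρ / 2 := by positivity
  have h1 : ω (ρ / (ρ + ‖x - c‖)) ≤ D * ω ((1 / 2) ^ k) := by
    refine le_trans (hω.mono ?_) (hω.doubling _)
    calc ρ / (ρ + ‖x - c‖) ≤ ρ / (2 ^ k * ρ / 2) := by gcongr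
      _ = 2 * (1 / 2) ^ k := by rw [one_div_pow]; field_simp
  calc √(ω (ρ / (ρ + ‖x - c‖))) / (ρ + ‖x - c‖) ^ n
      ≤ √(D * ω ((1 / 2) ^ k)) / (2 ^ k * ρ / 2) ^ n := by
        gcongr
    _ = _ := by
        rw [Real.sqrt_mul (by linarith [hω.one_le]), div_pow _ _ n, div_div_eq_mul_div]

/-- The weighted square oscillation of a `BMO` function is bounded. -/
lemma Modulus.lintegral_wt_le (hω : Modulus ω D) (n : ℕ) (M : ℝ) : ∃ C : ℝ≥0, ∀ b : Rn n → ℝ,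
    IsBMO b M → ∀ (c : Rn n) (ρ : ℝ), 0 < ρ →
      ∫⁻ x, wt ω c ρ x * (1 + ENNReal.ofReal ((b x - avgOn b (cube c (2 * ρ))) ^ 2)) ≤ C := by
  set B := 1 + (2 * bmoConst n M + 2 * (2 ^ n * M) ^ 2) with hB
  refine ⟨(∑' k : ℕ, √D * 4 ^ n * B * (√(ω ((1 / 2) ^ k)) * (1 + (k : ℝ)) ^ 2)).toNNReal,
    fun b hb c ρ hρ => ?_⟩
  have hM := hb.nonneg
  have hB0 : 0 ≤ B := by have := bmoConst_nonneg (n := n) hM; positivity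
  set β := avgOn b (cube c (2 * ρ))
  set F : Rn n → ℝ≥0∞ := fun x => 1 + ENNReal.ofReal ((b x - β) ^ 2) with hF
  have hFm : AEMeasurable F :=
    (((hb.aemeasurable.sub_const β).pow_const 2).ennreal_ofReal).const_add 1
  set w : ℕ → ℝ := fun k => √D * √(ω ((1 / 2) ^ k)) * 2 ^ n / (2 ^ k * ρ) ^ n with hw
  have hw0 : ∀ k, 0 ≤ w k := fun k => by positivity
  have hint : ∀ k : ℕ, ∫⁻ x in hcube c (2 ^ k * ρ), F x ≤
      ENNReal.ofReal (B * (1 + (k : ℝ)) ^ 2 * (2 * (2 ^ k * ρ)) ^ n) := by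
    intro k
    rw [hF, lintegral_add_left measurable_const, lintegral_const, Measure.restrict_apply_univ]
    refine (add_le_add le_rfl (hb.lintegral_hcube_pow_sq_le c hρ k)).trans ?_
    have hbc := bmoConst_nonneg (n := n) hM
    rw [volume_hcube c (by positivity), ← ENNReal.ofReal_one, ← ENNReal.ofReal_mul (by norm_num),
      ← ENNReal.ofReal_mul (by positivity), ← ENNReal.ofReal_add (by positivity) (by positivity)]
    refine ENNReal.ofReal_le_ofReal ?_
    rw [← add_mul]
    refine mul_le_mul_of_nonneg_right ?_ (by positivity)
    have hk : 1 ≤ (1 + (k : ℝ)) ^ 2 := one_le_pow₀ (by simp)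
    rw [hB, add_mul]
    linarith
  calc ∫⁻ x, wt ω c ρ x * F x
      ≤ ∫⁻ x, ∑' k : ℕ, (hcube c (2 ^ k * ρ)).indicator
          (fun x => ENNReal.ofReal (w k) * F x) x := by
        refine lintegral_mono fun x => ?_
        refine (mul_le_mul' (hω.wt_le_tsum c hρ x) le_rfl).trans (le_of_eq ?_)
        rw [← ENNReal.tsum_mul_right]
        refine tsum_congr fun k => ?_
        by_cases hx : x ∈ hcube c (2 ^ k * ρ) <;> simp [hx, hw]
    _ = ∑' k : ℕ, ENNReal.ofReal (w k) * ∫⁻ x in hcube c (2 ^ k * ρ), F x := by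
        rw [lintegral_tsum fun k => (hFm.const_mul _).indicator (measurableSet_hcube _ _)]
        refine tsum_congr fun k => ?_
        rw [lintegral_indicator (measurableSet_hcube _ _), lintegral_const_mul' _ _ (by simp)]
    _ ≤ ∑' k : ℕ, ENNReal.ofReal (√D * 4 ^ n * B * (√(ω ((1 / 2) ^ k)) * (1 + (k : ℝ)) ^ 2)) := by
        refine ENNReal.tsum_le_tsum fun k => ?_
        refine (mul_le_mul' le_rfl (hint k)).trans (le_of_eq ?_)
        rw [← ENNReal.ofReal_mul (hw0 k)]
        congr 1
        rw [hw, mul_pow 2 (2 ^ k * ρ), show (4 : ℝ) = 2 * 2 by norm_num, mul_pow 2 2 n]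
        field_simp
    _ = _ := by
        rw [← ENNReal.ofReal_tsum_of_nonneg (fun k => by positivity) (hω.summable.mul_left _)]
        rfl

lemma Modulus.wt_split (hω : Modulus ω D) {ρ ρ' R : ℝ} (hρ : 0 < ρ) (hρ' : 0 < ρ')
    (c c' x y : Rn n) (h : (ρ + ‖x - c‖) / 2 ≤ R) (h' : (ρ' + ‖y - c'‖) / 2 ≤ R) :
    ENNReal.ofReal (√(ω (ρ / R)) * √(ω (ρ' / R)) / R ^ (2 * n)) ≤
      ENNReal.ofReal (D * 4 ^ n) * (wt ω c ρ x * wt ω c' ρ' y) := by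
  have h1 : 0 < ρ + ‖x - c‖ := by positivity
  have h2 : 0 < ρ' + ‖y - c'‖ := by positivity
  have hR : 0 < R := by linarith
  have hD : 0 ≤ D := by linarith [hω.one_le]
  have key : ∀ {a S : ℝ}, 0 < a → 0 < S → S / 2 ≤ R →
      √(ω (a / R)) / R ^ n ≤ √D * 2 ^ n * (√(ω (a / S)) / S ^ n) := by
    intro a S ha hS hSR
    have e1 : √(ω (a / R)) ≤ √D * √(ω (a / S)) := by
      rw [← Real.sqrt_mul hD]
      refine Real.sqrt_le_sqrt (le_trans (hω.mono ?_) (hω.doubling _))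
      calc a / R ≤ a / (S / 2) := by gcongr
        _ = 2 * (a / S) := by field_simp
    calc √(ω (a / R)) / R ^ n ≤ (√D * √(ω (a / S))) / (S / 2) ^ n := by gcongr
      _ = _ := by rw [div_pow]; field_simp
  unfold wt
  rw [← ENNReal.ofReal_mul (by positivity), ← ENNReal.ofReal_mul (by positivity)]
  refine ENNReal.ofReal_le_ofReal ?_
  calc √(ω (ρ / R)) * √(ω (ρ' / R)) / R ^ (2 * n)
      = (√(ω (ρ / R)) / R ^ n) * (√(ω (ρ' / R)) / R ^ n) := by
        rw [two_mul, pow_add]; field_simp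
    _ ≤ (√D * 2 ^ n * (√(ω (ρ / (ρ + ‖x - c‖))) / (ρ + ‖x - c‖) ^ n)) *
        (√D * 2 ^ n * (√(ω (ρ' / (ρ' + ‖y - c'‖))) / (ρ' + ‖y - c'‖) ^ n)) :=
        mul_le_mul (key hρ h1 h) (key hρ' h2 h') (by positivity) (by positivity)
    _ = (√D * √D) * (2 * 2) ^ n * ((√(ω (ρ / (ρ + ‖x - c‖))) / (ρ + ‖x - c‖) ^ n) *
        (√(ω (ρ' / (ρ' + ‖y - c'‖))) / (ρ' + ‖y - c'‖) ^ n)) := by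
        rw [mul_pow 2 2]; ring
    _ = _ := by rw [Real.mul_self_sqrt hD]; norm_num

end Weight

/-- A bilinear Calderón–Zygmund operator of `ω` type with weak `L¹ × L¹ → L^{1/2}` bound. -/
structure CZOp {n : ℕ} (ω : ℝ → ℝ) (D C₀ C₂ : ℝ) (K : Rn n → Rn n → Rn n → ℝ)
    (T : (Rn n → ℝ) → (Rn n → ℝ) → Rn n → ℝ) : Prop where
  one_le_dim : 1 ≤ n
  mod : Modulus ω D
  pos₀ : 0 < C₀
  pos₂ : 0 < C₂
  ker : IsCZKernel2 C₀ ω K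
  meas : ∀ f g : Rn n → ℝ, Integrable f → Integrable g → Measurable (T f g)
  bilin : Bilin2 T
  rep : KernelRep2 K T
  weak : ∀ f g : Rn n → ℝ, Integrable f → Integrable g → ∀ lam : ℝ, 0 < lam →
    volume {x | lam < |T f g x|} ≤
      ENNReal.ofReal ((C₂ * l1norm f * l1norm g / lam) ^ ((1 : ℝ) / 2))

/-- An integrable function of integral zero vanishing off the ball of centre `c`, radius `ρ`. -/
structure IsMol {n : ℕ} (c : Rn n) (ρ : ℝ) (h : Rn n → ℝ) : Prop where
  pos : 0 < ρ
  integrable : Integrable h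
  eq_zero : ∀ x, ρ < ‖x - c‖ → h x = 0
  integral_eq_zero : ∫ x, h x = 0

lemma IsMol.hasCompactSupport {n : ℕ} {c : Rn n} {ρ : ℝ} {h : Rn n → ℝ} (hh : IsMol c ρ h) :
    HasCompactSupport h :=
  HasCompactSupport.intro (isCompact_closedBall c ρ) fun x hx => hh.eq_zero x (by
    simpa [dist_eq_norm] using hx)

lemma IsMol.notMem_tsupport {n : ℕ} {c : Rn n} {ρ : ℝ} {h : Rn n → ℝ} (hh : IsMol c ρ h)
    {x : Rn n} (hx : ρ < ‖x - c‖) : x ∉ tsupport h := fun hx' => by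
  have h1 : tsupport h ⊆ Metric.closedBall c ρ :=
    closure_minimal (fun y hy => by
      by_contra hc
      exact hy (hh.eq_zero y (by simpa [dist_eq_norm] using hc))) Metric.isClosed_closedBall
  have := h1 hx'
  rw [Metric.mem_closedBall, dist_eq_norm] at this
  linarith

namespace CZOp

variable {n : ℕ} {ω : ℝ → ℝ} {D C₀ C₂ : ℝ} {K : Rn n → Rn n → Rn n → ℝ}
  {T : (Rn n → ℝ) → (Rn n → ℝ) → Rn n → ℝ}

lemma swap (hT : CZOp ω D C₀ C₂ K T) :
    CZOp ω D C₀ C₂ (fun x y₁ y₂ => K x y₂ y₁) (fun f g => T g f) where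
  one_le_dim := hT.one_le_dim
  mod := hT.mod
  pos₀ := hT.pos₀
  pos₂ := hT.pos₂
  ker := by
    obtain ⟨h1, h2, h3, h4⟩ := hT.ker
    have e : ∀ x y₁ y₂ : Rn n, ¬(x = y₁ ∧ y₁ = y₂) → ¬(x = y₂ ∧ y₂ = y₁) := by
      rintro x y₁ y₂ h ⟨rfl, rfl⟩; exact h ⟨rfl, rfl⟩
    refine ⟨fun x y₁ y₂ h => ?_, fun x x' y₁ y₂ h h' => ?_, fun x y₁ y₁' y₂ h h' => ?_,
      fun x y₁ y₂ y₂' h h' => ?_⟩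
    · rw [add_comm]; exact h1 _ _ _ (e _ _ _ h)
    · rw [add_comm ‖x - y₁‖]; exact h2 _ _ _ _ (e _ _ _ h) (by rwa [max_comm])
    · rw [add_comm ‖x - y₁‖]; exact h4 _ _ _ _ (e _ _ _ h) (by rwa [max_comm])
    · rw [add_comm ‖x - y₁‖]; exact h3 _ _ _ _ (e _ _ _ h) (by rwa [max_comm])
  meas f g hf hg := hT.meas g f hg hf
  bilin := ⟨fun f f' g hf hf' hg => hT.bilin.2.2.1 g f f' hg hf hf',
    fun r f g hf hg => hT.bilin.2.2.2 r g f hg hf,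
    fun f g g' hf hg hg' => hT.bilin.1 g g' f hg hg' hf,
    fun r f g hf hg => hT.bilin.2.1 r g f hg hf⟩
  rep f g hf hg hcf hcg := by
    filter_upwards [hT.rep g f hg hf hcg hcf] with x hx hxn
    rw [hx (by rwa [inter_comm])]
    rw [Measure.volume_eq_prod, ← integral_prod_swap]
    refine integral_congr_ae (Filter.Eventually.of_forall fun y => ?_)
    simp only [Prod.fst_swap, Prod.snd_swap]; ring
  weak f g hf hg lam hl := by
    have := hT.weak g f hg hf lam hl
    rwa [mul_right_comm] at this

lemma measurable_kernel (hT : CZOp ω D C₀ C₂ K T) (x : Rn n) :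
    Measurable fun y : Rn n × Rn n => K x y.1 y.2 := by
  refine measurable_of_continuousOn_compl_singleton (x, x) fun y hy => ContinuousAt.continuousWithinAt ?_
  obtain ⟨y₁, y₂⟩ := y
  obtain ⟨-, -, h3, h4⟩ := hT.ker
  set S := ‖x - y₁‖ + ‖x - y₂‖ with hS
  have hS0 : 0 < S := by
    by_contra hc
    have h1 := norm_nonneg (x - y₁)
    have h2 := norm_nonneg (x - y₂)
    have e1 : ‖x - y₁‖ = 0 := by linarith
    have e2 : ‖x - y₂‖ = 0 := by linarith
    rw [norm_eq_zero, sub_eq_zero] at e1 e2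
    exact hy (by rw [mem_singleton_iff, ← e1, ← e2])
  have hC := hT.pos₀
  rw [Metric.continuousAt_iff]
  intro ε hε
  set A := C₀ / (S / 2) ^ (2 * n) with hA
  have hA0 : 0 < A := by positivity
  obtain ⟨δ, hδ, hωδ⟩ := hT.mod.exists_le (show 0 < ε / (4 * A) by positivity)
  refine ⟨min (S / 8) (δ * (S / 2)), by positivity, fun {y'} hy' => ?_⟩
  obtain ⟨y₁', y₂'⟩ := y'
  rw [Prod.dist_eq, max_lt_iff, dist_comm, dist_eq_norm, dist_comm, dist_eq_norm] at hy'
  simp only at hy'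
  obtain ⟨⟨a1, a2⟩, b1, b2⟩ := hy'.imp lt_min_iff.1 lt_min_iff.1
  have tri : ‖x - y₁‖ ≤ ‖x - y₁'‖ + ‖y₁ - y₁'‖ := by
    have := norm_sub_le (x - y₁') (y₁ - y₁')
    simpa using this
  set S' := ‖x - y₁'‖ + ‖x - y₂‖ with hS'
  have hSS' : S / 2 ≤ S' := by linarith
  have hne : ∀ a b : Rn n, 0 < ‖x - a‖ + ‖x - b‖ → ¬(x = a ∧ a = b) := by
    rintro a b h ⟨rfl, rfl⟩; simp at h
  have m1 : S ≤ 2 * max ‖x - y₁‖ ‖x - y₂‖ := by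
    linarith [le_max_left ‖x - y₁‖ ‖x - y₂‖, le_max_right ‖x - y₁‖ ‖x - y₂‖]
  have m2 : S' ≤ 2 * max ‖x - y₁'‖ ‖x - y₂‖ := by
    linarith [le_max_left ‖x - y₁'‖ ‖x - y₂‖, le_max_right ‖x - y₁'‖ ‖x - y₂‖]
  have k1 := h3 x y₁ y₁' y₂ (hne _ _ hS0) (by linarith)
  have k2 := h4 x y₁' y₂ y₂' (hne _ _ (by linarith)) (by linarith)
  rw [← hS] at k1
  rw [← hS'] at k2
  have w1 : ω (‖y₁ - y₁'‖ / S) ≤ ε / (4 * A) := hωδ _ (by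
    rw [div_le_iff₀ hS0]; nlinarith)
  have w2 : ω (‖y₂ - y₂'‖ / S') ≤ ε / (4 * A) := hωδ _ (by
    rw [div_le_iff₀ (by linarith)]; nlinarith)
  have c1 : C₀ / S ^ (2 * n) ≤ A := by rw [hA]; gcongr; linarith
  have c2 : C₀ / S' ^ (2 * n) ≤ A := by rw [hA]; gcongr
  have e : A * (ε / (4 * A)) = ε / 4 := by field_simp
  have f1 := mul_le_mul c1 w1 (hT.mod.nonneg _) hA0.le
  have f2 := mul_le_mul c2 w2 (hT.mod.nonneg _) hA0.le
  rw [dist_comm, Real.dist_eq]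
  calc |K x y₁ y₂ - K x y₁' y₂'| ≤ _ := abs_sub_le _ (K x y₁' y₂) _
    _ < ε := by linarith

/-- The basic pointwise bound obtained by cancellation in the first slot. -/
lemma enorm_le_of_isMol (hT : CZOp ω D C₀ C₂ K T) {c : Rn n} {ρ : ℝ} {h ψ : Rn n → ℝ} {x : Rn n}
    (hh : IsMol c ρ h) (hψ : Integrable ψ)
    (hrep : T h ψ x = ∫ y : Rn n × Rn n, K x y.1 y.2 * h y.1 * ψ y.2)
    {R : Rn n → ℝ} (hRm : Measurable R)
    (hR : ∀ y₁, ‖y₁ - c‖ ≤ ρ → ∀ y₂, ψ y₂ ≠ 0 → ρ ≤ 1 / 2 * max ‖x - y₁‖ ‖x - y₂‖ ∧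
      0 < R y₂ ∧ R y₂ ≤ ‖x - y₁‖ + ‖x - y₂‖) :
    ‖T h ψ x‖ₑ ≤ (∫⁻ y, ‖h y‖ₑ) *
      ∫⁻ y, ‖ψ y‖ₑ * ENNReal.ofReal (C₀ * (ω (ρ / R y) / R y ^ (2 * n))) := by
  set F : Rn n × Rn n → ℝ := fun y => K x y.1 y.2 * h y.1 * ψ y.2 with hF
  set G : Rn n × Rn n → ℝ := fun y => h y.1 * (K x c y.2 * ψ y.2) with hG
  have hKm := hT.measurable_kernel x
  have hC := hT.pos₀
  have hψm : AEMeasurable fun y => ‖ψ y‖ₑ *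
      ENNReal.ofReal (C₀ * (ω (ρ / R y) / R y ^ (2 * n))) :=
    hψ.aestronglyMeasurable.enorm.mul (Measurable.aemeasurable (by
      have := hT.mod.mono.measurable; fun_prop))
  rw [hrep, ← lintegral_prod_mul hh.integrable.aestronglyMeasurable.enorm hψm]
  by_cases hFi : Integrable F (volume.prod volume)
  swap
  · rw [Measure.volume_eq_prod, integral_undef hFi]; simp
  by_cases hB : ∫⁻ y : Rn n × Rn n, ‖h y.1‖ₑ * (‖ψ y.2‖ₑ *
      ENNReal.ofReal (C₀ * (ω (ρ / R y.2) / R y.2 ^ (2 * n)))) ∂(volume.prod volume) = ⊤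
  · rw [hB]; exact le_top
  have hpt : ∀ y : Rn n × Rn n, ‖F y - G y‖ₑ ≤ ‖h y.1‖ₑ * (‖ψ y.2‖ₑ *
      ENNReal.ofReal (C₀ * (ω (ρ / R y.2) / R y.2 ^ (2 * n)))) := by
    rintro ⟨y₁, y₂⟩
    have e : F (y₁, y₂) - G (y₁, y₂) = h y₁ * (ψ y₂ * (K x y₁ y₂ - K x c y₂)) := by
      simp only [hF, hG]; ring
    rw [e, enorm_mul, enorm_mul]
    dsimp only
    by_cases h1 : h y₁ = 0
    · simp [h1]
    by_cases h2 : ψ y₂ = 0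
    · simp [h2]
    have h3 : ‖y₁ - c‖ ≤ ρ := by
      by_contra hc; exact h1 (hh.eq_zero _ (not_le.1 hc))
    obtain ⟨r1, r2, r3⟩ := hR y₁ h3 y₂ h2
    gcongr
    rw [Real.enorm_eq_ofReal_abs]
    refine ENNReal.ofReal_le_ofReal ?_
    refine (hT.ker.2.2.1 x y₁ c y₂ ?_ (h3.trans r1)).trans ?_
    · rintro ⟨rfl, rfl⟩; simp at r3; linarith
    · rw [mul_div_assoc', div_mul_eq_mul_div]
      have : ω (‖y₁ - c‖ / (‖x - y₁‖ + ‖x - y₂‖)) ≤ ω (ρ / R y₂) :=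
        hT.mod.mono (div_le_div₀ hh.pos.le h3 r2 r3)
      have := hT.mod.nonneg (ρ / R y₂)
      gcongr
  have hGm : AEStronglyMeasurable G (volume.prod volume) := by
    have h1 : Measurable fun y : Rn n => K x c y := hKm.comp (by fun_prop : Measurable fun y : Rn n => (c, y))
    exact hh.integrable.aestronglyMeasurable.comp_fst.mul
      (h1.aestronglyMeasurable.mul hψ.aestronglyMeasurable).comp_snd
  have hFG : Integrable (fun y => F y - G y) (volume.prod volume) := by
    refine ⟨hFi.aestronglyMeasurable.sub hGm, ?_⟩
    exact lt_of_le_of_lt (lintegral_mono hpt) (lt_top_iff_ne_top.2 hB)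
  have hGi : Integrable G (volume.prod volume) := by
    refine (hFi.sub hFG).congr (Filter.Eventually.of_forall fun y => ?_)
    simp
  have hG0 : ∫ y, G y ∂(volume.prod volume) = 0 := by
    rw [hG, integral_prod_mul (f := h) (g := fun y => K x c y * ψ y), hh.integral_eq_zero, zero_mul]
  have : ∫ y, F y ∂(volume.prod volume) = ∫ y, (F y - G y) ∂(volume.prod volume) := by
    rw [integral_sub hFi hGi, hG0, sub_zero]
  rw [Measure.volume_eq_prod, this]
  exact (enorm_integral_le_lintegral_enorm _).trans (lintegral_mono hpt)

lemma ofReal_mul_le_wt (hω : Modulus ω D) (hC : 0 < C₀) {ρ R : ℝ} (hρ : 0 < ρ)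
    (c c' x y : Rn n) (h : (ρ + ‖x - c‖) / 2 ≤ R) (h' : (ρ + ‖y - c'‖) / 2 ≤ R) :
    ENNReal.ofReal (C₀ * (ω (ρ / R) / R ^ (2 * n))) ≤
      ENNReal.ofReal (C₀ * (D * 4 ^ n)) * (wt ω c ρ x * wt ω c' ρ y) := by
  rw [ENNReal.ofReal_mul hC.le, ENNReal.ofReal_mul hC.le, mul_assoc]
  gcongr
  have := hω.wt_split hρ hρ c c' x y h h'
  rwa [Real.mul_self_sqrt (hω.nonneg _)] at this

lemma lintegral_le_wt (hω : Modulus ω D) (hC : 0 < C₀) {c : Rn n} {ρ : ℝ} (hρ : 0 < ρ)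
    (ψ : Rn n → ℝ) (x : Rn n) {R : Rn n → ℝ}
    (h : ∀ y, (ρ + ‖x - c‖) / 2 ≤ R y) (h' : ∀ y, (ρ + ‖y - c‖) / 2 ≤ R y) :
    ∫⁻ y, ‖ψ y‖ₑ * ENNReal.ofReal (C₀ * (ω (ρ / R y) / R y ^ (2 * n))) ≤
      ENNReal.ofReal (C₀ * (D * 4 ^ n)) * (wt ω c ρ x * ∫⁻ y, ‖ψ y‖ₑ * wt ω c ρ y) := by
  rw [← lintegral_const_mul' _ _ (by simp [wt]), ← lintegral_const_mul' _ _ (by simp)]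
  refine lintegral_mono fun y => ?_
  refine (mul_le_mul' le_rfl (ofReal_mul_le_wt hω hC hρ c c x y (h y) (h' y))).trans (le_of_eq ?_)
  ring

/-- Decay of `T h ψ` away from the support of `h`. -/
lemma ae_enorm_le_far (hT : CZOp ω D C₀ C₂ K T) {c : Rn n} {ρ : ℝ} {h ψ : Rn n → ℝ}
    (hh : IsMol c ρ h) (hψ : Integrable ψ) (hψc : HasCompactSupport ψ) :
    ∀ᵐ x, 4 * ρ < ‖x - c‖ → ‖T h ψ x‖ₑ ≤ ENNReal.ofReal (C₀ * (D * 4 ^ n)) *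
      ((∫⁻ y, ‖h y‖ₑ) * wt ω c ρ x * ∫⁻ y, ‖ψ y‖ₑ * wt ω c ρ y) := by
  filter_upwards [hT.rep h ψ hh.integrable hψ hh.hasCompactSupport hψc] with x hx hxc
  have hρ := hh.pos
  have hrep := hx fun hc => hh.notMem_tsupport (by linarith) hc.1
  have h1 := hT.enorm_le_of_isMol hh hψ hrep
    (R := fun y => max ((ρ + ‖x - c‖) / 2) ((ρ + ‖y - c‖) / 2)) (by fun_prop) ?_
  · refine h1.trans ((mul_le_mul' le_rfl (lintegral_le_wt hT.mod hT.pos₀ hρ ψ x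
      (fun y => le_max_left _ _) (fun y => le_max_right _ _))).trans (le_of_eq ?_))
    ring
  · intro y₁ hy₁ y₂ _
    have t1 : ‖x - c‖ ≤ ‖x - y₁‖ + ‖y₁ - c‖ := norm_sub_le_norm_sub_add_norm_sub _ _ _
    have t2 : ‖y₂ - c‖ ≤ ‖x - y₂‖ + ‖x - c‖ := by
      rw [norm_sub_rev x y₂]; exact norm_sub_le_norm_sub_add_norm_sub _ _ _
    have h0 := norm_nonneg (x - y₂)
    refine ⟨by linarith [le_max_left ‖x - y₁‖ ‖x - y₂‖],
      lt_max_of_lt_left (by positivity), max_le (by linarith) (by linarith)⟩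

/-- Bound of `T h ψ` near the support of `h` when `ψ` is supported far away. -/
lemma ae_enorm_le_near (hT : CZOp ω D C₀ C₂ K T) {c : Rn n} {ρ L : ℝ} {h ψ : Rn n → ℝ}
    (hh : IsMol c ρ h) (hψ : Integrable ψ) (hψc : HasCompactSupport ψ) (hL : 1 ≤ L)
    (hψ0 : ∀ y, ‖y - c‖ ≤ (2 * L + 2) * ρ → ψ y = 0) :
    ∀ᵐ x, ‖x - c‖ ≤ L * ρ → ‖T h ψ x‖ₑ ≤ ENNReal.ofReal (C₀ * (D * 4 ^ n)) *
      ((∫⁻ y, ‖h y‖ₑ) * wt ω c ρ c * ∫⁻ y, ‖ψ y‖ₑ * wt ω c ρ y) := by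
  filter_upwards [hT.rep h ψ hh.integrable hψ hh.hasCompactSupport hψc] with x hx hxc
  have hρ := hh.pos
  have hLρ : ρ ≤ L * ρ := le_mul_of_one_le_left hρ.le hL
  have hxψ : x ∉ tsupport ψ := by
    rw [notMem_tsupport_iff_eventuallyEq]
    filter_upwards [Metric.ball_mem_nhds x hρ] with y hy
    refine hψ0 y ?_
    rw [Metric.mem_ball, dist_eq_norm] at hy
    have : ‖y - c‖ ≤ ‖y - x‖ + ‖x - c‖ := norm_sub_le_norm_sub_add_norm_sub _ _ _
    linarith
  have hrep := hx fun hc => hxψ hc.2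
  have h1 := hT.enorm_le_of_isMol hh hψ hrep
    (R := fun y => (ρ + ‖y - c‖) / 2) (by fun_prop) ?_
  · refine h1.trans ((mul_le_mul' le_rfl (lintegral_le_wt (x := c) hT.mod hT.pos₀ hρ ψ
      (fun y => ?_) (fun y => le_rfl))).trans (le_of_eq ?_))
    · have := norm_nonneg (y - c)
      simp only [sub_self, norm_zero, add_zero]; linarith
    · ring
  · intro y₁ hy₁ y₂ h2
    have h3 : (2 * L + 2) * ρ < ‖y₂ - c‖ := by
      by_contra hc; exact h2 (hψ0 _ (not_lt.1 hc))
    have t2 : ‖y₂ - c‖ ≤ ‖x - y₂‖ + ‖x - c‖ := by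
      rw [norm_sub_rev x y₂]; exact norm_sub_le_norm_sub_add_norm_sub _ _ _
    have h0 := norm_nonneg (x - y₁)
    refine ⟨by linarith [le_max_right ‖x - y₁‖ ‖x - y₂‖], by positivity, by linarith⟩

/-- Decay of `T h h'` away from the supports of both entries. -/
lemma ae_enorm_le_far_far (hT : CZOp ω D C₀ C₂ K T) {c c' : Rn n} {ρ ρ' : ℝ} {h h' : Rn n → ℝ}
    (hh : IsMol c ρ h) (hh' : IsMol c' ρ' h') :
    ∀ᵐ x, 4 * ρ < ‖x - c‖ → 4 * ρ' < ‖x - c'‖ → ‖T h h' x‖ₑ ≤ ENNReal.ofReal (C₀ * (D * 4 ^ n)) *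
      ((∫⁻ y, ‖h y‖ₑ) * wt ω c ρ x * ((∫⁻ y, ‖h' y‖ₑ) * wt ω c' ρ' x)) := by
  have hr := hT.rep h h' hh.integrable hh'.integrable hh.hasCompactSupport hh'.hasCompactSupport
  have hr' := hT.swap.rep h' h hh'.integrable hh.integrable hh'.hasCompactSupport
    hh.hasCompactSupport
  filter_upwards [hr, hr'] with x hx hx' hxc hxc'
  have hρ := hh.pos
  have hρ' := hh'.pos
  have hC := hT.pos₀
  have hn := hh.notMem_tsupport (x := x) (by linarith)
  set R := max ((ρ + ‖x - c‖) / 2) ((ρ' + ‖x - c'‖) / 2) with hR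
  have hR0 : 0 < R := lt_max_of_lt_left (by positivity)
  have geo : ∀ y₁, ‖y₁ - c‖ ≤ ρ → ∀ y₂, ‖y₂ - c'‖ ≤ ρ' →
      ρ ≤ 1 / 2 * max ‖x - y₁‖ ‖x - y₂‖ ∧ ρ' ≤ 1 / 2 * max ‖x - y₁‖ ‖x - y₂‖ ∧
        R ≤ ‖x - y₁‖ + ‖x - y₂‖ := by
    intro y₁ h1 y₂ h2
    have t1 : ‖x - c‖ ≤ ‖x - y₁‖ + ‖y₁ - c‖ := norm_sub_le_norm_sub_add_norm_sub _ _ _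
    have t2 : ‖x - c'‖ ≤ ‖x - y₂‖ + ‖y₂ - c'‖ := norm_sub_le_norm_sub_add_norm_sub _ _ _
    refine ⟨by linarith [le_max_left ‖x - y₁‖ ‖x - y₂‖],
      by linarith [le_max_right ‖x - y₁‖ ‖x - y₂‖], max_le ?_ ?_⟩ <;>
    linarith [norm_nonneg (x - y₁), norm_nonneg (x - y₂)]
  have hz : ∀ {y : Rn n}, h y ≠ 0 → ‖y - c‖ ≤ ρ := fun {y} hy => by
    by_contra hc; exact hy (hh.eq_zero _ (not_le.1 hc))
  have hz' : ∀ {y : Rn n}, h' y ≠ 0 → ‖y - c'‖ ≤ ρ' := fun {y} hy => by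
    by_contra hc; exact hy (hh'.eq_zero _ (not_le.1 hc))
  have b1 := hT.enorm_le_of_isMol hh hh'.integrable (hx fun hc => hn hc.1)
    (R := fun _ => R) measurable_const (fun y₁ h1 y₂ h2 =>
      ⟨(geo y₁ h1 y₂ (hz' h2)).1, hR0, (geo y₁ h1 y₂ (hz' h2)).2.2⟩)
  have b2 := hT.swap.enorm_le_of_isMol hh' hh.integrable (hx' fun hc => hn hc.2)
    (R := fun _ => R) measurable_const (fun y₂ h2 y₁ h1 => by
      rw [max_comm, add_comm ‖x - y₂‖]
      exact ⟨(geo y₁ (hz h1) y₂ h2).2.1, hR0, (geo y₁ (hz h1) y₂ h2).2.2⟩)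
  rw [lintegral_mul_const' _ _ ENNReal.ofReal_ne_top] at b1 b2
  set p := ω (ρ / R)
  set q := ω (ρ' / R)
  have hp : 0 ≤ p := hT.mod.nonneg _
  have hq : 0 ≤ q := hT.mod.nonneg _
  have hmin : min p q ≤ √p * √q := by
    rw [← Real.sqrt_mul hp]
    refine Real.le_sqrt_of_sq_le ?_
    have := le_min hp hq
    rw [sq]
    exact mul_le_mul (min_le_left _ _) (min_le_right _ _) this hp
  have b3 : ‖T h h' x‖ₑ ≤ (∫⁻ y, ‖h y‖ₑ) * ((∫⁻ y, ‖h' y‖ₑ) *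
      ENNReal.ofReal (C₀ * (min p q / R ^ (2 * n)))) := by
    rcases le_total p q with hpq | hpq
    · rwa [min_eq_left hpq]
    · rw [min_eq_right hpq]
      refine b2.trans (le_of_eq ?_); ring
  have hs := hT.mod.wt_split hρ hρ' c c' x x (le_max_left _ _) (le_max_right _ _)
  refine b3.trans ?_
  calc _ ≤ (∫⁻ y, ‖h y‖ₑ) * ((∫⁻ y, ‖h' y‖ₑ) *
        (ENNReal.ofReal C₀ * ENNReal.ofReal (√p * √q / R ^ (2 * n)))) := by
        rw [← ENNReal.ofReal_mul hC.le]
        gcongr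
    _ ≤ (∫⁻ y, ‖h y‖ₑ) * ((∫⁻ y, ‖h' y‖ₑ) *
        (ENNReal.ofReal C₀ * (ENNReal.ofReal (D * 4 ^ n) * (wt ω c ρ x * wt ω c' ρ' x)))) := by
        gcongr
    _ = _ := by rw [ENNReal.ofReal_mul hC.le]; ring

end CZOp

lemma isBMO_zero (n : ℕ) : IsBMO (fun _ : Rn n => (0 : ℝ)) 0 where
  locallyIntegrable := locallyIntegrable_const 0
  osc c l _ := by simp [avgOn]
  nonneg := le_rfl

lemma Modulus.lintegral_wt_bound {ω : ℝ → ℝ} {D : ℝ} (hω : Modulus ω D) (n : ℕ) :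
    ∃ W : ℝ≥0, ∀ (c : Rn n) (ρ : ℝ), 0 < ρ → ∫⁻ x, wt ω c ρ x ≤ W := by
  obtain ⟨W, hW⟩ := hω.lintegral_wt_le n 0
  refine ⟨W, fun c ρ hρ => le_trans (lintegral_mono fun x => ?_) (hW _ (isBMO_zero n) c ρ hρ)⟩
  exact le_mul_of_one_le_right' (le_add_right le_rfl)

lemma far_geometry {n : ℕ} {c x y₁ y₂ : Rn n} {ρ : ℝ} (hx : ‖x - c‖ ≤ ρ)
    (h : 4 * ρ < ‖y₁ - c‖ ∨ 4 * ρ < ‖y₂ - c‖) :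
    3 * ρ ≤ max ‖x - y₁‖ ‖x - y₂‖ ∧
      max ((ρ + ‖y₁ - c‖) / 2) ((ρ + ‖y₂ - c‖) / 2) ≤ ‖x - y₁‖ + ‖x - y₂‖ := by
  have t1 : ‖y₁ - c‖ ≤ ‖x - y₁‖ + ‖x - c‖ := by
    rw [norm_sub_rev x y₁]; exact norm_sub_le_norm_sub_add_norm_sub _ _ _
  have t2 : ‖y₂ - c‖ ≤ ‖x - y₂‖ + ‖x - c‖ := by
    rw [norm_sub_rev x y₂]; exact norm_sub_le_norm_sub_add_norm_sub _ _ _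
  have n1 := norm_nonneg (x - y₁)
  have n2 := norm_nonneg (x - y₂)
  rcases h with h | h
  · exact ⟨by linarith [le_max_left ‖x - y₁‖ ‖x - y₂‖], max_le (by linarith) (by linarith)⟩
  · exact ⟨by linarith [le_max_right ‖x - y₁‖ ‖x - y₂‖], max_le (by linarith) (by linarith)⟩

namespace CZOp

variable {n : ℕ} {ω : ℝ → ℝ} {D C₀ C₂ : ℝ} {K : Rn n → Rn n → Rn n → ℝ}
  {T : (Rn n → ℝ) → (Rn n → ℝ) → Rn n → ℝ}

lemma integrable_kernel (hT : CZOp ω D C₀ C₂ K T) {c x : Rn n} {ρ : ℝ} {φ ψ : Rn n → ℝ}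
    (hρ : 0 < ρ) (hφ : Integrable φ) (hψ : Integrable ψ) (hx : ‖x - c‖ ≤ ρ)
    (h0 : (∀ y, ‖y - c‖ ≤ 4 * ρ → φ y = 0) ∨ ∀ y, ‖y - c‖ ≤ 4 * ρ → ψ y = 0) :
    Integrable (fun y : Rn n × Rn n => K x y.1 y.2 * φ y.1 * ψ y.2) (volume.prod volume) := by
  have hC := hT.pos₀
  refine Integrable.mono' (((hφ.mul_prod hψ).norm).const_mul (C₀ / ρ ^ (2 * n)))
    (((hT.measurable_kernel x).aestronglyMeasurable.mul hφ.aestronglyMeasurable.comp_fst).mul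
      hψ.aestronglyMeasurable.comp_snd) (Filter.Eventually.of_forall ?_)
  rintro ⟨y₁, y₂⟩
  simp only [norm_mul, Real.norm_eq_abs, mul_assoc]
  by_cases h1 : φ y₁ = 0
  · simp [h1]
  by_cases h2 : ψ y₂ = 0
  · simp [h2]
  have hd : 4 * ρ < ‖y₁ - c‖ ∨ 4 * ρ < ‖y₂ - c‖ := by
    rcases h0 with h | h
    · left; by_contra hc; exact h1 (h _ (not_lt.1 hc))
    · right; by_contra hc; exact h2 (h _ (not_lt.1 hc))
  obtain ⟨g1, g2⟩ := far_geometry hx hd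
  have hS : ρ ≤ ‖x - y₁‖ + ‖x - y₂‖ := by
    have := max_le_add_of_nonneg (norm_nonneg (x - y₁)) (norm_nonneg (x - y₂))
    linarith
  gcongr
  refine (hT.ker.1 x y₁ y₂ ?_).trans ?_
  · rintro ⟨rfl, rfl⟩; simp at hS; linarith
  · gcongr

/-- The oscillation of `T φ ψ` on a ball which one of the supports avoids. -/
lemma ae_enorm_sub_le (hT : CZOp ω D C₀ C₂ K T) {W : ℝ≥0}
    (hW : ∀ (c : Rn n) (ρ : ℝ), 0 < ρ → ∫⁻ x, wt ω c ρ x ≤ W)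
    {c : Rn n} {ρ a τ : ℝ} {φ ψ : Rn n → ℝ} (hρ : 0 < ρ) (hφ : Integrable φ) (hψ : Integrable ψ)
    (hφc : HasCompactSupport φ) (hψc : HasCompactSupport ψ)
    (ha : ∀ y, |φ y| ≤ a) (hτ : ∀ y, |ψ y| ≤ τ)
    (h0 : (∀ y, ‖y - c‖ ≤ 4 * ρ → φ y = 0) ∨ ∀ y, ‖y - c‖ ≤ 4 * ρ → ψ y = 0) :
    ∀ᵐ x, ‖x - c‖ ≤ ρ →
      ‖T φ ψ x - ∫ y : Rn n × Rn n, K c y.1 y.2 * φ y.1 * ψ y.2‖ₑ ≤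
        ENNReal.ofReal (C₀ * (D * 4 ^ n) * (a * τ) * (W * W)) := by
  filter_upwards [hT.rep φ ψ hφ hψ hφc hψc] with x hx hxc
  have hC := hT.pos₀
  have hD := hT.mod.one_le
  have ha0 : 0 ≤ a := (abs_nonneg _).trans (ha 0)
  have hτ0 : 0 ≤ τ := (abs_nonneg _).trans (hτ 0)
  have hns : ∀ f : Rn n → ℝ, (∀ y, ‖y - c‖ ≤ 4 * ρ → f y = 0) → x ∉ tsupport f := by
    intro f hf
    rw [notMem_tsupport_iff_eventuallyEq]
    filter_upwards [Metric.ball_mem_nhds x hρ] with y hy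
    refine hf y ?_
    rw [Metric.mem_ball, dist_eq_norm] at hy
    have : ‖y - c‖ ≤ ‖y - x‖ + ‖x - c‖ := norm_sub_le_norm_sub_add_norm_sub _ _ _
    linarith
  rw [hx fun hc => h0.elim (fun h => hns _ h hc.1) (fun h => hns _ h hc.2)]
  rw [Measure.volume_eq_prod, ← integral_sub (hT.integrable_kernel hρ hφ hψ hxc h0)
    (hT.integrable_kernel hρ hφ hψ (by simpa using hρ.le) h0)]
  refine (enorm_integral_le_lintegral_enorm _).trans ?_
  have hwm : AEMeasurable (wt ω c ρ) := (hT.mod.measurable_wt c ρ).aemeasurable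
  calc _ ≤ ∫⁻ y : Rn n × Rn n, ENNReal.ofReal (C₀ * (D * 4 ^ n) * (a * τ)) *
        (wt ω c ρ y.1 * wt ω c ρ y.2) ∂(volume.prod volume) := by
        refine lintegral_mono ?_
        rintro ⟨y₁, y₂⟩
        dsimp only
        by_cases h1 : φ y₁ = 0
        · simp [h1]
        by_cases h2 : ψ y₂ = 0
        · simp [h2]
        have hd : 4 * ρ < ‖y₁ - c‖ ∨ 4 * ρ < ‖y₂ - c‖ := by
          rcases h0 with h | h
          · left; by_contra hc; exact h1 (h _ (not_lt.1 hc))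
          · right; by_contra hc; exact h2 (h _ (not_lt.1 hc))
        obtain ⟨g1, g2⟩ := far_geometry hxc hd
        set R := max ((ρ + ‖y₁ - c‖) / 2) ((ρ + ‖y₂ - c‖) / 2) with hR
        have hR0 : 0 < R := lt_max_of_lt_left (by positivity)
        have hs := ofReal_mul_le_wt hT.mod hC hρ c c y₁ y₂
          (le_max_left ((ρ + ‖y₁ - c‖) / 2) ((ρ + ‖y₂ - c‖) / 2)) (le_max_right _ _)
        rw [← hR] at hs
        have e : K x y₁ y₂ * φ y₁ * ψ y₂ - K c y₁ y₂ * φ y₁ * ψ y₂ =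
          φ y₁ * ψ y₂ * (K x y₁ y₂ - K c y₁ y₂) := by ring
        have k : |K x y₁ y₂ - K c y₁ y₂| ≤ C₀ * (ω (ρ / R) / R ^ (2 * n)) := by
          refine (hT.ker.2.1 x c y₁ y₂ ?_ (by linarith)).trans ?_
          · rintro ⟨rfl, rfl⟩; simp at g2; linarith
          · rw [mul_div_assoc', div_mul_eq_mul_div]
            have : ω (‖x - c‖ / (‖x - y₁‖ + ‖x - y₂‖)) ≤ ω (ρ / R) :=
              hT.mod.mono (div_le_div₀ hρ.le hxc hR0 g2)
            have := hT.mod.nonneg (ρ / R)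
            gcongr
        rw [e, Real.enorm_eq_ofReal_abs, abs_mul, abs_mul]
        calc ENNReal.ofReal (|φ y₁| * |ψ y₂| * |K x y₁ y₂ - K c y₁ y₂|)
            ≤ ENNReal.ofReal (a * τ * (C₀ * (ω (ρ / R) / R ^ (2 * n)))) := by
              gcongr
              · exact ha y₁
              · exact hτ y₂
          _ ≤ ENNReal.ofReal (a * τ) * (ENNReal.ofReal (C₀ * (D * 4 ^ n)) *
              (wt ω c ρ y₁ * wt ω c ρ y₂)) := by
              rw [ENNReal.ofReal_mul (by positivity)]; gcongr
          _ = _ := by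
              rw [ENNReal.ofReal_mul (p := C₀ * (D * 4 ^ n)) (by positivity)]; ring
    _ = ENNReal.ofReal (C₀ * (D * 4 ^ n) * (a * τ)) *
        ((∫⁻ y, wt ω c ρ y) * ∫⁻ y, wt ω c ρ y) := by
        rw [lintegral_const_mul' _ _ ENNReal.ofReal_ne_top, lintegral_prod_mul hwm hwm]
    _ ≤ ENNReal.ofReal (C₀ * (D * 4 ^ n) * (a * τ)) * (W * W) := by
        gcongr <;> exact hW c ρ hρ
    _ = _ := by
        rw [ENNReal.ofReal_mul (q := (W : ℝ) * W) (by positivity),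
          ENNReal.ofReal_mul (NNReal.coe_nonneg W), ENNReal.ofReal_coe_nnreal]

end CZOp

lemma l1norm_indicator_closedBall_le {n : ℕ} {f : Rn n → ℝ} {a R : ℝ} (hf : Integrable f)
    (ha : ∀ y, |f y| ≤ a) (c : Rn n) (hR : 0 < R) :
    l1norm ((Metric.closedBall c R).indicator f) ≤ a * (4 * R) ^ n := by
  have ha0 : 0 ≤ a := (abs_nonneg _).trans (ha 0)
  set N := Metric.closedBall c R
  have hN : MeasurableSet N := measurableSet_closedBall
  have hv : volume.real N ≤ (4 * R) ^ n :=
    ENNReal.toReal_le_of_le_ofReal (by positivity) (volume_closedBall_le c hR)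
  have hNt : volume N ≠ ⊤ := measure_closedBall_lt_top.ne
  calc l1norm (N.indicator f) ≤ ∫ x, N.indicator (fun _ => a) x := by
        refine integral_mono (hf.indicator hN).abs
          ((integrable_indicator_iff hN).2 (integrableOn_const hNt)) fun x => ?_
        by_cases hx : x ∈ N
        · simpa [hx] using ha x
        · simp [hx]
    _ = volume.real N * a := by rw [integral_indicator hN, setIntegral_const, smul_eq_mul]
    _ ≤ (4 * R) ^ n * a := by gcongr
    _ = _ := mul_comm _ _

lemma hasCompactSupport_indicator {n : ℕ} {f : Rn n → ℝ} (hf : HasCompactSupport f)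
    (s : Set (Rn n)) : HasCompactSupport (s.indicator f) :=
  hf.mono fun x hx => by
    by_contra hc
    rw [Function.notMem_support] at hc
    exact hx (by by_cases hs : x ∈ s <;> simp [hs, hc])

lemma abs_indicator_le {n : ℕ} {f : Rn n → ℝ} {a : ℝ} (ha : ∀ y, |f y| ≤ a) (s : Set (Rn n))
    (y : Rn n) : |s.indicator f y| ≤ a := by
  by_cases hy : y ∈ s
  · simpa [hy] using ha y
  · simpa [hy] using (abs_nonneg _).trans (ha y)

/-- Local square integrability of `T f g` for bounded `f` and `g`. -/
lemma Modulus.exists_lintegral_sq_le {ω : ℝ → ℝ} {D : ℝ} (hω : Modulus ω D) (n : ℕ) :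
    ∃ κ : ℝ≥0, ∀ (C₀ C₂ : ℝ) (K : Rn n → Rn n → Rn n → ℝ)
      (T : (Rn n → ℝ) → (Rn n → ℝ) → Rn n → ℝ), CZOp ω D C₀ C₂ K T →
      ∀ (a τ : ℝ) (f g : Rn n → ℝ), 0 < a → 0 < τ → Integrable f → Integrable g →
        HasCompactSupport f → HasCompactSupport g → (∀ y, |f y| ≤ a) → (∀ y, |g y| ≤ τ) →
        ∀ (c : Rn n) (r : ℝ), 0 < r → (∀ y, 4 * (n * r) < ‖y - c‖ → f y = 0) →
          (∀ y, 4 * (n * r) < ‖y - c‖ → g y = 0) →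
          ∫⁻ x in hcube c r, ENNReal.ofReal ((T f g x) ^ 2) ≤
            ENNReal.ofReal (κ * ((C₀ + C₂) * (a * τ)) ^ 2) * volume (hcube c r) := by
  obtain ⟨W, hW⟩ := hω.lintegral_wt_bound n
  have hD := hω.one_le
  set κ₁ : ℝ := (8 * n) ^ n * 2 ^ (n + 2) with hκ₁
  set κ₀ : ℝ := 2 * (D * 4 ^ n * (W * W)) + κ₁ ^ 2 with hκ₀
  have hκ₀0 : 0 ≤ κ₀ := by positivity
  have hjn := jnConst_pos
  refine ⟨(jnConst * (2 * κ₀) ^ 2).toNNReal, ?_⟩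
  intro C₀ C₂ K T hT a τ f g ha hτ hf hg hfc hgc hfa hgτ c r hr hf0 hg0
  have hn : (0 : ℝ) < n := by exact_mod_cast hT.one_le_dim
  have hC₀ := hT.pos₀
  have hC₂ := hT.pos₂
  have hκ₁0 : 0 < κ₁ := by positivity
  set t₀ := κ₀ * ((C₀ + C₂) * (a * τ)) with ht₀
  have ht₀0 : 0 < t₀ := by positivity
  set N : Rn n → ℝ → Set (Rn n) := fun c r => Metric.closedBall c (4 * (n * r)) with hN
  have hNm : ∀ c r, MeasurableSet (N c r) := fun c r => measurableSet_closedBall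
  have hmem : ∀ {c r y}, y ∈ N c r ↔ ‖y - c‖ ≤ 4 * (n * r) := fun {c r y} => by
    simp [hN, dist_eq_norm]
  set P : Rn n → ℝ → ℝ := fun c r =>
    (∫ y : Rn n × Rn n, K c y.1 y.2 * (N c r)ᶜ.indicator f y.1 * g y.2) +
      ∫ y : Rn n × Rn n, K c y.1 y.2 * (N c r).indicator f y.1 * (N c r)ᶜ.indicator g y.2 with hP
  have key := lintegral_hcube_sq_le (h := T f g) (hT.meas f g hf hg).aemeasurable P
    (t := 2 * t₀) (by positivity) ?_ c hr
  · have hP0 : P c r = 0 := by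
      have h1 : ∀ y, (N c r)ᶜ.indicator f y = 0 := fun y => by
        by_cases hy : y ∈ N c r
        · simp [hy]
        · exact indicator_apply_eq_zero.2 fun _ => hf0 y (not_le.1 (hmem.not.1 hy))
      have h2 : ∀ y, (N c r)ᶜ.indicator g y = 0 := fun y => by
        by_cases hy : y ∈ N c r
        · simp [hy]
        · exact indicator_apply_eq_zero.2 fun _ => hg0 y (not_le.1 (hmem.not.1 hy))
      simp [hP, h1, h2]
    simp only [hP0, sub_zero] at key
    refine key.trans (le_of_eq ?_)
    rw [Real.coe_toNNReal _ (by positivity), ht₀]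
    congr 2; ring
  clear hf0 hg0 hr r c
  intro c r hr
  have hρ : 0 < n * r := by positivity
  set f₁ := (N c r).indicator f with hf₁
  set f₂ := (N c r)ᶜ.indicator f with hf₂
  set g₁ := (N c r).indicator g with hg₁
  set g₂ := (N c r)ᶜ.indicator g with hg₂
  have if₁ : Integrable f₁ := hf.indicator (hNm c r)
  have if₂ : Integrable f₂ := hf.indicator (hNm c r).compl
  have ig₁ : Integrable g₁ := hg.indicator (hNm c r)
  have ig₂ : Integrable g₂ := hg.indicator (hNm c r).compl
  have hz : ∀ (φ : Rn n → ℝ) (y : Rn n), ‖y - c‖ ≤ 4 * (n * r) →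
      (N c r)ᶜ.indicator φ y = 0 := fun φ y hy => by
    rw [indicator_of_notMem]; simpa using hmem.2 hy
  have far₁ := hT.ae_enorm_sub_le hW hρ if₂ hg (hasCompactSupport_indicator hfc _) hgc
    (abs_indicator_le hfa _) hgτ (Or.inl (hz f))
  have far₂ := hT.ae_enorm_sub_le hW hρ if₁ ig₂ (hasCompactSupport_indicator hfc _)
    (hasCompactSupport_indicator hgc _) (abs_indicator_le hfa _) (abs_indicator_le hgτ _)
    (Or.inr (hz g))
  have hsub : {x ∈ hcube c r | 2 * t₀ < |T f g x - P c r|} ≤ᵐ[volume] {x | t₀ < |T f₁ g₁ x|} := by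
    filter_upwards [far₁, far₂] with x h1 h2 hx
    have hxc := norm_sub_le_of_mem_hcube hx.1
    have e1 : T f g x = T f₁ g x + T f₂ g x := by
      rw [← hT.bilin.1 f₁ f₂ g if₁ if₂ hg]
      congr 1; ext y; exact (congrFun (indicator_self_add_compl (N c r) f) y).symm
    have e2 : T f₁ g x = T f₁ g₁ x + T f₁ g₂ x := by
      rw [← hT.bilin.2.2.1 f₁ g₁ g₂ if₁ ig₁ ig₂]
      congr 1; ext y; exact (congrFun (indicator_self_add_compl (N c r) g) y).symm
    have hE : 0 ≤ C₀ * (D * 4 ^ n) * (a * τ) * (W * W) := by positivity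
    have h1' := h1 hxc
    have h2' := h2 hxc
    rw [Real.enorm_eq_ofReal_abs, ENNReal.ofReal_le_ofReal_iff hE] at h1' h2'
    have hx2 := hx.2
    have e3 : T f g x - P c r = T f₁ g₁ x +
        ((T f₂ g x - ∫ y : Rn n × Rn n, K c y.1 y.2 * f₂ y.1 * g y.2) +
        (T f₁ g₂ x - ∫ y : Rn n × Rn n, K c y.1 y.2 * f₁ y.1 * g₂ y.2)) := by
      rw [e1, e2, hP]; ring
    rw [e3] at hx2
    have tri := (abs_add_le (T f₁ g₁ x) _).trans (add_le_add le_rfl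
      (abs_add_le (T f₂ g x - ∫ y : Rn n × Rn n, K c y.1 y.2 * f₂ y.1 * g y.2)
        (T f₁ g₂ x - ∫ y : Rn n × Rn n, K c y.1 y.2 * f₁ y.1 * g₂ y.2)))
    have hle : 2 * (C₀ * (D * 4 ^ n) * (a * τ) * (W * W)) ≤ t₀ := by
      rw [ht₀, hκ₀]
      have p1 : 0 ≤ D * 4 ^ n * (W * W) * (C₂ * (a * τ)) := by positivity
      have p2 : 0 ≤ κ₁ ^ 2 * ((C₀ + C₂) * (a * τ)) := by positivity
      nlinarith
    show t₀ < |T f₁ g₁ x|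
    linarith
  have hV₁ := l1norm_indicator_closedBall_le hf hfa c (show 0 < 4 * (n * r) by positivity)
  have hV₂ := l1norm_indicator_closedBall_le hg hgτ c (show 0 < 4 * (n * r) by positivity)
  have l0 : ∀ φ : Rn n → ℝ, 0 ≤ l1norm φ := fun φ => integral_nonneg fun x => abs_nonneg _
  have hV : (C₂ * l1norm f₁ * l1norm g₁ / t₀) ^ ((1 : ℝ) / 2) ≤ (2 * r) ^ n / 2 ^ (n + 2) := by
    rw [← Real.sqrt_eq_rpow]
    refine Real.sqrt_le_iff.2 ⟨by positivity, ?_⟩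
    rw [div_le_iff₀ ht₀0]
    have hV0 : 0 ≤ (4 * (4 * (n * r))) ^ n := by positivity
    calc C₂ * l1norm f₁ * l1norm g₁
        ≤ C₂ * (a * (4 * (4 * (n * r))) ^ n) * (τ * (4 * (4 * (n * r))) ^ n) :=
          mul_le_mul (mul_le_mul_of_nonneg_left hV₁ hC₂.le) hV₂ (l0 _) (by positivity)
      _ = ((2 * r) ^ n / 2 ^ (n + 2)) ^ 2 * (κ₁ ^ 2 * (C₂ * (a * τ))) := by
          have : (4 * (4 * (n * r))) ^ n = (2 * r) ^ n * (8 * (n : ℝ)) ^ n := by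
            rw [← mul_pow]; congr 1; ring
          rw [this, hκ₁]; field_simp
      _ ≤ _ := by
          gcongr
          rw [ht₀]
          have p1 : 0 ≤ D * 4 ^ n * (W * W) * ((C₀ + C₂) * (a * τ)) := by positivity
          have p2 : 0 ≤ κ₁ ^ 2 * (C₀ * (a * τ)) := by positivity
          rw [hκ₀]; nlinarith
  have hfin := (measure_mono_ae hsub).trans ((hT.weak f₁ g₁ if₁ ig₁ t₀ ht₀0).trans
    (ENNReal.ofReal_le_ofReal hV))
  rw [volume_hcube c hr.le]
  calc _ ≤ 2 ^ (n + 2) * ENNReal.ofReal ((2 * r) ^ n / 2 ^ (n + 2)) := mul_le_mul' le_rfl hfin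
    _ = _ := by
        have : (2 : ℝ≥0∞) ^ (n + 2) = ENNReal.ofReal (2 ^ (n + 2)) := by
          rw [ENNReal.ofReal_pow (by norm_num)]; norm_num
        rw [this, ← ENNReal.ofReal_mul (by positivity)]
        congr 1; field_simp

lemma IsMol.lintegral_le {n : ℕ} {c : Rn n} {ρ τ : ℝ} {q : Rn n → ℝ} (hq : IsMol c ρ q)
    (hτ : ∀ y, |q y| ≤ τ) : ∫⁻ y, ‖q y‖ₑ ≤ ENNReal.ofReal (τ * (4 * ρ) ^ n) := by
  have hτ0 : 0 ≤ τ := (abs_nonneg _).trans (hτ 0)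
  calc ∫⁻ y, ‖q y‖ₑ
      ≤ ∫⁻ y, (Metric.closedBall c ρ).indicator (fun _ => ENNReal.ofReal τ) y := by
        refine lintegral_mono fun y => ?_
        by_cases hy : y ∈ Metric.closedBall c ρ
        · rw [indicator_of_mem hy, Real.enorm_eq_ofReal_abs]
          exact ENNReal.ofReal_le_ofReal (hτ y)
        · rw [Metric.mem_closedBall, dist_eq_norm, not_le] at hy
          simp [hq.eq_zero y hy]
    _ = ENNReal.ofReal τ * volume (Metric.closedBall c ρ) := by
        rw [lintegral_indicator measurableSet_closedBall, lintegral_const,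
          Measure.restrict_apply_univ]
    _ ≤ ENNReal.ofReal τ * ENNReal.ofReal ((4 * ρ) ^ n) := by
        gcongr; exact volume_closedBall_le c hq.pos
    _ = _ := (ENNReal.ofReal_mul hτ0).symm

lemma enorm_le_one_add_sq (u : ℝ) : ‖u‖ₑ ≤ 1 + ENNReal.ofReal (u ^ 2) := by
  rw [Real.enorm_eq_ofReal_abs, ← ENNReal.ofReal_one, ← ENNReal.ofReal_add zero_le_one (sq_nonneg _)]
  refine ENNReal.ofReal_le_ofReal ?_
  rw [← sq_abs]; nlinarith [sq_nonneg (|u| - 1), abs_nonneg u]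

lemma enorm_mul_enorm_le {A : ℝ} (hA : 0 < A) (u v : ℝ) :
    ‖u‖ₑ * ‖v‖ₑ ≤ ENNReal.ofReal A * ENNReal.ofReal (u ^ 2) +
      ENNReal.ofReal A⁻¹ * ENNReal.ofReal (v ^ 2) := by
  rw [Real.enorm_eq_ofReal_abs, Real.enorm_eq_ofReal_abs, ← ENNReal.ofReal_mul (abs_nonneg _),
    ← ENNReal.ofReal_mul hA.le, ← ENNReal.ofReal_mul (inv_pos.2 hA).le,
    ← ENNReal.ofReal_add (by positivity) (by positivity)]
  refine ENNReal.ofReal_le_ofReal ?_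
  have h : 0 ≤ (A * |u| - |v|) ^ 2 / A := by positivity
  have e : (A * |u| - |v|) ^ 2 / A = A * u ^ 2 - 2 * (|u| * |v|) + A⁻¹ * v ^ 2 := by
    rw [← sq_abs u, ← sq_abs v]; field_simp; ring
  nlinarith [mul_nonneg (abs_nonneg u) (abs_nonneg v)]

lemma lintegral_enorm_mul_wt_le {n : ℕ} {ω : ℝ → ℝ} {W : ℝ≥0}
    (hW : ∀ (c : Rn n) (ρ : ℝ), 0 < ρ → ∫⁻ x, wt ω c ρ x ≤ W) {G : Rn n → ℝ} {α : ℝ}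
    (hG : ∀ y, |G y| ≤ α) (c : Rn n) {ρ : ℝ} (hρ : 0 < ρ) :
    ∫⁻ y, ‖G y‖ₑ * wt ω c ρ y ≤ ENNReal.ofReal (α * W) := by
  have hα : 0 ≤ α := (abs_nonneg _).trans (hG 0)
  calc ∫⁻ y, ‖G y‖ₑ * wt ω c ρ y ≤ ∫⁻ y, ENNReal.ofReal α * wt ω c ρ y := by
        refine lintegral_mono fun y => ?_
        rw [Real.enorm_eq_ofReal_abs]
        gcongr
        exact hG y
    _ ≤ ENNReal.ofReal α * W := by
        rw [lintegral_const_mul' _ _ ENNReal.ofReal_ne_top]; gcongr; exact hW c ρ hρ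
    _ = _ := by rw [ENNReal.ofReal_mul hα, ENNReal.ofReal_coe_nnreal]

set_option maxHeartbeats 1000000 in
/-- The commutator with a bounded function in one slot and an atom in the other. -/
lemma Modulus.exists_lintegral_commutator_le {ω : ℝ → ℝ} {D : ℝ} (hω : Modulus ω D) (n : ℕ)
    {M : ℝ} (hM : 0 ≤ M) :
    ∃ κ : ℝ≥0, ∀ (C₀ C₂ : ℝ) (K : Rn n → Rn n → Rn n → ℝ)
      (T : (Rn n → ℝ) → (Rn n → ℝ) → Rn n → ℝ), CZOp ω D C₀ C₂ K T →
      ∀ b : Rn n → ℝ, IsBMO b M → ∀ (α τ : ℝ) (G q : Rn n → ℝ) (c : Rn n) (ρ : ℝ),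
        0 < α → 0 < τ → Integrable G → HasCompactSupport G → (∀ y, |G y| ≤ α) →
        IsMol c ρ q → (∀ y, |q y| ≤ τ) →
        ∫⁻ x, ‖b x - avgOn b (cube c (2 * ρ))‖ₑ * ‖T G q x‖ₑ ≤
          ENNReal.ofReal (κ * ((C₀ + C₂) * α * (τ * ρ ^ n))) := by
  obtain ⟨W, hW⟩ := hω.lintegral_wt_bound n
  obtain ⟨W', hW'⟩ := hω.lintegral_wt_le n M
  obtain ⟨κ₁, hκ₁⟩ := hω.exists_lintegral_sq_le n
  have hD := hω.one_le
  have hB := bmoConst_nonneg (n := n) hM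
  set B := (2 * bmoConst n M + 2 * (2 ^ n * M) ^ 2) * (1 + ((3 : ℕ) : ℝ)) ^ 2 with hBdef
  have hB0 : 0 ≤ B := by positivity
  set k₁ : ℝ := D * 4 ^ n * 4 ^ n * W * W' with hk₁
  set k₂ : ℝ := D * 4 ^ n * 4 ^ n * √(ω 1) * W * (1 + B) * 16 ^ n with hk₂
  set k₃ : ℝ := (B + κ₁) * 16 ^ n with hk₃
  have hk₁0 : 0 ≤ k₁ := by positivity
  have hk₂0 : 0 ≤ k₂ := by positivity
  have hk₃0 : 0 ≤ k₃ := by positivity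
  refine ⟨(k₁ + k₂ + k₃).toNNReal, ?_⟩
  intro C₀ C₂ K T hT b hb α τ G q c ρ hα hτ hGi hGc hGα hq hqτ
  have hn : (1 : ℝ) ≤ n := by exact_mod_cast hT.one_le_dim
  have hC₀ := hT.pos₀
  have hC₂ := hT.pos₂
  have hρ := hq.pos
  set β := avgOn b (cube c (2 * ρ)) with hβ
  set Q := hcube c (2 ^ 3 * ρ) with hQ
  have hQm : MeasurableSet Q := measurableSet_hcube _ _
  have hQv : volume Q = ENNReal.ofReal ((16 * ρ) ^ n) := by
    rw [hQ, volume_hcube c (by positivity)]; congr 2; ring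
  set N := Metric.closedBall c (4 * (n * (2 ^ 3 * ρ))) with hN
  have hNm : MeasurableSet N := measurableSet_closedBall
  set G₁ := N.indicator G with hG₁
  set G₂ := Nᶜ.indicator G with hG₂
  have iG₁ : Integrable G₁ := hGi.indicator hNm
  have iG₂ : Integrable G₂ := hGi.indicator hNm.compl
  have hmem : ∀ {y}, y ∈ N ↔ ‖y - c‖ ≤ 4 * (n * (2 ^ 3 * ρ)) := fun {y} => by
    simp [hN, dist_eq_norm]
  have hq1 := hq.lintegral_le hqτ
  have far := hT.swap.ae_enorm_le_far hq hGi hGc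
  have near := hT.swap.ae_enorm_le_near hq iG₂ (hasCompactSupport_indicator hGc _)
    (L := 8 * n) (by linarith) (fun y hy => by
      have hyN : y ∈ N := hmem.2 (hy.trans (by nlinarith))
      simp [hG₂, hyN])
  have jn := hκ₁ C₀ C₂ K T hT α τ G₁ q hα hτ iG₁ hq.integrable
    (hasCompactSupport_indicator hGc _) hq.hasCompactSupport (abs_indicator_le hGα _) hqτ
    c (2 ^ 3 * ρ) (by positivity)
    (fun y hy => indicator_of_notMem (fun hc => absurd (hmem.1 hc) (not_le.2 hy)) _)
    (fun y hy => hq.eq_zero y (by nlinarith))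
  set A := (C₀ + C₂) * (α * τ) with hA
  have hA0 : 0 < A := by positivity
  set m : Rn n → ℝ≥0∞ := fun x => 1 + ENNReal.ofReal ((b x - β) ^ 2) with hm
  set E₁ : ℝ≥0∞ := ENNReal.ofReal (C₀ * (D * 4 ^ n) * (τ * (4 * ρ) ^ n * (α * W))) with hE₁
  set E₂ : ℝ≥0∞ := ENNReal.ofReal (C₀ * (D * 4 ^ n) * (τ * 4 ^ n * √(ω 1) * (α * W))) with hE₂
  have hmm : AEMeasurable m :=
    (((hb.aemeasurable.sub_const β).pow_const 2).ennreal_ofReal).const_add 1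
  have hbm : AEMeasurable fun x => ENNReal.ofReal ((b x - β) ^ 2) :=
    ((hb.aemeasurable.sub_const β).pow_const 2).ennreal_ofReal
  have hb2 := hb.lintegral_hcube_pow_sq_le c hρ 3
  rw [← hBdef, ← hQ, ← hβ] at hb2
  have hmQ : ∫⁻ x in Q, m x ≤ ENNReal.ofReal (1 + B) * volume Q := by
    rw [hm, lintegral_add_left measurable_const, lintegral_const, Measure.restrict_apply_univ,
      ENNReal.ofReal_add zero_le_one hB0, ENNReal.ofReal_one, add_mul]
    gcongr
  have hpt : ∀ᵐ x, ‖b x - β‖ₑ * ‖T G q x‖ₑ ≤ E₁ * (wt ω c ρ x * m x) +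
      Q.indicator (fun x => E₂ * m x + (ENNReal.ofReal A * ENNReal.ofReal ((b x - β) ^ 2) +
        ENNReal.ofReal A⁻¹ * ENNReal.ofReal ((T G₁ q x) ^ 2))) x := by
    filter_upwards [far, near] with x hfar hnear
    by_cases hx : x ∈ Q
    · refine le_add_left ?_
      rw [indicator_of_mem hx]
      have hxc : ‖x - c‖ ≤ 8 * n * ρ := by
        have := norm_sub_le_of_mem_hcube hx
        nlinarith
      have e : T G q x = T G₂ q x + T G₁ q x := by
        rw [← hT.bilin.1 G₂ G₁ q iG₂ iG₁ hq.integrable]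
        congr 1; ext y; exact (congrFun (indicator_compl_add_self N G) y).symm
      have h2 : ‖T G₂ q x‖ₑ ≤ E₂ := by
        refine (hnear hxc).trans ?_
        have hw := lintegral_enorm_mul_wt_le hW (abs_indicator_le hGα Nᶜ) c hρ
        have hwc : wt ω c ρ c = ENNReal.ofReal (√(ω 1) / ρ ^ n) := by
          simp [wt, hρ.ne']
        rw [hwc]
        refine (mul_le_mul' le_rfl (mul_le_mul' (mul_le_mul' hq1 le_rfl) hw)).trans (le_of_eq ?_)
        rw [← ENNReal.ofReal_mul (by positivity), ← ENNReal.ofReal_mul (by positivity),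
          ← ENNReal.ofReal_mul (by positivity), hE₂]
        congr 1
        rw [mul_pow]; field_simp
      calc ‖b x - β‖ₑ * ‖T G q x‖ₑ ≤ ‖b x - β‖ₑ * (‖T G₂ q x‖ₑ + ‖T G₁ q x‖ₑ) := by
            rw [e]; gcongr; exact enorm_add_le _ _
        _ = ‖b x - β‖ₑ * ‖T G₂ q x‖ₑ + ‖b x - β‖ₑ * ‖T G₁ q x‖ₑ := mul_add _ _ _
        _ ≤ m x * E₂ + _ := add_le_add (mul_le_mul' (enorm_le_one_add_sq _) h2)
            (enorm_mul_enorm_le hA0 _ _)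
        _ = _ := by rw [mul_comm (m x)]
    · refine le_add_right ?_
      have hxc : 4 * ρ < ‖x - c‖ := by
        by_contra hc
        exact hx (mem_hcube_of_norm_lt (by linarith))
      have hw := lintegral_enorm_mul_wt_le hW hGα c hρ
      calc ‖b x - β‖ₑ * ‖T G q x‖ₑ ≤ m x * (ENNReal.ofReal (C₀ * (D * 4 ^ n)) *
            (ENNReal.ofReal (τ * (4 * ρ) ^ n) * wt ω c ρ x * ENNReal.ofReal (α * W))) := by
            refine mul_le_mul' (enorm_le_one_add_sq _) ((hfar hxc).trans ?_)
            gcongr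
        _ = _ := by
            rw [hE₁, ENNReal.ofReal_mul (p := C₀ * (D * 4 ^ n)) (by positivity),
              ENNReal.ofReal_mul (p := τ * (4 * ρ) ^ n) (by positivity)]
            ring
  have hTm : Measurable fun x => ENNReal.ofReal ((T G₁ q x) ^ 2) :=
    ((hT.meas G₁ q iG₁ hq.integrable).pow_const 2).ennreal_ofReal
  calc _ ≤ _ := lintegral_mono_ae hpt
    _ = E₁ * (∫⁻ x, wt ω c ρ x * m x) + (E₂ * (∫⁻ x in Q, m x) +
        (ENNReal.ofReal A * (∫⁻ x in Q, ENNReal.ofReal ((b x - β) ^ 2)) +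
        ENNReal.ofReal A⁻¹ * ∫⁻ x in Q, ENNReal.ofReal ((T G₁ q x) ^ 2))) := by
        have hwm : AEMeasurable fun x => E₁ * (wt ω c ρ x * m x) :=
          ((hω.measurable_wt c ρ).aemeasurable.mul hmm).const_mul _
        have hE₂m : AEMeasurable (fun x => E₂ * m x) (volume.restrict Q) :=
          hmm.restrict.const_mul _
        have hAb : AEMeasurable (fun x => ENNReal.ofReal A * ENNReal.ofReal ((b x - β) ^ 2))
            (volume.restrict Q) := hbm.restrict.const_mul _
        rw [lintegral_add_left' hwm,
          lintegral_const_mul' _ _ ENNReal.ofReal_ne_top, lintegral_indicator hQm,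
          lintegral_add_left' hE₂m,
          lintegral_const_mul' _ _ ENNReal.ofReal_ne_top,
          lintegral_add_left' hAb,
          lintegral_const_mul' _ _ ENNReal.ofReal_ne_top,
          lintegral_const_mul' _ _ ENNReal.ofReal_ne_top]
    _ ≤ E₁ * W' + (E₂ * (ENNReal.ofReal (1 + B) * volume Q) +
        (ENNReal.ofReal A * (ENNReal.ofReal B * volume Q) +
        ENNReal.ofReal A⁻¹ * (ENNReal.ofReal (κ₁ * A ^ 2) * volume Q))) := by
        gcongr
        exact hW' b hb c ρ hρ
    _ = ENNReal.ofReal (C₀ * (D * 4 ^ n) * (τ * (4 * ρ) ^ n * (α * W)) * W' +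
        (C₀ * (D * 4 ^ n) * (τ * 4 ^ n * √(ω 1) * (α * W)) * ((1 + B) * (16 * ρ) ^ n) +
        (A * (B * (16 * ρ) ^ n) + A⁻¹ * (κ₁ * A ^ 2 * (16 * ρ) ^ n)))) := by
        rw [hQv, hE₁, hE₂, ← ENNReal.ofReal_coe_nnreal (p := W')]
        have hW0 : (0:ℝ) ≤ W' := W'.2
        have hB1 : 0 ≤ 1 + B := by positivity
        generalize 1 + B = B₁ at hB1 ⊢
        rw [ENNReal.ofReal_add (by positivity) (by positivity),
          ENNReal.ofReal_add (by positivity) (by positivity),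
          ENNReal.ofReal_add (by positivity) (by positivity),
          ENNReal.ofReal_mul (q := (W' : ℝ)) (by positivity),
          ENNReal.ofReal_mul (q := B₁ * (16 * ρ) ^ n) (by positivity),
          ENNReal.ofReal_mul (p := B₁) (by positivity),
          ENNReal.ofReal_mul (p := A) (by positivity),
          ENNReal.ofReal_mul (p := B) (by positivity),
          ENNReal.ofReal_mul (p := A⁻¹) (by positivity),
          ENNReal.ofReal_mul (q := (16 * ρ) ^ n) (p := κ₁ * A ^ 2) (by positivity)]
    _ ≤ _ := by
        refine ENNReal.ofReal_le_ofReal ?_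
        rw [Real.coe_toNNReal _ (by positivity)]
        have e1 : A⁻¹ * (κ₁ * A ^ 2 * (16 * ρ) ^ n) = A * (κ₁ * (16 * ρ) ^ n) := by field_simp
        have e2 : C₀ * (D * 4 ^ n) * (τ * (4 * ρ) ^ n * (α * W)) * W' =
            C₀ * α * (τ * ρ ^ n) * k₁ := by rw [hk₁, mul_pow]; ring
        have e3 : C₀ * (D * 4 ^ n) * (τ * 4 ^ n * √(ω 1) * (α * W)) * ((1 + B) * (16 * ρ) ^ n) =
            C₀ * α * (τ * ρ ^ n) * k₂ := by rw [hk₂, mul_pow]; ring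
        have e4 : A * (B * (16 * ρ) ^ n) + A * (κ₁ * (16 * ρ) ^ n) =
            (C₀ + C₂) * α * (τ * ρ ^ n) * k₃ := by rw [hk₃, mul_pow, hA]; ring
        rw [e1, e2, e3, e4]
        have hp : 0 ≤ C₂ * α * (τ * ρ ^ n) := by positivity
        nlinarith [mul_nonneg hp hk₁0, mul_nonneg hp hk₂0]

lemma gridIdx_gridCentre {n : ℕ} (k : ℤ) (m : Fin n → ℤ) :
    gridIdx (0 : Rn n) 1 k (gridCentre 0 1 k m) = m := by
  have h : gridCentre (0 : Rn n) 1 k m ∈ gridCell 0 1 k m := by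
    rw [gridCell_eq_hcube _ one_pos]
    refine mem_hcube_of_norm_lt ?_
    rw [sub_self, norm_zero]; positivity
  exact h

/-- Stopping-time selection: an atom is bad when some dyadic ancestor of its cube carries mass
above `α`; `(L k, I k)` indexes the maximal such ancestor. -/
lemma exists_stopping_cubes {n N : ℕ} (hn : 1 ≤ n) (lev : Fin N → ℤ) (idx : Fin N → Fin n → ℤ)
    (μ : Fin N → ℝ) (hμ : ∀ k, 0 ≤ μ k) (hsum : ∑ k, μ k ≤ 1) {α : ℝ} (hα : 0 < α) :
    ∃ (bad : Finset (Fin N)) (L : Fin N → ℤ) (I : Fin N → Fin n → ℤ),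
      (∀ k ∈ bad, lev k ≤ L k ∧
        gridCell (0 : Rn n) 1 (lev k) (idx k) ⊆ gridCell 0 1 (L k) (I k)) ∧
      (∀ k ∈ bad, ∀ l ∈ bad, ∀ x : Rn n, x ∈ gridCell 0 1 (L k) (I k) →
        x ∈ gridCell 0 1 (L l) (I l) → (L k, I k) = (L l, I l)) ∧
      (α * ∑ p ∈ bad.image fun k => (L k, I k), ((2 : ℝ) ^ p.1) ^ n ≤ 1) ∧
      (∀ k ∈ bad, ∑ l ∈ bad.filter (fun l => (L l, I l) = (L k, I k)), μ l ≤
        2 ^ n * α * ((2 : ℝ) ^ L k) ^ n) ∧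
      (∀ s : Finset (Fin N), ∀ x : Rn n, (∀ k ∈ s, k ∉ bad ∧ x ∈ gridCell 0 1 (lev k) (idx k)) →
        ∑ k ∈ s, μ k / ((2 : ℝ) ^ lev k) ^ n ≤ α) := by
  classical
  set cell : Fin N → Set (Rn n) := fun k => gridCell 0 1 (lev k) (idx k) with hcell
  have hcm : ∀ k m, MeasurableSet (gridCell (0 : Rn n) 1 k m) := fun k m =>
    measurableSet_gridCell 0 one_pos k m
  have hcv : ∀ k m, volume (gridCell (0 : Rn n) 1 k m) = ENNReal.ofReal (((2 : ℝ) ^ k) ^ n) :=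
    fun k m => by rw [volume_gridCell 0 one_pos, one_mul]
  have hV : ∀ k : ℤ, 0 < ((2 : ℝ) ^ k) ^ n := fun k => by positivity
  set ν : Measure (Rn n) := ∑ k, ENNReal.ofReal (μ k / ((2 : ℝ) ^ lev k) ^ n) •
    volume.restrict (cell k) with hν
  have hνS : ∀ S : Set (Rn n), MeasurableSet S → ν S =
      ∑ k, ENNReal.ofReal (μ k / ((2 : ℝ) ^ lev k) ^ n) * volume (S ∩ cell k) := fun S hS => by
    simp [hν, Measure.finsetSum_apply, Measure.restrict_apply hS]
  have hle : ∀ S : Set (Rn n), MeasurableSet S → ∀ s : Finset (Fin N),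
      ∑ k ∈ s, ENNReal.ofReal (μ k / ((2 : ℝ) ^ lev k) ^ n) * volume (S ∩ cell k) ≤ ν S :=
    fun S hS s => by
      rw [hνS S hS]
      exact Finset.sum_le_sum_of_subset (Finset.subset_univ s)
  have hmass : ∀ k, ENNReal.ofReal (μ k / ((2 : ℝ) ^ lev k) ^ n) * volume (cell k) =
      ENNReal.ofReal (μ k) := fun k => by
    rw [hcell, hcv, ← ENNReal.ofReal_mul (div_nonneg (hμ k) (hV _).le),
      div_mul_cancel₀ _ (hV _).ne']
  have hν1 : ν univ ≤ 1 := by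
    rw [hνS univ MeasurableSet.univ]
    simp_rw [univ_inter, hmass]
    rw [← ENNReal.ofReal_sum_of_nonneg fun k _ => hμ k, ← ENNReal.ofReal_one]
    exact ENNReal.ofReal_le_ofReal hsum
  set ctr : Fin N → Rn n := fun k => gridCentre 0 1 (lev k) (idx k) with hctr
  set P : ℤ → Rn n → Prop := fun l x =>
    ENNReal.ofReal (α * ((2 : ℝ) ^ l) ^ n) < ν (gridCell 0 1 l (gridIdx 0 1 l x)) with hP
  have hfin : ∀ k, ∃ B : ℕ, ∀ j : ℕ, P (lev k + j) (ctr k) → j ≤ B := fun k => by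
    obtain ⟨B, hB⟩ := pow_unbounded_of_one_lt (max 1 α⁻¹ / 2 ^ lev k) (one_lt_two (α := ℝ))
    refine ⟨B, fun j hj => ?_⟩
    by_contra! hBj
    have h1 : max 1 α⁻¹ ≤ (2 : ℝ) ^ (lev k + j) := by
      rw [zpow_add₀ two_ne_zero, zpow_natCast, mul_comm, ← div_le_iff₀ (by positivity)]
      exact hB.le.trans (pow_le_pow_right₀ one_le_two hBj.le)
    have h2 : α⁻¹ ≤ ((2 : ℝ) ^ (lev k + j)) ^ n :=
      ((le_max_right _ _).trans h1).trans
        (le_self_pow₀ ((le_max_left _ _).trans h1) (by omega))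
    have h3 : (1 : ℝ≥0∞) ≤ ENNReal.ofReal (α * ((2 : ℝ) ^ (lev k + j)) ^ n) := by
      rw [← ENNReal.ofReal_one]
      refine ENNReal.ofReal_le_ofReal ?_
      rwa [inv_le_iff_one_le_mul₀' hα] at h2
    exact absurd (hj.trans_le ((measure_mono (subset_univ _)).trans hν1)) (not_lt.2 h3)
  have hmax : ∀ k, ∃ J : ℕ, (∃ j : ℕ, P (lev k + j) (ctr k)) →
      P (lev k + J) (ctr k) ∧ ∀ j : ℕ, J < j → ¬ P (lev k + j) (ctr k) := fun k => by
    obtain ⟨B, hB⟩ := hfin k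
    by_cases h : ∃ j : ℕ, P (lev k + j) (ctr k)
    · have hbdd : BddAbove {j : ℕ | P (lev k + j) (ctr k)} := ⟨B, fun j hj => hB j hj⟩
      exact ⟨sSup {j : ℕ | P (lev k + j) (ctr k)}, fun _ => ⟨Nat.sSup_mem h hbdd,
        fun j hj hPj => absurd (le_csSup hbdd hPj) (not_le.2 hj)⟩⟩
    · exact ⟨0, fun h' => absurd h' h⟩
  choose J hJ using hmax
  set bad : Finset (Fin N) := Finset.univ.filter fun k => ∃ j : ℕ, P (lev k + j) (ctr k) with hbad
  have hbadJ : ∀ k ∈ bad, P (lev k + J k) (ctr k) ∧ ∀ j : ℕ, J k < j → ¬ P (lev k + j) (ctr k) :=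
    fun k hk => hJ k (by simpa [hbad] using hk)
  set L : Fin N → ℤ := fun k => lev k + J k with hL
  set I : Fin N → Fin n → ℤ := fun k => gridIdx 0 1 (L k) (ctr k) with hI
  have hsub : ∀ k, cell k ⊆ gridCell 0 1 (L k) (I k) := fun k =>
    gridCell_subset (by simp [hL]) (gridIdx_gridCentre _ _)
  have huniq : ∀ k ∈ bad, ∀ l ∈ bad, ∀ x : Rn n, x ∈ gridCell 0 1 (L k) (I k) →
      x ∈ gridCell 0 1 (L l) (I l) → L k ≤ L l → (L k, I k) = (L l, I l) := by
    intro k hk l hl x hxk hxl hkl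
    have e : gridIdx 0 1 (L l) (ctr k) = I l :=
      (gridIdx_congr hkl (show gridIdx 0 1 (L k) (ctr k) = gridIdx 0 1 (L k) x from hxk.symm)).trans
        hxl
    rcases hkl.eq_or_lt with h | h
    · exact Prod.ext h (by rw [← e, ← h])
    · exfalso
      refine (hbadJ k hk).2 (L l - lev k).toNat (by simp only [hL] at h ⊢; omega) ?_
      have h2 : lev k + ((L l - lev k).toNat : ℤ) = L l := by simp only [hL] at h ⊢; omega
      rw [h2, hP]
      dsimp only
      rw [e]
      exact (hbadJ l hl).1
  have huniq' : ∀ k ∈ bad, ∀ l ∈ bad, ∀ x : Rn n, x ∈ gridCell 0 1 (L k) (I k) →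
      x ∈ gridCell 0 1 (L l) (I l) → (L k, I k) = (L l, I l) := fun k hk l hl x hxk hxl =>
    (le_total (L k) (L l)).elim (huniq k hk l hl x hxk hxl)
      fun h => (huniq l hl k hk x hxl hxk h).symm
  refine ⟨bad, L, I, fun k _ => ⟨by simp [hL], hsub k⟩, huniq', ?_, fun k hk => ?_,
    fun s x hs => ?_⟩
  · have h : ENNReal.ofReal (α * ∑ p ∈ bad.image fun k => (L k, I k), ((2 : ℝ) ^ p.1) ^ n) ≤ 1 := by
      rw [Finset.mul_sum, ENNReal.ofReal_sum_of_nonneg fun p _ => by positivity]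
      calc _ ≤ ∑ p ∈ bad.image fun k => (L k, I k), ν (gridCell 0 1 p.1 p.2) := by
            refine Finset.sum_le_sum fun p hp => ?_
            obtain ⟨k, hk, rfl⟩ := Finset.mem_image.1 hp
            exact (hbadJ k hk).1.le
        _ = ν (⋃ p ∈ bad.image fun k => (L k, I k), gridCell 0 1 p.1 p.2) := by
            refine (measure_biUnion_finset ?_ fun p _ => hcm _ _).symm
            intro p hp q hq hpq
            obtain ⟨k, hk, rfl⟩ := Finset.mem_image.1 hp
            obtain ⟨l, hl, rfl⟩ := Finset.mem_image.1 hq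
            exact Set.disjoint_left.2 fun x hx hx' => hpq (huniq' k hk l hl x hx hx')
        _ ≤ 1 := (measure_mono (subset_univ _)).trans hν1
    rwa [ENNReal.ofReal_le_one] at h
  · have h1 : ∑ l ∈ bad.filter (fun l => (L l, I l) = (L k, I k)), ENNReal.ofReal (μ l) ≤
        ν (gridCell 0 1 (L k) (I k)) := by
      refine le_trans (le_of_eq ?_) (hle _ (hcm (L k) (I k))
        (bad.filter fun l => (L l, I l) = (L k, I k)))
      refine Finset.sum_congr rfl fun l hl => ?_
      have e := (Finset.mem_filter.1 hl).2
      simp only [Prod.mk.injEq] at e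
      rw [inter_eq_right.2 (by rw [← e.1, ← e.2]; exact hsub l), hmass]
    have h2 : ν (gridCell 0 1 (L k) (I k)) ≤ ENNReal.ofReal (α * ((2 : ℝ) ^ (L k + 1)) ^ n) := by
      have h3 := not_lt.1 ((hbadJ k hk).2 (J k + 1) (Nat.lt_succ_self _))
      rw [show lev k + ((J k + 1 : ℕ) : ℤ) = L k + 1 by simp [hL, add_assoc]] at h3
      exact (measure_mono (gridCell_subset (by omega) rfl)).trans h3
    rw [← ENNReal.ofReal_sum_of_nonneg fun l _ => hμ l] at h1
    refine ((ENNReal.ofReal_le_ofReal_iff (by positivity)).1 (h1.trans h2)).trans (le_of_eq ?_)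
    rw [zpow_add_one₀ two_ne_zero, mul_pow]; ring
  · rcases s.eq_empty_or_nonempty with rfl | hne
    · simpa using hα.le
    obtain ⟨k₀, hk₀, hmin⟩ := s.exists_min_image lev hne
    have hsub' : ∀ k ∈ s, cell k₀ ⊆ cell k := fun k hk => by
      have := gridCell_subset (hmin k hk) (hs k₀ hk₀).2
      rwa [show gridIdx 0 1 (lev k) x = idx k from (hs k hk).2] at this
    have h1 := hle (cell k₀) (hcm _ _) s
    rw [Finset.sum_congr rfl fun k hk => by rw [inter_eq_left.2 (hsub' k hk)], ← Finset.sum_mul,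
      ← ENNReal.ofReal_sum_of_nonneg fun k _ => div_nonneg (hμ k) (hV _).le] at h1
    have h2 : ν (cell k₀) ≤ ENNReal.ofReal (α * ((2 : ℝ) ^ lev k₀) ^ n) := by
      have h3 : ¬ P (lev k₀ + (0 : ℕ)) (ctr k₀) := fun h =>
        (hs k₀ hk₀).1 (by simp only [hbad, Finset.mem_filter_univ]; exact ⟨0, h⟩)
      simp only [hP, Nat.cast_zero, add_zero, not_lt] at h3
      rwa [hctr, gridIdx_gridCentre] at h3
    have h4 := h1.trans h2
    rw [hcell] at h4
    simp only at h4
    rw [hcv, ← ENNReal.ofReal_mul (Finset.sum_nonneg fun k _ => div_nonneg (hμ k) (hV _).le),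
      ENNReal.ofReal_le_ofReal_iff (by positivity)] at h4
    exact le_of_mul_le_mul_right h4 (hV _)

lemma hasCompactSupport_sum {n : ℕ} {ι : Type*} (s : Finset ι) {f : ι → Rn n → ℝ}
    (h : ∀ i ∈ s, HasCompactSupport (f i)) : HasCompactSupport fun x => ∑ i ∈ s, f i x := by
  classical
  induction s using Finset.induction_on with
  | empty => exact HasCompactSupport.zero
  | insert i s hi ih =>
    simp_rw [Finset.sum_insert hi]
    exact (h i (Finset.mem_insert_self _ _)).add
      (ih fun j hj => h j (Finset.mem_insert_of_mem hj))

lemma lintegral_enorm_sum_le {n : ℕ} {ι : Type*} (s : Finset ι) {f : ι → Rn n → ℝ}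
    (h : ∀ i ∈ s, AEMeasurable (f i)) :
    ∫⁻ x, ‖∑ i ∈ s, f i x‖ₑ ≤ ∑ i ∈ s, ∫⁻ x, ‖f i x‖ₑ := by
  rw [← lintegral_finsetSum' s fun i hi => (h i hi).enorm]
  exact lintegral_mono fun x => enorm_sum_le _ _

/-- Centre of the dyadic cube of level `l` and index `m`. -/
def dyCentre {n : ℕ} (l : ℤ) (m : Fin n → ℤ) : Rn n := gridCentre 0 1 l m

/-- Radius of a ball about its centre containing a dyadic cube of level `l`. -/
def dyRadius (n : ℕ) (l : ℤ) : ℝ := n * (2 ^ l / 2)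

lemma dyRadius_pos {n : ℕ} (hn : 1 ≤ n) (l : ℤ) : 0 < dyRadius n l := by
  have : (1 : ℝ) ≤ n := by exact_mod_cast hn
  unfold dyRadius; positivity

lemma norm_sub_dyCentre_le {n : ℕ} {l : ℤ} {m : Fin n → ℤ} {x : Rn n}
    (hx : x ∈ gridCell (0 : Rn n) 1 l m) : ‖x - dyCentre l m‖ ≤ dyRadius n l := by
  rw [gridCell_eq_hcube _ one_pos] at hx
  simpa [dyRadius, dyCentre] using norm_sub_le_of_mem_hcube hx

lemma dyCentre_mem {n : ℕ} (l : ℤ) (m : Fin n → ℤ) :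
    dyCentre l m ∈ gridCell (0 : Rn n) 1 l m := gridIdx_gridCentre l m

lemma volume_dyCell {n : ℕ} (l : ℤ) (m : Fin n → ℤ) :
    volume (gridCell (0 : Rn n) 1 l m) = ENNReal.ofReal (((2 : ℝ) ^ l) ^ n) := by
  rw [volume_gridCell 0 one_pos, one_mul]

lemma dyCell_subset_cube {n : ℕ} (hn : 1 ≤ n) (l : ℤ) (m : Fin n → ℤ) :
    gridCell (0 : Rn n) 1 l m ⊆ cube (dyCentre l m) (2 * dyRadius n l) := by
  have h1 : (1 : ℝ) ≤ n := by exact_mod_cast hn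
  rw [gridCell_eq_hcube _ one_pos]
  refine (hcube_subset_cube _ _).trans (cube_subset_cube _ ?_)
  have : (0 : ℝ) < 2 ^ l := by positivity
  unfold dyRadius; nlinarith

/-- A pointwise bounded `(1,∞,0)`-atom on the dyadic cube of level `l` and index `m`. -/
structure IsDyAtom {n : ℕ} (l : ℤ) (m : Fin n → ℤ) (a : Rn n → ℝ) : Prop where
  measurable : Measurable a
  eq_zero : ∀ x, x ∉ gridCell (0 : Rn n) 1 l m → a x = 0
  abs_le : ∀ x, |a x| ≤ (((2 : ℝ) ^ l) ^ n)⁻¹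
  integral_eq_zero : ∫ x, a x = 0

namespace IsDyAtom

variable {n : ℕ} {l : ℤ} {m : Fin n → ℤ} {a b : Rn n → ℝ} {M : ℝ}

lemma lintegral_mul_le (ha : IsDyAtom l m a) (u : Rn n → ℝ) :
    ∫⁻ x, ‖u x * a x‖ₑ ≤
      ENNReal.ofReal (((2 : ℝ) ^ l) ^ n)⁻¹ * ∫⁻ x in gridCell (0 : Rn n) 1 l m, ‖u x‖ₑ := by
  rw [← lintegral_const_mul' _ _ ENNReal.ofReal_ne_top,
    ← lintegral_indicator (measurableSet_gridCell 0 one_pos l m)]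
  refine lintegral_mono fun x => ?_
  by_cases hx : x ∈ gridCell (0 : Rn n) 1 l m
  · rw [indicator_of_mem hx, enorm_mul, mul_comm, Real.enorm_eq_ofReal_abs (a x)]
    gcongr
    exact ha.abs_le x
  · rw [ha.eq_zero x hx]; simp

lemma lintegral_le (ha : IsDyAtom l m a) : ∫⁻ x, ‖a x‖ₑ ≤ 1 := by
  have h := ha.lintegral_mul_le fun _ => 1
  simp only [one_mul, enorm_one, lintegral_const, Measure.restrict_apply_univ,
    volume_dyCell] at h
  rwa [← ENNReal.ofReal_mul (by positivity), inv_mul_cancel₀ (by positivity),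
    ENNReal.ofReal_one] at h

lemma integrable (ha : IsDyAtom l m a) : Integrable a :=
  ⟨ha.measurable.aestronglyMeasurable, ha.lintegral_le.trans_lt ENNReal.one_lt_top⟩

lemma isMol (hn : 1 ≤ n) (ha : IsDyAtom l m a) : IsMol (dyCentre l m) (dyRadius n l) a where
  pos := dyRadius_pos hn l
  integrable := ha.integrable
  eq_zero x hx := ha.eq_zero x fun h => absurd (norm_sub_dyCentre_le h) (not_le.2 hx)
  integral_eq_zero := ha.integral_eq_zero

lemma lintegral_osc_le (hn : 1 ≤ n) (ha : IsDyAtom l m a) (hb : IsBMO b M) :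
    ∫⁻ x, ‖(b x - avgOn b (cube (dyCentre l m) (2 * dyRadius n l))) * a x‖ₑ ≤
      ENNReal.ofReal (M * n ^ n) := by
  have hM := hb.nonneg
  refine (ha.lintegral_mul_le _).trans ?_
  refine (mul_le_mul' le_rfl ((lintegral_mono_set (dyCell_subset_cube hn l m)).trans
    (hb.lintegral_cube_le _ (dyRadius_pos hn l)))).trans (le_of_eq ?_)
  rw [← ENNReal.ofReal_mul (by positivity)]
  congr 1
  rw [dyRadius, show 2 * ((n : ℝ) * (2 ^ l / 2)) = n * 2 ^ l by ring, mul_pow]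
  field_simp

lemma integrable_osc (hn : 1 ≤ n) (ha : IsDyAtom l m a) (hb : IsBMO b M) :
    Integrable fun x => (b x - avgOn b (cube (dyCentre l m) (2 * dyRadius n l))) * a x :=
  ⟨((hb.aemeasurable.sub_const _).mul ha.measurable.aemeasurable).aestronglyMeasurable,
    (ha.lintegral_osc_le hn hb).trans_lt ENNReal.ofReal_lt_top⟩

lemma abs_integral_osc_le (hn : 1 ≤ n) (ha : IsDyAtom l m a) (hb : IsBMO b M) :
    |∫ x, (b x - avgOn b (cube (dyCentre l m) (2 * dyRadius n l))) * a x| ≤ M * n ^ n := by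
  have hM := hb.nonneg
  have h := (enorm_integral_le_lintegral_enorm _).trans (ha.lintegral_osc_le hn hb)
  rwa [Real.enorm_eq_ofReal_abs, ENNReal.ofReal_le_ofReal_iff (by positivity)] at h

end IsDyAtom

/-- Mean-one bump on a dyadic cube. -/
def dyBump {n : ℕ} (l : ℤ) (m : Fin n → ℤ) : Rn n → ℝ :=
  (gridCell (0 : Rn n) 1 l m).indicator fun _ => (((2 : ℝ) ^ l) ^ n)⁻¹

lemma measurable_dyBump {n : ℕ} (l : ℤ) (m : Fin n → ℤ) : Measurable (dyBump l m : Rn n → ℝ) :=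
  measurable_const.indicator (measurableSet_gridCell 0 one_pos l m)

lemma lintegral_dyBump {n : ℕ} (l : ℤ) (m : Fin n → ℤ) :
    ∫⁻ x : Rn n, ‖dyBump l m x‖ₑ = 1 := by
  have hp : (0 : ℝ) < (((2 : ℝ) ^ l) ^ n)⁻¹ := by positivity
  simp_rw [dyBump, enorm_indicator_eq_indicator_enorm]
  rw [lintegral_indicator (measurableSet_gridCell 0 one_pos l m), lintegral_const,
    Measure.restrict_apply_univ, volume_dyCell, Real.enorm_eq_ofReal hp.le,
    ← ENNReal.ofReal_mul hp.le, inv_mul_cancel₀ (by positivity), ENNReal.ofReal_one]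

lemma integrable_dyBump {n : ℕ} (l : ℤ) (m : Fin n → ℤ) :
    Integrable (dyBump l m : Rn n → ℝ) :=
  ⟨(measurable_dyBump l m).aestronglyMeasurable,
    (lintegral_dyBump l m).trans_lt ENNReal.one_lt_top⟩

lemma integral_dyBump {n : ℕ} (l : ℤ) (m : Fin n → ℤ) : ∫ x : Rn n, dyBump l m x = 1 := by
  have hp : (0 : ℝ) < (((2 : ℝ) ^ l) ^ n) := by positivity
  rw [dyBump, integral_indicator (measurableSet_gridCell 0 one_pos l m), setIntegral_const,
    measureReal_def, volume_dyCell, ENNReal.toReal_ofReal hp.le, smul_eq_mul,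
    mul_inv_cancel₀ hp.ne']

lemma dyBump_eq_zero {n : ℕ} {l : ℤ} {m : Fin n → ℤ} {x : Rn n}
    (hx : dyRadius n l < ‖x - dyCentre l m‖) : dyBump l m x = 0 :=
  indicator_of_notMem (fun h => absurd (norm_sub_dyCentre_le h) (not_le.2 hx)) _

/-- A Calderón–Zygmund type decomposition at height `α` of an atomic sum `f` and of `b f`. -/
structure Decomp {n : ℕ} (C α : ℝ) (b f : Rn n → ℝ) where
  ι : Type
  κ : Type
  [finι : Fintype ι]
  [finκ : Fintype κ]
  /-- good part -/
  g : Rn n → ℝ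
  /-- the part of `b g` not carried by atoms -/
  F : Rn n → ℝ
  /-- the bounded part of `b (f - g)` -/
  G : Rn n → ℝ
  h : ι → Rn n → ℝ
  c : ι → Rn n
  ρ : ι → ℝ
  ε : ι → ℝ
  γ : ι → ℝ
  q : κ → Rn n → ℝ
  c' : κ → Rn n
  ρ' : κ → ℝ
  τ : κ → ℝ
  μ : κ → ℝ
  Ω : Set (Rn n)
  isMol_h : ∀ i, IsMol (c i) (ρ i) (h i)
  isMol_q : ∀ k, IsMol (c' k) (ρ' k) (q k)
  eq_f : ∀ x, f x = g x + ∑ i, ε i * h i x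
  eq_bf : ∀ x, b x * f x = b x * g x + (∑ i, γ i * h i x + G x)
  eq_g : ∀ x, g x = ∑ k, μ k * q k x
  eq_bg : ∀ x, b x * g x = ∑ k, μ k * avgOn b (cube (c' k) (2 * ρ' k)) * q k x + F x
  abs_w_le : ∀ i x, |ε i * b x - γ i| ≤ 1 + |b x - avgOn b (cube (c i) (2 * ρ i))|
  sum_h_le : ∑ i, ∫⁻ x, ‖h i x‖ₑ ≤ ENNReal.ofReal C
  τ_pos : ∀ k, 0 < τ k
  abs_q_le : ∀ k x, |q k x| ≤ τ k
  sum_q_le : ∑ k, |μ k| * (τ k * ρ' k ^ n) ≤ C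
  measurable_g : Measurable g
  compact_g : HasCompactSupport g
  abs_g_le : ∀ x, |g x| ≤ α
  lintegral_g_le : ∫⁻ x, ‖g x‖ₑ ≤ ENNReal.ofReal C
  measurable_G : Measurable G
  compact_G : HasCompactSupport G
  abs_G_le : ∀ x, |G x| ≤ C * α
  lintegral_G_le : ∫⁻ x, ‖G x‖ₑ ≤ ENNReal.ofReal C
  aemeasurable_F : AEMeasurable F
  lintegral_F_le : ∫⁻ x, ‖F x‖ₑ ≤ ENNReal.ofReal C
  measurable_Ω : MeasurableSet Ω
  volume_Ω_le : volume Ω ≤ ENNReal.ofReal (C / α)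
  far : ∀ x ∉ Ω, ∀ i, 4 * ρ i < ‖x - c i‖

attribute [instance] Decomp.finι Decomp.finκ

/-- The constant in the decomposition lemma. -/
def decompConst (n : ℕ) (M : ℝ) : ℝ := (12 * n) ^ n * (1 + 2 * M)

lemma exists_decomp {n N : ℕ} (hn : 1 ≤ n) {lev : Fin N → ℤ} {idx : Fin N → Fin n → ℤ}
    {a : Fin N → Rn n → ℝ} (ha : ∀ k, IsDyAtom (lev k) (idx k) (a k)) (lam : Fin N → ℝ)
    (hlam : ∑ k, |lam k| ≤ 1) {b : Rn n → ℝ} {M : ℝ} (hb : IsBMO b M) {α : ℝ} (hα : 0 < α) :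
    Nonempty (Decomp (decompConst n M) α b fun x => ∑ k, lam k * a k x) := by
  classical
  have hM := hb.nonneg
  have hn1 : (1 : ℝ) ≤ n := by exact_mod_cast hn
  obtain ⟨bad, L, I, hsub, huniq, hcount, hmass, hgood⟩ :=
    exists_stopping_cubes hn lev idx (fun k => |lam k|) (fun k => abs_nonneg _) hlam hα
  set β : Fin N → ℝ := fun k => avgOn b (cube (dyCentre (lev k) (idx k)) (2 * dyRadius n (lev k)))
    with hβ
  set u : Fin N → Rn n → ℝ := fun k x => (b x - β k) * a k x with hu
  set m : Fin N → ℝ := fun k => ∫ x, u k x with hm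
  have hnn : (1 : ℝ) ≤ n ^ n := one_le_pow₀ hn1
  have h12 : (n : ℝ) ^ n ≤ (12 * n) ^ n := by gcongr; linarith
  have hC1 : (n : ℝ) ^ n * (1 + 2 * M) ≤ decompConst n M := by
    unfold decompConst; gcongr
  have hCM : M * n ^ n ≤ decompConst n M := by nlinarith
  have hC0 : 1 ≤ decompConst n M := by nlinarith
  have hum : ∀ k, |m k| ≤ M * n ^ n := fun k => (ha k).abs_integral_osc_le hn hb
  have hui : ∀ k, Integrable (u k) := fun k => (ha k).integrable_osc hn hb
  have hul : ∀ k, ∫⁻ x, ‖u k x‖ₑ ≤ ENNReal.ofReal (M * n ^ n) := fun k =>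
    (ha k).lintegral_osc_le hn hb
  have hlams : ∀ s : Finset (Fin N), ∑ k ∈ s, |lam k| ≤ 1 := fun s =>
    (Finset.sum_le_sum_of_subset_of_nonneg (Finset.subset_univ s)
      fun _ _ _ => abs_nonneg _).trans hlam
  have hsum0 : ∀ (B : ℝ), 0 ≤ B → ∀ s : Finset (Fin N), ∀ v : Fin N → Rn n → ℝ,
      (∀ k, ∫⁻ x, ‖v k x‖ₑ ≤ ENNReal.ofReal B) →
      ∑ k ∈ s, ∫⁻ x, ‖lam k * v k x‖ₑ ≤ ENNReal.ofReal B := by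
    intro B hB s v hvB
    calc ∑ k ∈ s, ∫⁻ x, ‖lam k * v k x‖ₑ
        ≤ ∑ k ∈ s, ENNReal.ofReal (|lam k| * B) := by
          refine Finset.sum_le_sum fun k _ => ?_
          simp_rw [enorm_mul]
          rw [lintegral_const_mul' _ _ enorm_ne_top, Real.enorm_eq_ofReal_abs,
            ENNReal.ofReal_mul (abs_nonneg _)]
          gcongr
          exact hvB k
      _ = ENNReal.ofReal ((∑ k ∈ s, |lam k|) * B) := by
          rw [Finset.sum_mul, ENNReal.ofReal_sum_of_nonneg fun k _ => by positivity]
      _ ≤ ENNReal.ofReal B := ENNReal.ofReal_le_ofReal (mul_le_of_le_one_left hB (hlams s))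
  have hsumle : ∀ (B : ℝ), 0 ≤ B → ∀ s : Finset (Fin N), ∀ v : Fin N → Rn n → ℝ,
      (∀ k, AEMeasurable (v k)) → (∀ k, ∫⁻ x, ‖v k x‖ₑ ≤ ENNReal.ofReal B) →
      ∫⁻ x, ‖∑ k ∈ s, lam k * v k x‖ₑ ≤ ENNReal.ofReal B := fun B hB s v hv hvB =>
    (lintegral_enorm_sum_le s fun k _ => (hv k).const_mul _).trans (hsum0 B hB s v hvB)
  have hal : ∀ k, ∫⁻ x, ‖a k x‖ₑ ≤ ENNReal.ofReal 1 := fun k => by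
    rw [ENNReal.ofReal_one]; exact (ha k).lintegral_le
  have hMn : 0 ≤ M * (n : ℝ) ^ n := by positivity
  have hGl : ∀ k, ∫⁻ x : Rn n, ‖m k * dyBump (L k) (I k) x‖ₑ ≤ ENNReal.ofReal (M * n ^ n) :=
    fun k => by
      simp_rw [enorm_mul]
      rw [lintegral_const_mul' _ _ enorm_ne_top, lintegral_dyBump, mul_one,
        Real.enorm_eq_ofReal_abs]
      exact ENNReal.ofReal_le_ofReal (hum k)
  have hsplit : ∀ w : Fin N → ℝ, ∑ k, w k =
      ∑ k : {k // k ∉ bad}, w k + ∑ k : {k // k ∈ bad}, w k := fun w => by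
    rw [add_comm]
    convert (Fintype.sum_subtype_add_sum_subtype (fun k => k ∈ bad) w).symm
  have hsumg : ∀ w : Fin N → ℝ, ∑ k : {k // k ∉ bad}, w k = ∑ k ∈ badᶜ, w k := fun w => by
    rw [← Finset.sum_coe_sort badᶜ]
    exact Fintype.sum_equiv (Equiv.subtypeEquivRight fun k => Finset.mem_compl.symm) _ _
      fun _ => rfl
  have hsumb : ∀ w : Fin N → ℝ, ∑ k : {k // k ∈ bad}, w k = ∑ k ∈ bad, w k := fun w =>
    Finset.sum_coe_sort bad w
  refine ⟨{
    ι := {k // k ∈ bad} ⊕ {k // k ∈ bad}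
    κ := {k // k ∉ bad}
    g := fun x => ∑ k : {k // k ∉ bad}, lam k * a k x
    F := fun x => ∑ k : {k // k ∉ bad}, lam k * u k x
    G := fun x => ∑ k : {k // k ∈ bad}, lam k * (m k * dyBump (L k) (I k) x)
    h := Sum.elim (fun k x => lam k * a k x)
      fun k x => lam k * (u k x - m k * dyBump (L k) (I k) x)
    c := Sum.elim (fun k => dyCentre (lev k) (idx k)) fun k => dyCentre (L k) (I k)
    ρ := Sum.elim (fun k => dyRadius n (lev k)) fun k => dyRadius n (L k)
    ε := Sum.elim (fun _ => 1) fun _ => 0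
    γ := Sum.elim (fun k => β k) fun _ => 1
    q := fun k => a k
    c' := fun k => dyCentre (lev k) (idx k)
    ρ' := fun k => dyRadius n (lev k)
    τ := fun k => (((2 : ℝ) ^ lev k) ^ n)⁻¹
    μ := fun k => lam k
    Ω := ⋃ p ∈ bad.image fun k => (L k, I k), Metric.closedBall (dyCentre p.1 p.2) (6 * dyRadius n p.1)
    isMol_h := ?_
    isMol_q := fun k => (ha k).isMol hn
    eq_f := ?_
    eq_bf := ?_
    eq_g := fun x => rfl
    eq_bg := ?_
    abs_w_le := ?_
    sum_h_le := ?_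
    τ_pos := fun k => by positivity
    abs_q_le := fun k => (ha k).abs_le
    sum_q_le := ?_
    measurable_g := Finset.measurable_fun_sum _ fun k _ => (ha k).measurable.const_mul _
    compact_g := hasCompactSupport_sum _ fun k _ => ((ha k).isMol hn).hasCompactSupport.mul_left
    abs_g_le := ?_
    lintegral_g_le := ?_
    measurable_G := Finset.measurable_fun_sum _ fun k _ =>
      ((measurable_dyBump _ _).const_mul _).const_mul _
    compact_G := ?_
    abs_G_le := ?_
    lintegral_G_le := ?_
    aemeasurable_F := Finset.aemeasurable_fun_sum _ fun k _ => (hui k).aemeasurable.const_mul _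
    lintegral_F_le := ?_
    measurable_Ω := Finset.measurableSet_biUnion _ fun p _ => measurableSet_closedBall
    volume_Ω_le := ?_
    far := ?_ }⟩
  · rintro (⟨k, hk⟩ | ⟨k, hk⟩)
    · have h := (ha k).isMol hn
      exact ⟨h.pos, h.integrable.const_mul _, fun x hx => by simp [h.eq_zero x hx],
        by simp [integral_const_mul, h.integral_eq_zero]⟩
    · have h := (ha k).isMol hn
      have hi := (integrable_dyBump (L k) (I k)).const_mul (m k)
      refine ⟨dyRadius_pos hn _, ((hui k).sub hi).const_mul _, fun x hx => ?_, ?_⟩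
      · simp only [Sum.elim_inr] at hx ⊢
        rw [dyBump_eq_zero hx, hu]
        have hxS : x ∉ gridCell (0 : Rn n) 1 (lev k) (idx k) := fun hc =>
          absurd (norm_sub_dyCentre_le ((hsub k hk).2 hc)) (not_le.2 hx)
        simp [(ha k).eq_zero x hxS]
      · simp only [Sum.elim_inr]
        rw [integral_const_mul, integral_sub (hui k) hi, integral_const_mul, integral_dyBump]
        simp [hm]
  · intro x
    simp only [Fintype.sum_sum_type, Sum.elim_inl, Sum.elim_inr, one_mul, zero_mul,
      Finset.sum_const_zero, add_zero]
    exact hsplit _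
  · intro x
    simp only [Fintype.sum_sum_type, Sum.elim_inl, Sum.elim_inr, one_mul]
    rw [hsplit, mul_add, add_assoc, ← Finset.sum_add_distrib, ← Finset.sum_add_distrib,
      Finset.mul_sum _ _ (b x)]
    congr 1
    rw [Finset.mul_sum]
    refine Finset.sum_congr rfl fun k _ => ?_
    simp only [hu]; ring
  · intro x
    rw [Finset.mul_sum, ← Finset.sum_add_distrib]
    refine Finset.sum_congr rfl fun k _ => ?_
    simp only [hu, hβ]; ring
  · rintro (k | k) x
    · simp [hβ]
    · simp
  · simp only [Fintype.sum_sum_type, Sum.elim_inl, Sum.elim_inr]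
    have h1 := hsum0 1 zero_le_one bad a hal
    have h2 := hsum0 (M * n ^ n + M * n ^ n) (by positivity) bad
      (fun k x => u k x - m k * dyBump (L k) (I k) x) fun k => by
        rw [ENNReal.ofReal_add hMn hMn]
        refine le_trans ?_ (add_le_add (hul k) (hGl k))
        rw [← lintegral_add_left' (hui k).aemeasurable.enorm]
        exact lintegral_mono fun x => enorm_sub_le
    rw [← Finset.sum_coe_sort] at h1 h2
    refine (add_le_add h1 h2).trans ?_
    rw [← ENNReal.ofReal_add (by positivity) (by positivity)]
    exact ENNReal.ofReal_le_ofReal (by nlinarith)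
  · have h : ∀ k, |lam k| * ((((2 : ℝ) ^ lev k) ^ n)⁻¹ * dyRadius n (lev k) ^ n) ≤
        |lam k| * n ^ n := fun k => by
      refine mul_le_mul_of_nonneg_left ?_ (abs_nonneg _)
      have hp : (0 : ℝ) < 2 ^ lev k := by positivity
      rw [dyRadius, mul_pow, inv_mul_le_iff₀ (by positivity), mul_comm]
      gcongr
      linarith
    rw [hsumg fun k => |lam k| * ((((2 : ℝ) ^ lev k) ^ n)⁻¹ * dyRadius n (lev k) ^ n)]
    refine (Finset.sum_le_sum fun k _ => h k).trans ?_
    rw [← Finset.sum_mul]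
    have := hlams badᶜ
    nlinarith
  · intro x
    rw [hsumg fun k => lam k * a k x]
    have h := hgood (badᶜ.filter fun k => x ∈ gridCell (0 : Rn n) 1 (lev k) (idx k)) x
      fun k hk => by simpa using hk
    refine le_trans ?_ h
    rw [Finset.sum_filter]
    refine (Finset.abs_sum_le_sum_abs _ _).trans (Finset.sum_le_sum fun k _ => ?_)
    split_ifs with hx
    · rw [abs_mul, div_eq_mul_inv]
      exact mul_le_mul_of_nonneg_left ((ha k).abs_le x) (abs_nonneg _)
    · simp [(ha k).eq_zero x hx]
  · refine (lintegral_congr fun x => by rw [hsumg fun k => lam k * a k x]).trans_le ?_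
    exact (hsumle 1 zero_le_one _ a (fun k => (ha k).measurable.aemeasurable) hal).trans
      (ENNReal.ofReal_le_ofReal hC0)
  · refine hasCompactSupport_sum _ fun k _ => ?_
    refine HasCompactSupport.intro (isCompact_closedBall (dyCentre (L k) (I k))
      (dyRadius n (L k))) fun x hx => ?_
    rw [Metric.mem_closedBall, dist_eq_norm, not_le] at hx
    rw [dyBump_eq_zero hx, mul_zero, mul_zero]
  · intro x
    rw [hsumb fun k => lam k * (m k * dyBump (L k) (I k) x)]
    set s := bad.filter fun k => x ∈ gridCell (0 : Rn n) 1 (L k) (I k) with hs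
    have h1 : |∑ k ∈ bad, lam k * (m k * dyBump (L k) (I k) x)| ≤
        ∑ k ∈ s, |lam k| * (M * n ^ n * (((2 : ℝ) ^ L k) ^ n)⁻¹) := by
      rw [hs, Finset.sum_filter]
      refine (Finset.abs_sum_le_sum_abs _ _).trans (Finset.sum_le_sum fun k _ => ?_)
      split_ifs with hx
      · rw [dyBump, indicator_of_mem hx, abs_mul, abs_mul, abs_of_pos
          (show (0 : ℝ) < (((2 : ℝ) ^ L k) ^ n)⁻¹ by positivity)]
        have := hum k
        gcongr
      · rw [dyBump, indicator_of_notMem hx]; simp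
    refine h1.trans ?_
    rcases s.eq_empty_or_nonempty with he | ⟨k₀, hk₀⟩
    · rw [he, Finset.sum_empty]; positivity
    have hk₀' := Finset.mem_filter.1 hk₀
    have hss : s ⊆ bad.filter fun l => (L l, I l) = (L k₀, I k₀) := fun l hl => by
      have hl' := Finset.mem_filter.1 hl
      exact Finset.mem_filter.2 ⟨hl'.1, huniq l hl'.1 k₀ hk₀'.1 x hl'.2 hk₀'.2⟩
    have hV : (0 : ℝ) < ((2 : ℝ) ^ L k₀) ^ n := by positivity
    have h2 : ∑ k ∈ s, |lam k| * (M * n ^ n * (((2 : ℝ) ^ L k) ^ n)⁻¹) =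
        (∑ k ∈ s, |lam k|) * (M * n ^ n * (((2 : ℝ) ^ L k₀) ^ n)⁻¹) := by
      rw [Finset.sum_mul]
      refine Finset.sum_congr rfl fun l hl => ?_
      rw [(Prod.mk.inj (Finset.mem_filter.1 (hss hl)).2).1]
    have h3 : ∑ k ∈ s, |lam k| ≤ 2 ^ n * α * ((2 : ℝ) ^ L k₀) ^ n :=
      (Finset.sum_le_sum_of_subset_of_nonneg hss fun _ _ _ => abs_nonneg _).trans
        (hmass k₀ hk₀'.1)
    rw [h2]
    calc _ ≤ 2 ^ n * α * ((2 : ℝ) ^ L k₀) ^ n * (M * n ^ n * (((2 : ℝ) ^ L k₀) ^ n)⁻¹) := by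
          gcongr
      _ = ((2 * n) ^ n * M) * α := by rw [mul_pow]; field_simp
      _ ≤ _ := by
          refine mul_le_mul_of_nonneg_right ?_ hα.le
          unfold decompConst
          have : ((2 : ℝ) * n) ^ n ≤ (12 * n) ^ n := by gcongr; norm_num
          have h0 : (0 : ℝ) ≤ (12 * n) ^ n := by positivity
          nlinarith
  · refine (lintegral_congr fun x => by rw [hsumb fun k => lam k * (m k * dyBump (L k) (I k) x)]).trans_le ?_
    exact (hsumle _ hMn bad (fun k x => m k * dyBump (L k) (I k) x)
      (fun k => ((measurable_dyBump _ _).const_mul _).aemeasurable) hGl).trans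
      (ENNReal.ofReal_le_ofReal hCM)
  · refine (lintegral_congr fun x => by rw [hsumg fun k => lam k * u k x]).trans_le ?_
    exact (hsumle _ hMn _ u (fun k => (hui k).aemeasurable) hul).trans
      (ENNReal.ofReal_le_ofReal hCM)
  · refine (measure_biUnion_finset_le _ _).trans ?_
    refine (Finset.sum_le_sum fun p _ => volume_closedBall_le _
      (by have := dyRadius_pos hn p.1; positivity)).trans ?_
    rw [← ENNReal.ofReal_sum_of_nonneg fun p _ => by
      have := dyRadius_pos hn p.1; positivity]
    refine ENNReal.ofReal_le_ofReal ?_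
    rw [le_div_iff₀ hα]
    have e : ∀ p : ℤ × (Fin n → ℤ), (4 * (6 * dyRadius n p.1)) ^ n =
        (12 * n) ^ n * ((2 : ℝ) ^ p.1) ^ n := fun p => by
      rw [dyRadius, ← mul_pow]; ring_nf
    simp_rw [e]
    rw [← Finset.mul_sum, mul_assoc, mul_comm _ α]
    unfold decompConst
    have h0 : (0 : ℝ) ≤ (12 * n) ^ n := by positivity
    gcongr
    linarith
  · intro x hx
    have hx' : ∀ k ∈ bad, 6 * dyRadius n (L k) < ‖x - dyCentre (L k) (I k)‖ := fun k hk => by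
      by_contra! hc
      refine hx (mem_biUnion (Finset.mem_image_of_mem (fun k => (L k, I k)) hk) ?_)
      rwa [Metric.mem_closedBall, dist_eq_norm]
    rintro (⟨k, hk⟩ | ⟨k, hk⟩)
    · simp only [Sum.elim_inl]
      have h1 := norm_sub_dyCentre_le ((hsub k hk).2 (dyCentre_mem (lev k) (idx k)))
      have h2 := hx' k hk
      have h3 := norm_sub_le_norm_sub_add_norm_sub x (dyCentre (lev k) (idx k))
        (dyCentre (L k) (I k))
      have h4 : dyRadius n (lev k) ≤ dyRadius n (L k) := by
        unfold dyRadius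
        have := zpow_le_zpow_right₀ (one_le_two (α := ℝ)) (hsub k hk).1
        gcongr
      linarith [dyRadius_pos hn (lev k)]
    · simp only [Sum.elim_inr]
      linarith [hx' k hk, dyRadius_pos hn (L k)]

namespace Decomp

variable {n : ℕ} {C α : ℝ} {b f : Rn n → ℝ} (d : Decomp C α b f)

lemma integrable_g : Integrable d.g :=
  ⟨d.measurable_g.aestronglyMeasurable, d.lintegral_g_le.trans_lt ENNReal.ofReal_lt_top⟩

lemma integrable_G : Integrable d.G :=
  ⟨d.measurable_G.aestronglyMeasurable, d.lintegral_G_le.trans_lt ENNReal.ofReal_lt_top⟩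

lemma integrable_F : Integrable d.F :=
  ⟨d.aemeasurable_F.aestronglyMeasurable, d.lintegral_F_le.trans_lt ENNReal.ofReal_lt_top⟩

lemma integrable_sum_h (w : d.ι → ℝ) : Integrable fun x => ∑ i, w i * d.h i x :=
  integrable_finsetSum _ fun i _ => (d.isMol_h i).integrable.const_mul _

lemma integrable_sum_q (w : d.κ → ℝ) : Integrable fun x => ∑ k, w k * d.q k x :=
  integrable_finsetSum _ fun k _ => (d.isMol_q k).integrable.const_mul _

lemma integrable_bg : Integrable fun x => b x * d.g x := by
  simp_rw [d.eq_bg]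
  exact (d.integrable_sum_q _).add d.integrable_F

end Decomp

lemma Decomp.integrable_f {n : ℕ} {C α : ℝ} {b f : Rn n → ℝ} (d : Decomp C α b f) :
    Integrable f := by
  rw [funext d.eq_f]
  exact d.integrable_g.add (d.integrable_sum_h _)

lemma Decomp.integrable_bf {n : ℕ} {C α : ℝ} {b f : Rn n → ℝ} (d : Decomp C α b f) :
    Integrable fun x => b x * f x := by
  simp_rw [d.eq_bf]
  exact d.integrable_bg.add ((d.integrable_sum_h _).add d.integrable_G)

/-- `V` is linear on integrable functions. -/
structure IsLinearOnL1 {n : ℕ} (V : (Rn n → ℝ) → ℝ) : Prop where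
  add : ∀ f g, Integrable f → Integrable g → V (fun y => f y + g y) = V f + V g
  smul : ∀ (r : ℝ) f, Integrable f → V (fun y => r * f y) = r * V f

namespace IsLinearOnL1

variable {n : ℕ} {V V' : (Rn n → ℝ) → ℝ}

lemma sum (hV : IsLinearOnL1 V) {ι : Type*} (s : Finset ι) (w : ι → ℝ) {h : ι → Rn n → ℝ}
    (hh : ∀ i, Integrable (h i)) :
    V (fun y => ∑ i ∈ s, w i * h i y) = ∑ i ∈ s, w i * V (h i) := by
  classical
  induction s using Finset.induction_on with
  | empty => simpa using hV.smul 0 (fun _ => 0) (integrable_zero _ _ _)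
  | insert i s hi ih =>
    simp_rw [Finset.sum_insert hi]
    rw [hV.add _ _ ((hh i).const_mul _) (integrable_finsetSum _ fun j _ => (hh j).const_mul _),
      hV.smul _ _ (hh i), ih]

lemma comb (hV : IsLinearOnL1 V) (hV' : IsLinearOnL1 V') (t : ℝ) :
    IsLinearOnL1 fun f => t * V f - V' f where
  add f g hf hg := by simp only [hV.add f g hf hg, hV'.add f g hf hg]; ring
  smul r f hf := by simp only [hV.smul r f hf, hV'.smul r f hf]; ring

lemma commutator (hV : IsLinearOnL1 V) {C α : ℝ} {b f : Rn n → ℝ} (d : Decomp C α b f) (t : ℝ) :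
    t * V f - V (fun y => b y * f y) = (t * V d.g - V (fun y => b y * d.g y)) +
      ∑ i, (d.ε i * t - d.γ i) * V (d.h i) - V d.G := by
  have hh : ∀ i, Integrable (d.h i) := fun i => (d.isMol_h i).integrable
  have h1 : V f = V d.g + ∑ i, d.ε i * V (d.h i) := by
    conv_lhs => rw [funext d.eq_f]
    rw [hV.add _ _ d.integrable_g (d.integrable_sum_h _), hV.sum _ _ hh]
  have h2 : V (fun y => b y * f y) =
      V (fun y => b y * d.g y) + (∑ i, d.γ i * V (d.h i) + V d.G) := by
    conv_lhs => rw [funext d.eq_bf]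
    have hs : Integrable fun y => ∑ i, d.γ i * d.h i y + d.G y :=
      (d.integrable_sum_h d.γ).add d.integrable_G
    rw [hV.add _ _ d.integrable_bg hs,
      hV.add _ _ (d.integrable_sum_h _) d.integrable_G, hV.sum _ _ hh]
  have h3 : ∑ i, (d.ε i * t - d.γ i) * V (d.h i) =
      t * ∑ i, d.ε i * V (d.h i) - ∑ i, d.γ i * V (d.h i) := by
    rw [Finset.mul_sum, ← Finset.sum_sub_distrib]
    exact Finset.sum_congr rfl fun i _ => by ring
  rw [h1, h2, h3]; ring

lemma commutator_good (hV : IsLinearOnL1 V) {C α : ℝ} {b f : Rn n → ℝ} (d : Decomp C α b f)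
    (t : ℝ) :
    t * V d.g - V (fun y => b y * d.g y) =
      ∑ k, d.μ k * ((t - avgOn b (cube (d.c' k) (2 * d.ρ' k))) * V (d.q k)) - V d.F := by
  have hq : ∀ k, Integrable (d.q k) := fun k => (d.isMol_q k).integrable
  have h1 : V d.g = ∑ k, d.μ k * V (d.q k) := by
    conv_lhs => rw [funext d.eq_g]
    exact hV.sum _ _ hq
  have h2 : V (fun y => b y * d.g y) =
      ∑ k, d.μ k * avgOn b (cube (d.c' k) (2 * d.ρ' k)) * V (d.q k) + V d.F := by
    conv_lhs => rw [funext d.eq_bg]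
    rw [hV.add _ _ (d.integrable_sum_q _) d.integrable_F, hV.sum _ _ hq]
  rw [h1, h2, Finset.mul_sum, ← sub_sub, ← Finset.sum_sub_distrib]
  congr 1
  exact Finset.sum_congr rfl fun k _ => by ring

end IsLinearOnL1

lemma Bilin2.linear_left {n : ℕ} {T : (Rn n → ℝ) → (Rn n → ℝ) → Rn n → ℝ} (hT : Bilin2 T)
    {g : Rn n → ℝ} (hg : Integrable g) (x : Rn n) : IsLinearOnL1 fun f => T f g x :=
  ⟨fun f f' hf hf' => hT.1 f f' g hf hf' hg x, fun r f hf => hT.2.1 r f g hf hg x⟩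

lemma Bilin2.linear_right {n : ℕ} {T : (Rn n → ℝ) → (Rn n → ℝ) → Rn n → ℝ} (hT : Bilin2 T)
    {f : Rn n → ℝ} (hf : Integrable f) (x : Rn n) : IsLinearOnL1 fun g => T f g x :=
  ⟨fun g g' hg hg' => hT.2.2.1 f g g' hf hg hg' x, fun r g hg => hT.2.2.2 r f g hf hg x⟩

/-- The commutator `b T(f, g) - T(f, b g)` in the second slot. -/
def commR {n : ℕ} (T : (Rn n → ℝ) → (Rn n → ℝ) → Rn n → ℝ) (b f g : Rn n → ℝ) (x : Rn n) : ℝ :=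
  b x * T f g x - T f (fun y => b y * g y) x

/-- The iterated commutator. -/
def commLR {n : ℕ} (T : (Rn n → ℝ) → (Rn n → ℝ) → Rn n → ℝ) (b₁ b₂ f g : Rn n → ℝ)
    (x : Rn n) : ℝ :=
  b₁ x * b₂ x * T f g x - b₂ x * T (fun y => b₁ y * f y) g x
    - b₁ x * T f (fun y => b₂ y * g y) x + T (fun y => b₁ y * f y) (fun y => b₂ y * g y) x

/-- Interaction of the bad part in the first slot with the bounded parts in the second. -/
def badGood {n : ℕ} (T : (Rn n → ℝ) → (Rn n → ℝ) → Rn n → ℝ) {C α : ℝ} {b₁ f₁ b₂ f₂ : Rn n → ℝ}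
    (d₁ : Decomp C α b₁ f₁) (d₂ : Decomp C α b₂ f₂) (x : Rn n) : ℝ :=
  ∑ i, (d₁.ε i * b₁ x - d₁.γ i) * (commR T b₂ (d₁.h i) d₂.g x - T (d₁.h i) d₂.G x)

/-- Interaction of the two bad parts. -/
def badBad {n : ℕ} (T : (Rn n → ℝ) → (Rn n → ℝ) → Rn n → ℝ) {C α : ℝ} {b₁ f₁ b₂ f₂ : Rn n → ℝ}
    (d₁ : Decomp C α b₁ f₁) (d₂ : Decomp C α b₂ f₂) (x : Rn n) : ℝ :=
  ∑ i, ∑ j, (d₁.ε i * b₁ x - d₁.γ i) * ((d₂.ε j * b₂ x - d₂.γ j) * T (d₁.h i) (d₂.h j) x)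

/-- The commutator of a bounded function with the good atoms. -/
def goodAtoms {n : ℕ} (T : (Rn n → ℝ) → (Rn n → ℝ) → Rn n → ℝ) {C α : ℝ} {b f : Rn n → ℝ}
    (G : Rn n → ℝ) (d : Decomp C α b f) (x : Rn n) : ℝ :=
  ∑ k, d.μ k * ((b x - avgOn b (cube (d.c' k) (2 * d.ρ' k))) * T G (d.q k) x)

lemma commLR_eq {n : ℕ} {T : (Rn n → ℝ) → (Rn n → ℝ) → Rn n → ℝ} (hT : Bilin2 T) {C α : ℝ}
    {b₁ f₁ b₂ f₂ : Rn n → ℝ} (d₁ : Decomp C α b₁ f₁) (d₂ : Decomp C α b₂ f₂) (x : Rn n) :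
    commLR T b₁ b₂ f₁ f₂ x = commLR T b₁ b₂ d₁.g d₂.g x + badBad T d₁ d₂ x +
      badGood T d₁ d₂ x + badGood (fun f g => T g f) d₂ d₁ x -
      goodAtoms T d₁.G d₂ x + T d₁.G d₂.F x -
      goodAtoms (fun f g => T g f) d₂.G d₁ x + T d₁.F d₂.G x + T d₁.G d₂.G x := by
  have hh₁ : ∀ i, Integrable (d₁.h i) := fun i => (d₁.isMol_h i).integrable
  have hh₂ : ∀ i, Integrable (d₂.h i) := fun i => (d₂.isMol_h i).integrable
  have e0 := ((hT.linear_left d₂.integrable_f x).comb (hT.linear_left d₂.integrable_bf x)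
    (b₂ x)).commutator d₁ (b₁ x)
  have er : ∀ φ : Rn n → ℝ, Integrable φ → b₂ x * T φ f₂ x - T φ (fun y => b₂ y * f₂ y) x =
      commR T b₂ φ d₂.g x + ∑ j, (d₂.ε j * b₂ x - d₂.γ j) * T φ (d₂.h j) x - T φ d₂.G x :=
    fun φ hφ => (hT.linear_right hφ x).commutator d₂ (b₂ x)
  have eg := (hT.linear_right d₁.integrable_G x).commutator_good d₂ (b₂ x)
  have eg' := (hT.linear_left d₂.integrable_G x).commutator_good d₁ (b₁ x)
  have ebg : badGood T d₁ d₂ x + badBad T d₁ d₂ x = ∑ i, (d₁.ε i * b₁ x - d₁.γ i) *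
      (b₂ x * T (d₁.h i) f₂ x - T (d₁.h i) (fun y => b₂ y * f₂ y) x) := by
    rw [badGood, badBad, ← Finset.sum_add_distrib]
    refine Finset.sum_congr rfl fun i _ => ?_
    rw [er _ (hh₁ i), ← Finset.mul_sum]
    ring
  have ebg' : badGood (fun f g => T g f) d₂ d₁ x =
      b₁ x * ∑ j, (d₂.ε j * b₂ x - d₂.γ j) * T d₁.g (d₂.h j) x -
      ∑ j, (d₂.ε j * b₂ x - d₂.γ j) * T (fun y => b₁ y * d₁.g y) (d₂.h j) x -
      ∑ j, (d₂.ε j * b₂ x - d₂.γ j) * T d₁.G (d₂.h j) x := by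
    rw [badGood, Finset.mul_sum, ← Finset.sum_sub_distrib, ← Finset.sum_sub_distrib]
    exact Finset.sum_congr rfl fun j _ => by simp only [commR]; ring
  have e1 := er _ d₁.integrable_g
  have e2 := er _ d₁.integrable_bg
  have e3 := er _ d₁.integrable_G
  simp only [commR] at e1 e2 e3 eg eg' e0
  rw [← ebg, e1, e2, e3] at e0
  simp only [commLR, goodAtoms]
  have el : commLR T b₁ b₂ f₁ f₂ x =
      b₁ x * (b₂ x * T f₁ f₂ x - T f₁ (fun y => b₂ y * f₂ y) x) -
      (b₂ x * T (fun y => b₁ y * f₁ y) f₂ x -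
        T (fun y => b₁ y * f₁ y) (fun y => b₂ y * f₂ y) x) := by
    simp only [commLR]; ring
  simp only [commLR] at el
  rw [el, e0, ebg']
  linear_combination (-1 : ℝ) * eg - eg'

/-- Chebyshev's inequality off an exceptional set. -/
lemma volume_lt_abs_le {n : ℕ} {p : Rn n → ℝ} {Ω : Set (Rn n)} {H : Rn n → ℝ≥0∞}
    (hH : AEMeasurable H) (hp : ∀ᵐ x, x ∉ Ω → ‖p x‖ₑ ≤ H x) {B t : ℝ} (ht : 0 < t)
    (hI : ∫⁻ x, H x ≤ ENNReal.ofReal B) :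
    volume {x | x ∉ Ω ∧ t < |p x|} ≤ ENNReal.ofReal (B / t) := by
  have ht' : ENNReal.ofReal t ≠ 0 := by simpa using ht
  calc volume {x | x ∉ Ω ∧ t < |p x|} ≤ volume {x | ENNReal.ofReal t ≤ H x} := by
        refine measure_mono_ae ?_
        filter_upwards [hp] with x hx hx'
        refine le_trans ?_ (hx hx'.1)
        rw [Real.enorm_eq_ofReal_abs]
        exact ENNReal.ofReal_le_ofReal hx'.2.le
    _ ≤ (∫⁻ x, H x) / ENNReal.ofReal t :=
        meas_ge_le_lintegral_div hH ht' ENNReal.ofReal_ne_top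
    _ ≤ ENNReal.ofReal B / ENNReal.ofReal t := by gcongr
    _ = _ := (ENNReal.ofReal_div_of_pos ht).symm

/-- The weight `wt` times one plus the squared oscillation of `b`. -/
def oscWt {n : ℕ} (ω : ℝ → ℝ) (b : Rn n → ℝ) (c : Rn n) (ρ : ℝ) (x : Rn n) : ℝ≥0∞ :=
  wt ω c ρ x * (1 + ENNReal.ofReal ((b x - avgOn b (cube c (2 * ρ))) ^ 2))

lemma Modulus.aemeasurable_oscWt {n : ℕ} {ω : ℝ → ℝ} {D : ℝ} (hω : Modulus ω D) {b : Rn n → ℝ}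
    (hb : AEMeasurable b) (c : Rn n) (ρ : ℝ) : AEMeasurable (oscWt ω b c ρ) :=
  (hω.measurable_wt c ρ).aemeasurable.mul
    (((hb.sub_const _).pow_const 2).ennreal_ofReal.const_add 1)

lemma one_add_mul_one_add_le (u v : ℝ) : (1 + ‖u‖ₑ) * (1 + ‖v‖ₑ) ≤
    (1 + ENNReal.ofReal (u ^ 2)) + (1 + ENNReal.ofReal (v ^ 2)) := by
  rw [Real.enorm_eq_ofReal_abs, Real.enorm_eq_ofReal_abs, ← ENNReal.ofReal_one,
    ← ENNReal.ofReal_add zero_le_one (abs_nonneg _), ← ENNReal.ofReal_add zero_le_one (abs_nonneg _),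
    ← ENNReal.ofReal_add zero_le_one (sq_nonneg _), ← ENNReal.ofReal_add zero_le_one (sq_nonneg _),
    ← ENNReal.ofReal_mul (by positivity), ← ENNReal.ofReal_add (by positivity) (by positivity)]
  refine ENNReal.ofReal_le_ofReal ?_
  rw [← sq_abs u, ← sq_abs v]
  nlinarith [sq_nonneg (|u| - |v|), sq_nonneg (|u| - 1), sq_nonneg (|v| - 1)]

lemma enorm_le_one_add_enorm {w u : ℝ} (h : |w| ≤ 1 + |u|) : ‖w‖ₑ ≤ 1 + ‖u‖ₑ := by
  rw [Real.enorm_eq_ofReal_abs, Real.enorm_eq_ofReal_abs, ← ENNReal.ofReal_one,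
    ← ENNReal.ofReal_add zero_le_one (abs_nonneg _)]
  exact ENNReal.ofReal_le_ofReal h

lemma Decomp.lintegral_sum_le {n : ℕ} {C α : ℝ} {b f : Rn n → ℝ} (d : Decomp C α b f)
    {Φ : d.ι → Rn n → ℝ≥0∞} (hΦ : ∀ i, AEMeasurable (Φ i)) {B : ℝ≥0}
    (hB : ∀ i, ∫⁻ x, Φ i x ≤ B) :
    ∫⁻ x, ∑ i, (∫⁻ y, ‖d.h i y‖ₑ) * Φ i x ≤ ENNReal.ofReal (C * B) := by
  rw [lintegral_finsetSum' _ fun i _ => (hΦ i).const_mul _]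
  calc ∑ i, ∫⁻ x, (∫⁻ y, ‖d.h i y‖ₑ) * Φ i x
      ≤ ∑ i, (∫⁻ y, ‖d.h i y‖ₑ) * B := by
        refine Finset.sum_le_sum fun i _ => ?_
        rw [lintegral_const_mul'' _ (hΦ i)]
        exact mul_le_mul' le_rfl (hB i)
    _ = (∑ i, ∫⁻ y, ‖d.h i y‖ₑ) * B := (Finset.sum_mul _ _ _).symm
    _ ≤ ENNReal.ofReal C * B := mul_le_mul' d.sum_h_le le_rfl
    _ = _ := by rw [ENNReal.ofReal_mul' (NNReal.coe_nonneg B), ENNReal.ofReal_coe_nnreal]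

/-- The majorant of the bad part away from the exceptional set. -/
def Decomp.majorant {n : ℕ} (ω : ℝ → ℝ) {C α : ℝ} {b f : Rn n → ℝ} (d : Decomp C α b f)
    (x : Rn n) : ℝ≥0∞ :=
  ∑ i, (∫⁻ y, ‖d.h i y‖ₑ) * (2 * oscWt ω b (d.c i) (d.ρ i) x)

lemma Decomp.aemeasurable_majorant {n : ℕ} {ω : ℝ → ℝ} {D : ℝ} (hω : Modulus ω D) {C α : ℝ}
    {b f : Rn n → ℝ} (hb : AEMeasurable b) (d : Decomp C α b f) :
    AEMeasurable (d.majorant ω) := by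
  unfold Decomp.majorant
  exact Finset.aemeasurable_fun_sum _ fun i _ =>
    ((hω.aemeasurable_oscWt hb _ _).const_mul _).const_mul _

lemma Decomp.enorm_mul_le_majorant {n : ℕ} (ω : ℝ → ℝ) {C α : ℝ} {b f : Rn n → ℝ}
    (d : Decomp C α b f) (x : Rn n) :
    ∑ i, ‖d.ε i * b x - d.γ i‖ₑ * ((∫⁻ y, ‖d.h i y‖ₑ) * wt ω (d.c i) (d.ρ i) x) ≤
      d.majorant ω x := by
  refine Finset.sum_le_sum fun i _ => ?_
  have h := enorm_le_one_add_enorm (d.abs_w_le i x)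
  have h2 : ‖d.ε i * b x - d.γ i‖ₑ ≤
      2 * (1 + ENNReal.ofReal ((b x - avgOn b (cube (d.c i) (2 * d.ρ i))) ^ 2)) :=
    h.trans ((add_le_add (le_add_right le_rfl) (enorm_le_one_add_sq _)).trans
      (two_mul _).ge)
  refine (mul_le_mul' h2 le_rfl).trans (le_of_eq ?_)
  rw [oscWt]; ring

namespace CZOp

variable {n : ℕ} {ω : ℝ → ℝ} {D C₀ C₂ : ℝ} {K : Rn n → Rn n → Rn n → ℝ}
  {T : (Rn n → ℝ) → (Rn n → ℝ) → Rn n → ℝ}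

lemma ae_enorm_badBad_le (hT : CZOp ω D C₀ C₂ K T) {C α : ℝ} {b₁ f₁ b₂ f₂ : Rn n → ℝ}
    (d₁ : Decomp C α b₁ f₁) (d₂ : Decomp C α b₂ f₂) :
    ∀ᵐ x, x ∉ d₁.Ω → x ∉ d₂.Ω → ‖badBad T d₁ d₂ x‖ₑ ≤
      ENNReal.ofReal (C₀ * (D * 4 ^ n)) * (d₁.majorant ω x * d₂.majorant ω x) := by
  have h : ∀ᵐ x, ∀ i j, 4 * d₁.ρ i < ‖x - d₁.c i‖ → 4 * d₂.ρ j < ‖x - d₂.c j‖ →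
      ‖T (d₁.h i) (d₂.h j) x‖ₑ ≤ ENNReal.ofReal (C₀ * (D * 4 ^ n)) *
        ((∫⁻ y, ‖d₁.h i y‖ₑ) * wt ω (d₁.c i) (d₁.ρ i) x *
          ((∫⁻ y, ‖d₂.h j y‖ₑ) * wt ω (d₂.c j) (d₂.ρ j) x)) := by
    rw [ae_all_iff]; intro i; rw [ae_all_iff]; intro j
    exact hT.ae_enorm_le_far_far (d₁.isMol_h i) (d₂.isMol_h j)
  filter_upwards [h] with x hx hx₁ hx₂
  refine le_trans ?_ (mul_le_mul' le_rfl
    (mul_le_mul' (d₁.enorm_mul_le_majorant ω x) (d₂.enorm_mul_le_majorant ω x)))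
  rw [Finset.sum_mul_sum, Finset.mul_sum]
  refine (enorm_sum_le _ _).trans (Finset.sum_le_sum fun i _ => ?_)
  rw [Finset.mul_sum]
  refine (enorm_sum_le _ _).trans (Finset.sum_le_sum fun j _ => ?_)
  rw [enorm_mul, enorm_mul]
  refine (mul_le_mul' le_rfl (mul_le_mul' le_rfl
    (hx i j (d₁.far x hx₁ i) (d₂.far x hx₂ j)))).trans (le_of_eq ?_)
  ring

lemma ae_enorm_commR_le (hT : CZOp ω D C₀ C₂ K T) {W W' : ℝ≥0}
    (hW : ∀ (c : Rn n) (ρ : ℝ), 0 < ρ → ∫⁻ x, wt ω c ρ x ≤ W) {b : Rn n → ℝ}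
    {c : Rn n} {ρ : ℝ} (hW' : ∫⁻ x, oscWt ω b c ρ x ≤ W')
    {h : Rn n → ℝ} (hh : IsMol c ρ h) {C α : ℝ} (hC : 0 ≤ C) {f : Rn n → ℝ}
    (d : Decomp C α b f) :
    ∀ᵐ x, 4 * ρ < ‖x - c‖ → ‖commR T b h d.g x - T h d.G x‖ₑ ≤
      ENNReal.ofReal (C₀ * (D * 4 ^ n)) * ((∫⁻ y, ‖h y‖ₑ) * wt ω c ρ x *
        (ENNReal.ofReal (α * (W * (1 + C) + W')) *
          (1 + ‖b x - avgOn b (cube c (2 * ρ))‖ₑ))) := by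
  have hα : 0 ≤ α := (abs_nonneg _).trans (d.abs_g_le 0)
  have hCt : (0 : ℝ) ≤ C * α := by positivity
  unfold oscWt at hW'
  generalize avgOn b (cube c (2 * ρ)) = β at *
  set ψ : Rn n → ℝ := fun y => b y * d.g y + -β * d.g y with hψ
  have hψe : ∀ y, ψ y = (b y - β) * d.g y := fun y => by simp only [hψ]; ring
  have hβg : Integrable fun y => -β * d.g y := d.integrable_g.const_mul _
  have hψi : Integrable ψ := d.integrable_bg.add hβg
  have hψc : HasCompactSupport ψ := by
    rw [funext hψe]; exact d.compact_g.mul_left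
  have hψw : ∫⁻ y, ‖ψ y‖ₑ * wt ω c ρ y ≤ ENNReal.ofReal (α * W') := by
    rw [ENNReal.ofReal_mul hα, ENNReal.ofReal_coe_nnreal]
    refine le_trans ?_ (mul_le_mul' le_rfl hW')
    rw [← lintegral_const_mul' _ _ ENNReal.ofReal_ne_top]
    refine lintegral_mono fun y => ?_
    rw [hψe, enorm_mul, mul_comm (wt ω c ρ y), ← mul_assoc, mul_comm ‖b y - β‖ₑ,
      Real.enorm_eq_ofReal_abs (d.g y)]
    gcongr
    · exact d.abs_g_le y
    · exact enorm_le_one_add_sq _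
  filter_upwards [hT.ae_enorm_le_far hh d.integrable_g d.compact_g,
    hT.ae_enorm_le_far hh d.integrable_G d.compact_G, hT.ae_enorm_le_far hh hψi hψc]
    with x h1 h2 h3 hx
  have e : commR T b h d.g x - T h d.G x = (b x - β) * T h d.g x - T h ψ x - T h d.G x := by
    have := (hT.bilin.linear_right hh.integrable x).add _ _ d.integrable_bg hβg
    simp only [(hT.bilin.linear_right hh.integrable x).smul _ _ d.integrable_g] at this
    rw [hψ, this, commR]; ring
  have g1 := (h1 hx).trans (mul_le_mul' le_rfl (mul_le_mul' le_rfl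
    (lintegral_enorm_mul_wt_le hW d.abs_g_le c hh.pos)))
  have g2 := (h2 hx).trans (mul_le_mul' le_rfl (mul_le_mul' le_rfl
    (lintegral_enorm_mul_wt_le hW d.abs_G_le c hh.pos)))
  have g3 := (h3 hx).trans (mul_le_mul' le_rfl (mul_le_mul' le_rfl hψw))
  rw [e]
  generalize ENNReal.ofReal (C₀ * (D * 4 ^ n)) = E at *
  generalize (∫⁻ y, ‖h y‖ₑ) * wt ω c ρ x = H at *
  calc ‖(b x - β) * T h d.g x - T h ψ x - T h d.G x‖ₑ
      ≤ ‖b x - β‖ₑ * ‖T h d.g x‖ₑ + ‖T h ψ x‖ₑ + ‖T h d.G x‖ₑ := by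
        rw [← enorm_mul]
        exact enorm_sub_le.trans (add_le_add enorm_sub_le le_rfl)
    _ ≤ ‖b x - β‖ₑ * (E * (H * ENNReal.ofReal (α * W))) + E * (H * ENNReal.ofReal (α * W')) +
        E * (H * ENNReal.ofReal (C * α * W)) :=
        add_le_add (add_le_add (mul_le_mul' le_rfl g1) g3) g2
    _ = E * (H * (ENNReal.ofReal (α * W) * ‖b x - β‖ₑ +
        (ENNReal.ofReal (α * W') + ENNReal.ofReal (C * α * W)) * 1)) := by ring
    _ ≤ E * (H * (ENNReal.ofReal (α * (W * (1 + C) + W')) * ‖b x - β‖ₑ +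
        ENNReal.ofReal (α * (W * (1 + C) + W')) * 1)) := by
        have hWW : (0 : ℝ) ≤ α * W := by positivity
        have hWW' : (0 : ℝ) ≤ α * W' := by positivity
        have hWC : (0 : ℝ) ≤ C * α * W := by positivity
        rw [← ENNReal.ofReal_add hWW' hWC]
        refine mul_le_mul' le_rfl (mul_le_mul' le_rfl (add_le_add (mul_le_mul'
          (ENNReal.ofReal_le_ofReal ?_) le_rfl) (mul_le_mul'
          (ENNReal.ofReal_le_ofReal ?_) le_rfl))) <;> nlinarith
    _ = _ := by ring

lemma ae_enorm_badGood_le (hT : CZOp ω D C₀ C₂ K T) {W W' : ℝ≥0}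
    (hW : ∀ (c : Rn n) (ρ : ℝ), 0 < ρ → ∫⁻ x, wt ω c ρ x ≤ W) {b₁ b₂ : Rn n → ℝ}
    (hW' : ∀ (c : Rn n) (ρ : ℝ), 0 < ρ → ∫⁻ x, oscWt ω b₂ c ρ x ≤ W')
    {C α : ℝ} (hC : 0 ≤ C) {f₁ f₂ : Rn n → ℝ} (d₁ : Decomp C α b₁ f₁) (d₂ : Decomp C α b₂ f₂) :
    ∀ᵐ x, x ∉ d₁.Ω → ‖badGood T d₁ d₂ x‖ₑ ≤
      ENNReal.ofReal (C₀ * (D * 4 ^ n)) * ENNReal.ofReal (α * (W * (1 + C) + W')) *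
        ∑ i, (∫⁻ y, ‖d₁.h i y‖ₑ) *
          (oscWt ω b₁ (d₁.c i) (d₁.ρ i) x + oscWt ω b₂ (d₁.c i) (d₁.ρ i) x) := by
  have h := fun i => hT.ae_enorm_commR_le hW (hW' (d₁.c i) (d₁.ρ i) (d₁.isMol_h i).pos)
    (d₁.isMol_h i) hC d₂
  filter_upwards [ae_all_iff.2 h] with x hx hxΩ
  rw [Finset.mul_sum]
  refine (enorm_sum_le _ _).trans (Finset.sum_le_sum fun i _ => ?_)
  rw [enorm_mul]
  refine (mul_le_mul' (enorm_le_one_add_enorm (d₁.abs_w_le i x))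
    (hx i (d₁.far x hxΩ i))).trans ?_
  have hp := one_add_mul_one_add_le (b₁ x - avgOn b₁ (cube (d₁.c i) (2 * d₁.ρ i)))
    (b₂ x - avgOn b₂ (cube (d₁.c i) (2 * d₁.ρ i)))
  simp only [oscWt]
  rw [← mul_add]
  refine le_trans (le_of_eq ?_) (mul_le_mul' le_rfl (mul_le_mul' le_rfl (mul_le_mul' le_rfl hp)))
  ring

end CZOp

lemma l1norm_le_of_lintegral_le {n : ℕ} {f : Rn n → ℝ} {B : ℝ} (hB : 0 ≤ B) (hf : Integrable f)
    (h : ∫⁻ x, ‖f x‖ₑ ≤ ENNReal.ofReal B) : l1norm f ≤ B := by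
  have e : l1norm f = (∫⁻ x, ‖f x‖ₑ).toReal := by
    rw [l1norm, ← integral_norm_eq_lintegral_enorm hf.1]; simp
  rw [e]
  exact ENNReal.toReal_le_of_le_ofReal hB h

lemma l1norm_nonneg {n : ℕ} (f : Rn n → ℝ) : 0 ≤ l1norm f :=
  integral_nonneg fun _ => abs_nonneg _

lemma Decomp.l2norm_le {n : ℕ} {C α : ℝ} (hC : 0 ≤ C) {b f : Rn n → ℝ} (d : Decomp C α b f) :
    l2norm d.g ≤ (α * C) ^ ((1 : ℝ) / 2) := by
  have hα : 0 ≤ α := (abs_nonneg _).trans (d.abs_g_le 0)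
  refine Real.rpow_le_rpow (integral_nonneg fun _ => sq_nonneg _) ?_ (by norm_num)
  calc ∫ x, d.g x ^ 2 ≤ ∫ x, α * |d.g x| := by
        refine integral_mono_of_nonneg (Filter.Eventually.of_forall fun _ => sq_nonneg _)
          (d.integrable_g.abs.const_mul _) (Filter.Eventually.of_forall fun x => ?_)
        have h := mul_le_mul_of_nonneg_right (d.abs_g_le x) (abs_nonneg (d.g x))
        rwa [← sq, sq_abs] at h
    _ = α * l1norm d.g := integral_const_mul _ _
    _ ≤ α * C := by
        gcongr; exact l1norm_le_of_lintegral_le hC d.integrable_g d.lintegral_g_le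

namespace CZOp

variable {n : ℕ} {ω : ℝ → ℝ} {D C₀ C₂ : ℝ} {K : Rn n → Rn n → Rn n → ℝ}
  {T : (Rn n → ℝ) → (Rn n → ℝ) → Rn n → ℝ}

lemma volume_good_le (hT : CZOp ω D C₀ C₂ K T) {A C α : ℝ} (hA : C₂ ≤ A) (hC : 0 ≤ C)
    (hα : 0 < α) {u v : Rn n → ℝ} (hu : Integrable u) (hv : Integrable v)
    (hu' : ∫⁻ x, ‖u x‖ₑ ≤ ENNReal.ofReal C) (hv' : ∫⁻ x, ‖v x‖ₑ ≤ ENNReal.ofReal C) :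
    volume {x | A * α ^ 2 / 9 < |T u v x|} ≤ ENNReal.ofReal (3 * C / α) := by
  have hA0 : 0 < A := hT.pos₂.trans_le hA
  refine (hT.weak u v hu hv _ (by positivity)).trans (ENNReal.ofReal_le_ofReal ?_)
  rw [← Real.sqrt_eq_rpow]
  refine Real.sqrt_le_iff.2 ⟨by positivity, ?_⟩
  have h1 := l1norm_le_of_lintegral_le hC hu hu'
  have h2 := l1norm_le_of_lintegral_le hC hv hv'
  have h3 := hT.pos₂.le
  have h4 := l1norm_nonneg u
  have h5 := l1norm_nonneg v
  calc C₂ * l1norm u * l1norm v / (A * α ^ 2 / 9) ≤ A * C * C / (A * α ^ 2 / 9) := by gcongr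
    _ = (3 * C / α) ^ 2 := by field_simp; norm_num

lemma volume_badBad_le (hT : CZOp ω D C₀ C₂ K T) {A C α : ℝ} (hA : C₀ ≤ A) (hC : 0 ≤ C)
    (hα : 0 < α) {b₁ f₁ b₂ f₂ : Rn n → ℝ} {W' : ℝ≥0} (hb₁ : AEMeasurable b₁)
    (hb₂ : AEMeasurable b₂)
    (h₁ : ∀ (c : Rn n) (ρ : ℝ), 0 < ρ → ∫⁻ x, oscWt ω b₁ c ρ x ≤ W')
    (h₂ : ∀ (c : Rn n) (ρ : ℝ), 0 < ρ → ∫⁻ x, oscWt ω b₂ c ρ x ≤ W')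
    (d₁ : Decomp C α b₁ f₁) (d₂ : Decomp C α b₂ f₂) :
    volume {x | x ∉ d₁.Ω ∪ d₂.Ω ∧ A * α ^ 2 / 9 < |badBad T d₁ d₂ x|} ≤
      ENNReal.ofReal (2 * C * W' * (9 * (D * 4 ^ n) + 1) / α) := by
  have hD : 0 < D := zero_lt_one.trans_le hT.mod.one_le
  have hC₀ := hT.pos₀
  have key : ∀ {b f : Rn n → ℝ} (d : Decomp C α b f), AEMeasurable b →
      (∀ (c : Rn n) (ρ : ℝ), 0 < ρ → ∫⁻ x, oscWt ω b c ρ x ≤ W') → ∀ s : ℝ, 0 < s →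
      volume {x | ENNReal.ofReal s ≤ d.majorant ω x} ≤ ENNReal.ofReal (2 * C * W' / s) := by
    intro b f d hb h s hs
    have hI : ∫⁻ x, d.majorant ω x ≤ ENNReal.ofReal (C * (2 * W' : ℝ≥0)) := by
      refine d.lintegral_sum_le (fun i => (hT.mod.aemeasurable_oscWt hb _ _).const_mul _)
        fun i => ?_
      rw [lintegral_const_mul'' _ (hT.mod.aemeasurable_oscWt hb _ _), ENNReal.coe_mul]
      exact mul_le_mul' le_rfl (h _ _ (d.isMol_h i).pos)
    refine (meas_ge_le_lintegral_div (d.aemeasurable_majorant hT.mod hb) (by simpa using hs)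
      ENNReal.ofReal_ne_top).trans ?_
    rw [ENNReal.ofReal_div_of_pos hs]
    refine ENNReal.div_le_div_right (hI.trans (le_of_eq ?_)) _
    congr 1; push_cast; ring
  set S : ℝ := 9 * (D * 4 ^ n) with hS
  have hS0 : 0 < S := by positivity
  calc volume {x | x ∉ d₁.Ω ∪ d₂.Ω ∧ A * α ^ 2 / 9 < |badBad T d₁ d₂ x|}
      ≤ volume ({x | ENNReal.ofReal (α / S) ≤ d₁.majorant ω x} ∪
          {x | ENNReal.ofReal α ≤ d₂.majorant ω x}) := by
        refine measure_mono_ae ?_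
        filter_upwards [hT.ae_enorm_badBad_le d₁ d₂] with x hx hx'
        obtain ⟨hxΩ, hlt⟩ := hx'
        simp only [mem_union, not_or] at hxΩ
        by_contra hcon
        have hcon' : x ∉ {x | ENNReal.ofReal (α / S) ≤ d₁.majorant ω x} ∪
          {x | ENNReal.ofReal α ≤ d₂.majorant ω x} := hcon
        rw [mem_union, not_or] at hcon'
        obtain ⟨hc1, hc2⟩ := hcon'
        rw [mem_ofPred_eq, not_le] at hc1 hc2
        have hb := (hx hxΩ.1 hxΩ.2).trans (mul_le_mul' le_rfl (mul_le_mul' hc1.le hc2.le))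
        rw [← ENNReal.ofReal_mul (by positivity), ← ENNReal.ofReal_mul (by positivity),
          Real.enorm_eq_ofReal_abs, ENNReal.ofReal_le_ofReal_iff (by positivity)] at hb
        have e : C₀ * (D * 4 ^ n) * (α / S * α) = C₀ * α ^ 2 / 9 := by rw [hS]; field_simp
        rw [e] at hb
        have : C₀ * α ^ 2 / 9 ≤ A * α ^ 2 / 9 := by gcongr
        linarith
    _ ≤ ENNReal.ofReal (2 * C * W' / (α / S)) + ENNReal.ofReal (2 * C * W' / α) :=
        (measure_union_le _ _).trans
          (add_le_add (key d₁ hb₁ h₁ _ (by positivity)) (key d₂ hb₂ h₂ _ hα))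
    _ = _ := by
        rw [← ENNReal.ofReal_add (by positivity) (by positivity)]
        congr 1; field_simp

lemma volume_badGood_le (hT : CZOp ω D C₀ C₂ K T) {W W' : ℝ≥0}
    (hW : ∀ (c : Rn n) (ρ : ℝ), 0 < ρ → ∫⁻ x, wt ω c ρ x ≤ W)
    {A C α : ℝ} (hA : C₀ ≤ A) (hC : 0 ≤ C) (hα : 0 < α) {b₁ f₁ b₂ f₂ : Rn n → ℝ}
    (hb₁ : AEMeasurable b₁) (hb₂ : AEMeasurable b₂)
    (h₁ : ∀ (c : Rn n) (ρ : ℝ), 0 < ρ → ∫⁻ x, oscWt ω b₁ c ρ x ≤ W')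
    (h₂ : ∀ (c : Rn n) (ρ : ℝ), 0 < ρ → ∫⁻ x, oscWt ω b₂ c ρ x ≤ W')
    (d₁ : Decomp C α b₁ f₁) (d₂ : Decomp C α b₂ f₂) :
    volume {x | x ∉ d₁.Ω ∧ A * α ^ 2 / 9 < |badGood T d₁ d₂ x|} ≤
      ENNReal.ofReal (18 * (D * 4 ^ n) * (W * (1 + C) + W') * C * W' / α) := by
  have hD : 0 < D := zero_lt_one.trans_le hT.mod.one_le
  have hC₀ := hT.pos₀
  have hA0 := hC₀.trans_le hA
  have hm : ∀ i, AEMeasurable fun x =>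
      oscWt ω b₁ (d₁.c i) (d₁.ρ i) x + oscWt ω b₂ (d₁.c i) (d₁.ρ i) x := fun i =>
    (hT.mod.aemeasurable_oscWt hb₁ _ _).add (hT.mod.aemeasurable_oscWt hb₂ _ _)
  have hB : ∀ i, ∫⁻ x, (oscWt ω b₁ (d₁.c i) (d₁.ρ i) x + oscWt ω b₂ (d₁.c i) (d₁.ρ i) x) ≤
      (2 * W' : ℝ≥0) := by
    intro i
    rw [lintegral_add_left' (hT.mod.aemeasurable_oscWt hb₁ _ _), two_mul, ENNReal.coe_add]
    exact add_le_add (h₁ _ _ (d₁.isMol_h i).pos) (h₂ _ _ (d₁.isMol_h i).pos)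
  have hm' : AEMeasurable fun x => ∑ i, (∫⁻ y, ‖d₁.h i y‖ₑ) *
      (oscWt ω b₁ (d₁.c i) (d₁.ρ i) x + oscWt ω b₂ (d₁.c i) (d₁.ρ i) x) :=
    Finset.aemeasurable_fun_sum _ fun i _ => (hm i).const_mul _
  have h := volume_lt_abs_le (hm'.const_mul _) (hT.ae_enorm_badGood_le hW h₂ hC d₁ d₂)
    (t := A * α ^ 2 / 9) (by positivity)
    (B := A * (D * 4 ^ n) * (α * (W * (1 + C) + W')) * (C * (2 * W'))) ?_
  · refine h.trans (le_of_eq ?_)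
    congr 1; field_simp; ring
  · rw [lintegral_const_mul'' _ hm', ← ENNReal.ofReal_mul (by positivity)]
    refine (mul_le_mul' (ENNReal.ofReal_le_ofReal ?_) (d₁.lintegral_sum_le hm hB)).trans
      (le_of_eq (ENNReal.ofReal_mul (p := A * (D * 4 ^ n) * (α * (W * (1 + C) + W'))) ?_).symm)
    · gcongr
    · positivity

lemma volume_goodAtoms_le (hT : CZOp ω D C₀ C₂ K T) {A C α : ℝ} (hA : C₀ + C₂ ≤ A) (hC : 0 < C)
    (hα : 0 < α) {b f G : Rn n → ℝ} (hb : AEMeasurable b) {κ : ℝ≥0} (d : Decomp C α b f)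
    (hG : Integrable G)
    (hκ : ∀ k, ∫⁻ x, ‖b x - avgOn b (cube (d.c' k) (2 * d.ρ' k))‖ₑ * ‖T G (d.q k) x‖ₑ ≤
      ENNReal.ofReal (κ * ((C₀ + C₂) * (C * α) * (d.τ k * d.ρ' k ^ n)))) :
    volume {x | A * α ^ 2 / 9 < |goodAtoms T G d x|} ≤ ENNReal.ofReal (9 * κ * C ^ 2 / α) := by
  have h0 := hT.pos₀
  have h2 := hT.pos₂
  have hA0 : 0 < A := by linarith
  have hm : ∀ k, AEMeasurable fun x =>
      ‖b x - avgOn b (cube (d.c' k) (2 * d.ρ' k))‖ₑ * ‖T G (d.q k) x‖ₑ := fun k =>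
    (hb.sub_const _).enorm.mul (hT.meas _ _ hG (d.isMol_q k).integrable).aemeasurable.enorm
  have hm' : AEMeasurable fun x => ∑ k, ‖d.μ k‖ₑ *
      (‖b x - avgOn b (cube (d.c' k) (2 * d.ρ' k))‖ₑ * ‖T G (d.q k) x‖ₑ) :=
    Finset.aemeasurable_fun_sum _ fun k _ => (hm k).const_mul _
  have h := volume_lt_abs_le (Ω := ∅) (p := goodAtoms T G d) hm'
    (Filter.Eventually.of_forall fun x _ => ?_) (t := A * α ^ 2 / 9) (by positivity)
    (B := κ * (A * (C * α)) * C) ?_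
  · simp only [mem_empty_iff_false, not_false_eq_true, true_and] at h
    refine h.trans (le_of_eq ?_)
    congr 1; field_simp
  · refine (enorm_sum_le _ _).trans (le_of_eq ?_)
    simp only [enorm_mul]
  · rw [lintegral_finsetSum' _ fun k _ => (hm k).const_mul _]
    calc ∑ k, ∫⁻ x, ‖d.μ k‖ₑ *
          (‖b x - avgOn b (cube (d.c' k) (2 * d.ρ' k))‖ₑ * ‖T G (d.q k) x‖ₑ)
        ≤ ∑ k, ENNReal.ofReal (κ * (A * (C * α)) * (|d.μ k| * (d.τ k * d.ρ' k ^ n))) := by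
          refine Finset.sum_le_sum fun k _ => ?_
          have hτ := d.τ_pos k
          have hρ := (d.isMol_q k).pos
          rw [lintegral_const_mul'' _ (hm k), Real.enorm_eq_ofReal_abs]
          refine (mul_le_mul' le_rfl (hκ k)).trans ?_
          rw [← ENNReal.ofReal_mul (abs_nonneg _)]
          refine ENNReal.ofReal_le_ofReal ?_
          calc |d.μ k| * (κ * ((C₀ + C₂) * (C * α) * (d.τ k * d.ρ' k ^ n)))
              ≤ |d.μ k| * (κ * (A * (C * α) * (d.τ k * d.ρ' k ^ n))) := by gcongr
            _ = _ := by ring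
      _ = ENNReal.ofReal (∑ k, κ * (A * (C * α)) * (|d.μ k| * (d.τ k * d.ρ' k ^ n))) := by
          refine (ENNReal.ofReal_sum_of_nonneg fun k _ => ?_).symm
          have hτ := d.τ_pos k
          have hρ := (d.isMol_q k).pos
          positivity
      _ ≤ _ := by
          refine ENNReal.ofReal_le_ofReal ?_
          rw [← Finset.mul_sum]
          exact mul_le_mul_of_nonneg_left d.sum_q_le (by positivity)

end CZOp

lemma volume_good_good_le {n : ℕ} {T : (Rn n → ℝ) → (Rn n → ℝ) → Rn n → ℝ}
    {b₁ b₂ f₁ f₂ : Rn n → ℝ} {C₁ A C α : ℝ} (hC₁ : 0 < C₁)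
    (hT : ∀ f g : Rn n → ℝ, Measurable f → Measurable g →
      (∃ A : ℝ, ∀ x, |f x| ≤ A) → (∃ A : ℝ, ∀ x, |g x| ≤ A) →
      HasCompactSupport f → HasCompactSupport g → ∀ lam : ℝ, 0 < lam →
      volume {x | lam < |commLR T b₁ b₂ f g x|} ≤
        ENNReal.ofReal (C₁ * l2norm f * l2norm g / lam))
    (hA : C₁ ≤ A) (hC : 0 ≤ C) (hα : 0 < α) (d₁ : Decomp C α b₁ f₁) (d₂ : Decomp C α b₂ f₂) :
    volume {x | A * α ^ 2 / 9 < |commLR T b₁ b₂ d₁.g d₂.g x|} ≤ ENNReal.ofReal (9 * C / α) := by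
  have hA0 : 0 < A := hC₁.trans_le hA
  refine (hT d₁.g d₂.g d₁.measurable_g d₂.measurable_g ⟨α, d₁.abs_g_le⟩ ⟨α, d₂.abs_g_le⟩
    d₁.compact_g d₂.compact_g _ (by positivity)).trans (ENNReal.ofReal_le_ofReal ?_)
  have h0 : ∀ f : Rn n → ℝ, 0 ≤ l2norm f := fun f =>
    Real.rpow_nonneg (integral_nonneg fun _ => sq_nonneg _) _
  have h := mul_le_mul (d₁.l2norm_le hC) (d₂.l2norm_le hC) (h0 _) (by positivity)
  rw [← Real.sqrt_eq_rpow, Real.mul_self_sqrt (by positivity)] at h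
  calc C₁ * l2norm d₁.g * l2norm d₂.g / (A * α ^ 2 / 9)
      = C₁ * (l2norm d₁.g * l2norm d₂.g) / (A * α ^ 2 / 9) := by rw [mul_assoc]
    _ ≤ A * (α * C) / (A * α ^ 2 / 9) := by
        gcongr
        exact mul_nonneg (h0 _) (h0 _)
    _ = 9 * C / α := by field_simp

lemma abs_nine_le {a₁ a₂ a₃ a₄ a₅ a₆ a₇ a₈ a₉ t : ℝ} (h₁ : |a₁| ≤ t / 9) (h₂ : |a₂| ≤ t / 9)
    (h₃ : |a₃| ≤ t / 9) (h₄ : |a₄| ≤ t / 9) (h₅ : |a₅| ≤ t / 9) (h₆ : |a₆| ≤ t / 9)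
    (h₇ : |a₇| ≤ t / 9) (h₈ : |a₈| ≤ t / 9) (h₉ : |a₉| ≤ t / 9) :
    |a₁ + a₂ + a₃ + a₄ - a₅ + a₆ - a₇ + a₈ + a₉| ≤ t := by
  rw [abs_le] at *
  constructor <;> linarith

lemma decompConst_pos {n : ℕ} (hn : 1 ≤ n) {M : ℝ} (hM : 0 ≤ M) : 0 < decompConst n M := by
  have : (1 : ℝ) ≤ n := by exact_mod_cast hn
  unfold decompConst; positivity

/-- Weak type bound for the iterated commutator on functions admitting a decomposition. -/
lemma Modulus.exists_volume_commLR_le {n : ℕ} (hn : 1 ≤ n) {ω : ℝ → ℝ} {D : ℝ}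
    (hω : Modulus ω D) {M : ℝ} (hM : 0 ≤ M) :
    ∃ κ : ℝ, 0 < κ ∧ ∀ (C₀ C₁ C₂ : ℝ) (K : Rn n → Rn n → Rn n → ℝ)
      (T : (Rn n → ℝ) → (Rn n → ℝ) → Rn n → ℝ), CZOp ω D C₀ C₂ K T → 0 < C₁ →
      ∀ b₁ b₂ : Rn n → ℝ, IsBMO b₁ M → IsBMO b₂ M →
      (∀ f g : Rn n → ℝ, Measurable f → Measurable g →
        (∃ A : ℝ, ∀ x, |f x| ≤ A) → (∃ A : ℝ, ∀ x, |g x| ≤ A) →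
        HasCompactSupport f → HasCompactSupport g → ∀ lam : ℝ, 0 < lam →
        volume {x | lam < |commLR T b₁ b₂ f g x|} ≤
          ENNReal.ofReal (C₁ * l2norm f * l2norm g / lam)) →
      ∀ (α : ℝ) (f₁ f₂ : Rn n → ℝ), 0 < α → Decomp (decompConst n M) α b₁ f₁ →
        Decomp (decompConst n M) α b₂ f₂ →
        volume {x | (C₀ + C₁ + C₂) * α ^ 2 < |commLR T b₁ b₂ f₁ f₂ x|} ≤
          ENNReal.ofReal (κ / α) := by
  obtain ⟨W, hW⟩ := hω.lintegral_wt_bound n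
  obtain ⟨W', hW'⟩ := hω.lintegral_wt_le n M
  obtain ⟨κ, hκ⟩ := hω.exists_lintegral_commutator_le n hM
  have hD : 0 < D := zero_lt_one.trans_le hω.one_le
  have hC := decompConst_pos hn hM
  generalize decompConst n M = C at *
  have hC0 := hC.le
  set B₁ := 2 * C * W' * (9 * (D * 4 ^ n) + 1) with hB₁
  set B₂ := 18 * (D * 4 ^ n) * (W * (1 + C) + W') * C * W' with hB₂
  set B₃ := 9 * κ * C ^ 2 with hB₃
  have hB₁0 : 0 ≤ B₁ := by positivity
  have hB₂0 : 0 ≤ B₂ := by positivity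
  have hB₃0 : 0 ≤ B₃ := by positivity
  refine ⟨C + C + 9 * C + B₁ + B₂ + B₂ + B₃ + 3 * C + B₃ + 3 * C + 3 * C, by positivity, ?_⟩
  intro C₀ C₁ C₂ K T hT hC₁ b₁ b₂ hb₁ hb₂ hcom α f₁ f₂ hα d₁ d₂
  have h0 := hT.pos₀
  have h2 := hT.pos₂
  set A := C₀ + C₁ + C₂ with hA
  have hA0 : C₀ ≤ A := by linarith
  have hA1 : C₁ ≤ A := by linarith
  have hA2 : C₂ ≤ A := by linarith
  have hA3 : C₀ + C₂ ≤ A := by linarith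
  have hm₁ := hb₁.aemeasurable
  have hm₂ := hb₂.aemeasurable
  have hW₁ := hW' b₁ hb₁
  have hW₂ := hW' b₂ hb₂
  have hCα : 0 < C * α := by positivity
  have v₁ := volume_good_good_le hC₁ hcom hA1 hC0 hα d₁ d₂
  have v₂ := hT.volume_badBad_le hA0 hC0 hα hm₁ hm₂ hW₁ hW₂ d₁ d₂
  have v₃ := hT.volume_badGood_le hW hA0 hC0 hα hm₁ hm₂ hW₁ hW₂ d₁ d₂
  have v₄ := hT.swap.volume_badGood_le hW hA0 hC0 hα hm₂ hm₁ hW₂ hW₁ d₂ d₁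
  have v₅ := hT.volume_goodAtoms_le hA3 hC hα hm₂ d₂ d₁.integrable_G fun k =>
    hκ C₀ C₂ K T hT b₂ hb₂ (C * α) (d₂.τ k) d₁.G (d₂.q k) (d₂.c' k) (d₂.ρ' k) hCα (d₂.τ_pos k)
      d₁.integrable_G d₁.compact_G d₁.abs_G_le (d₂.isMol_q k) (d₂.abs_q_le k)
  have v₆ := hT.volume_good_le hA2 hC0 hα d₁.integrable_G d₂.integrable_F d₁.lintegral_G_le
    d₂.lintegral_F_le
  have v₇ := hT.swap.volume_goodAtoms_le hA3 hC hα hm₁ d₁ d₂.integrable_G fun k =>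
    hκ C₀ C₂ _ _ hT.swap b₁ hb₁ (C * α) (d₁.τ k) d₂.G (d₁.q k) (d₁.c' k) (d₁.ρ' k) hCα (d₁.τ_pos k)
      d₂.integrable_G d₂.compact_G d₂.abs_G_le (d₁.isMol_q k) (d₁.abs_q_le k)
  have v₈ := hT.volume_good_le hA2 hC0 hα d₁.integrable_F d₂.integrable_G d₁.lintegral_F_le
    d₂.lintegral_G_le
  have v₉ := hT.volume_good_le hA2 hC0 hα d₁.integrable_G d₂.integrable_G d₁.lintegral_G_le
    d₂.lintegral_G_le
  have hsub : {x | A * α ^ 2 < |commLR T b₁ b₂ f₁ f₂ x|} ⊆ d₁.Ω ∪ d₂.Ω ∪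
      {x | A * α ^ 2 / 9 < |commLR T b₁ b₂ d₁.g d₂.g x|} ∪
      {x | x ∉ d₁.Ω ∪ d₂.Ω ∧ A * α ^ 2 / 9 < |badBad T d₁ d₂ x|} ∪
      {x | x ∉ d₁.Ω ∧ A * α ^ 2 / 9 < |badGood T d₁ d₂ x|} ∪
      {x | x ∉ d₂.Ω ∧ A * α ^ 2 / 9 < |badGood (fun f g => T g f) d₂ d₁ x|} ∪
      {x | A * α ^ 2 / 9 < |goodAtoms T d₁.G d₂ x|} ∪
      {x | A * α ^ 2 / 9 < |T d₁.G d₂.F x|} ∪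
      {x | A * α ^ 2 / 9 < |goodAtoms (fun f g => T g f) d₂.G d₁ x|} ∪
      {x | A * α ^ 2 / 9 < |T d₁.F d₂.G x|} ∪
      {x | A * α ^ 2 / 9 < |T d₁.G d₂.G x|} := by
    intro x hx
    by_contra hcon
    simp only [mem_union, mem_ofPred_eq, not_or, not_and, not_lt] at hcon hx
    obtain ⟨⟨⟨⟨⟨⟨⟨⟨⟨⟨c1, c2⟩, w₁⟩, w₂⟩, w₃⟩, w₄⟩, w₅⟩, w₆⟩, w₇⟩, w₈⟩, w₉⟩ := hcon
    rw [commLR_eq hT.bilin d₁ d₂ x] at hx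
    exact absurd hx (not_lt.2 (abs_nine_le w₁ (w₂ ⟨c1, c2⟩) (w₃ c1) (w₄ c2) w₅ w₆ w₇ w₈ w₉))
  refine (measure_mono hsub).trans ?_
  have hu : ∀ {s t : Set (Rn n)} {p q : ℝ}, 0 ≤ q → volume s ≤ ENNReal.ofReal (p / α) ∧ 0 ≤ p →
      volume t ≤ ENNReal.ofReal (q / α) →
      volume (s ∪ t) ≤ ENNReal.ofReal ((p + q) / α) ∧ 0 ≤ p + q := by
    rintro s t p q hq ⟨hs, hp⟩ ht
    refine ⟨(measure_union_le _ _).trans ((add_le_add hs ht).trans (le_of_eq ?_)), by positivity⟩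
    rw [← ENNReal.ofReal_add (by positivity) (by positivity), add_div]
  have h3C : 0 ≤ 3 * C := by positivity
  exact (hu h3C (hu h3C (hu hB₃0 (hu h3C (hu hB₃0 (hu hB₂0 (hu hB₂0 (hu hB₁0
    (hu (by positivity) (hu hC0 ⟨d₁.volume_Ω_le, hC0⟩ d₂.volume_Ω_le) v₁) v₂) v₃) v₄) v₅) v₆) v₇)
    v₈) v₉).1

/-- The extension by zero of a modulus of continuity to the whole line. -/
def extZero (ω : ℝ → ℝ) (t : ℝ) : ℝ := if t ≤ 0 then 0 else ω t

lemma extZero_of_pos {ω : ℝ → ℝ} {t : ℝ} (ht : 0 < t) : extZero ω t = ω t :=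
  if_neg (not_le.2 ht)

lemma integral_one_add_log_div {a : ℝ} (ha : 0 < a) (ha1 : a ≤ 1) :
    ∫ t in a..1, (1 + Real.log (1 / t)) / t = -Real.log a + Real.log a ^ 2 / 2 := by
  have hI : ∀ t ∈ uIcc a 1, 0 < t := fun t ht => by
    rw [uIcc_of_le ha1] at ht; exact ha.trans_le ht.1
  have hd : ∀ t ∈ uIcc a 1, HasDerivAt (fun t => Real.log t - Real.log t ^ 2 / 2)
      ((1 + Real.log (1 / t)) / t) t := fun t ht => by
    have h := Real.hasDerivAt_log (hI t ht).ne'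
    refine (h.sub ((h.pow 2).div_const 2)).congr_deriv ?_
    rw [one_div, Real.log_inv]
    have := (hI t ht).ne'
    field_simp
    simp
    ring
  have hc : ContinuousOn (fun t : ℝ => (1 + Real.log (1 / t)) / t) (uIcc a 1) := by
    refine ContinuousOn.div (continuousOn_const.add (ContinuousOn.log ?_ ?_)) continuousOn_id
      fun t ht => (hI t ht).ne'
    · exact continuousOn_const.div continuousOn_id fun t ht => (hI t ht).ne'
    · exact fun t ht => (one_div_pos.2 (hI t ht)).ne'
  rw [intervalIntegral.integral_eq_sub_of_hasDerivAt hd hc.intervalIntegrable]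
  simp; ring

lemma summable_sqrt_of_logDini {ω : ℝ → ℝ} (hω0 : ∀ t, 0 < t → 0 ≤ ω t)
    (hωmono : ∀ s t : ℝ, 0 < s → s ≤ t → ω s ≤ ω t)
    (hω : IntegrableOn (fun t => ω t ^ ((1 : ℝ) / 4) * (1 + Real.log (1 / t)) / t) (Ioo (0 : ℝ) 1)) :
    Summable fun k : ℕ => √(ω ((1 / 2) ^ k)) * (1 + (k : ℝ)) ^ 2 := by
  set I := ∫ t in Ioo (0 : ℝ) 1, ω t ^ ((1 : ℝ) / 4) * (1 + Real.log (1 / t)) / t with hI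
  have hlog : ∀ t ∈ Ioo (0 : ℝ) 1, 0 ≤ Real.log (1 / t) := fun t ht =>
    Real.log_nonneg ((one_le_div ht.1).2 ht.2.le)
  have hnn : ∀ t ∈ Ioo (0 : ℝ) 1, 0 ≤ ω t ^ ((1 : ℝ) / 4) * (1 + Real.log (1 / t)) / t :=
    fun t ht => div_nonneg (mul_nonneg (Real.rpow_nonneg (hω0 t ht.1) _)
      (by linarith [hlog t ht])) ht.1.le
  have key : ∀ k : ℕ, ω ((1 / 2) ^ k) ^ ((1 : ℝ) / 4) * ((k * Real.log 2) ^ 2 / 2) ≤ I := by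
    intro k
    have ha : (0 : ℝ) < (1 / 2) ^ k := by positivity
    have ha1 : ((1 : ℝ) / 2) ^ k ≤ 1 := pow_le_one₀ (by norm_num) (by norm_num)
    have hla : Real.log ((1 / 2) ^ k) = -(k * Real.log 2) := by
      rw [Real.log_pow, one_div, Real.log_inv]; ring
    set a : ℝ := (1 / 2) ^ k with hadef
    have hv := integral_one_add_log_div ha ha1
    rw [hla, neg_neg, neg_sq, intervalIntegral.integral_of_le ha1,
      integral_Ioc_eq_integral_Ioo] at hv
    have hsub : Ioo a 1 ⊆ Ioo (0 : ℝ) 1 := Ioo_subset_Ioo_left ha.le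
    have hωa : 0 ≤ ω a ^ ((1 : ℝ) / 4) := Real.rpow_nonneg (hω0 a ha) _
    calc ω a ^ ((1 : ℝ) / 4) * ((k * Real.log 2) ^ 2 / 2)
        ≤ ω a ^ ((1 : ℝ) / 4) * (k * Real.log 2 + (k * Real.log 2) ^ 2 / 2) := by
          refine mul_le_mul_of_nonneg_left ?_ hωa
          have : 0 ≤ k * Real.log 2 := mul_nonneg k.cast_nonneg (Real.log_nonneg (by norm_num))
          linarith
      _ = ∫ t in Ioo a 1, ω a ^ ((1 : ℝ) / 4) * ((1 + Real.log (1 / t)) / t) := by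
          rw [integral_const_mul, hv]
      _ ≤ ∫ t in Ioo a 1, ω t ^ ((1 : ℝ) / 4) * (1 + Real.log (1 / t)) / t := by
          refine integral_mono_of_nonneg (ae_restrict_of_forall_mem measurableSet_Ioo fun t ht => ?_)
            (hω.mono_set hsub) (ae_restrict_of_forall_mem measurableSet_Ioo fun t ht => ?_)
          · exact mul_nonneg hωa (div_nonneg (by linarith [hlog t (hsub ht)]) (hsub ht).1.le)
          · simp only [mul_div_assoc]
            refine mul_le_mul_of_nonneg_right (Real.rpow_le_rpow (hω0 a ha)
              (hωmono a t ha ht.1.le) (by norm_num))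
              (div_nonneg (by linarith [hlog t (hsub ht)]) (hsub ht).1.le)
      _ ≤ I := setIntegral_mono_set hω (ae_restrict_of_forall_mem measurableSet_Ioo hnn)
          (Filter.Eventually.of_forall hsub)
  set B := 2 * I / Real.log 2 ^ 2 with hB
  have hl2 : 0 < Real.log 2 := Real.log_pos (by norm_num)
  have hs : Summable fun k : ℕ => 4 * B ^ 2 * (1 / (k : ℝ) ^ 2) :=
    (Real.summable_one_div_nat_pow.2 (by norm_num)).mul_left _
  refine Summable.of_norm_bounded_eventually_nat hs ?_
  filter_upwards [Filter.eventually_ge_atTop 1] with k hk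
  have hk1 : (1 : ℝ) ≤ k := by exact_mod_cast hk
  have hω' := hω0 ((1 / 2) ^ k) (by positivity)
  rw [Real.norm_of_nonneg (by positivity)]
  set u := ω ((1 / 2) ^ k) ^ ((1 : ℝ) / 4) with hu
  have hu0 : 0 ≤ u := Real.rpow_nonneg hω' _
  have hsq : √(ω ((1 / 2) ^ k)) = u ^ 2 := by
    rw [Real.sqrt_eq_rpow, hu, ← Real.rpow_mul_natCast hω']
    norm_num
  have hub : u ≤ B / (k : ℝ) ^ 2 := by
    rw [le_div_iff₀ (by positivity), hB, le_div_iff₀ (by positivity)]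
    have := key k
    linarith
  rw [hsq]
  calc u ^ 2 * (1 + (k : ℝ)) ^ 2 ≤ (B / (k : ℝ) ^ 2) ^ 2 * (2 * k) ^ 2 := by
        gcongr; linarith
    _ = _ := by field_simp; norm_num

lemma Modulus.of_logDini {ω : ℝ → ℝ} (hω0 : ∀ t, 0 < t → 0 ≤ ω t)
    (hωmono : ∀ s t : ℝ, 0 < s → s ≤ t → ω s ≤ ω t) {D : ℝ}
    (hdoub : ∀ t : ℝ, 0 < t → ω (2 * t) ≤ D * ω t)
    (hω : IntegrableOn (fun t => ω t ^ ((1 : ℝ) / 4) * (1 + Real.log (1 / t)) / t)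
      (Ioo (0 : ℝ) 1)) : Modulus (extZero ω) (max D 1) where
  mono s t hst := by
    unfold extZero
    split_ifs with h1 h2 h2
    · exact le_rfl
    · exact hω0 t (not_le.1 h2)
    · exact absurd (hst.trans h2) h1
    · exact hωmono s t (not_le.1 h1) hst
  nonneg t := by
    unfold extZero
    split_ifs with h
    · exact le_rfl
    · exact hω0 t (not_le.1 h)
  one_le := le_max_right _ _
  doubling t := by
    rcases le_or_gt t 0 with h | h
    · simp [extZero, h, show 2 * t ≤ 0 by linarith]
    · rw [extZero_of_pos h, extZero_of_pos (by positivity)]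
      exact (hdoub t h).trans (mul_le_mul_of_nonneg_right (le_max_left _ _) (hω0 t h))
  summable := by
    have e : ∀ k : ℕ, extZero ω ((1 / 2) ^ k) = ω ((1 / 2) ^ k) := fun k =>
      extZero_of_pos (by positivity)
    simp_rw [e]
    exact summable_sqrt_of_logDini hω0 hωmono hω

lemma IsCZKernel2.extZero {n : ℕ} {C₀ : ℝ} {ω : ℝ → ℝ} {K : Rn n → Rn n → Rn n → ℝ}
    (hK : IsCZKernel2 C₀ ω K) : IsCZKernel2 C₀ (extZero ω) K := by
  have hpos : ∀ x y₁ y₂ : Rn n, ¬(x = y₁ ∧ y₁ = y₂) → 0 < ‖x - y₁‖ + ‖x - y₂‖ := by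
    intro x y₁ y₂ h
    by_contra hc
    have h1 := norm_nonneg (x - y₁)
    have h2 := norm_nonneg (x - y₂)
    have e1 : x = y₁ := sub_eq_zero.1 (norm_eq_zero.1 (by linarith))
    have e2 : x = y₂ := sub_eq_zero.1 (norm_eq_zero.1 (by linarith))
    exact h ⟨e1, e1 ▸ e2⟩
  have key : ∀ (u v : Rn n) (R p q : ℝ), 0 < R → (u = v → p = 0) →
      p ≤ q * ω (‖u - v‖ / R) → p ≤ q * _root_.extZero ω (‖u - v‖ / R) := by
    intro u v R p q hR hp h
    rcases eq_or_ne u v with e | e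
    · simp [hp e, e, _root_.extZero]
    · rwa [extZero_of_pos (div_pos (norm_pos_iff.2 (sub_ne_zero.2 e)) hR)]
  obtain ⟨h1, h2, h3, h4⟩ := hK
  refine ⟨h1, fun x x' y₁ y₂ h h' => key _ _ _ _ _ (hpos _ _ _ h) ?_ (h2 x x' y₁ y₂ h h'),
    fun x y₁ y₁' y₂ h h' => key _ _ _ _ _ (hpos _ _ _ h) ?_ (h3 x y₁ y₁' y₂ h h'),
    fun x y₁ y₂ y₂' h h' => key _ _ _ _ _ (hpos _ _ _ h) ?_ (h4 x y₁ y₂ y₂' h h')⟩ <;>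
  · rintro rfl
    simp

lemma CZOp.ae_eq_left {n : ℕ} {ω : ℝ → ℝ} {D C₀ C₂ : ℝ} {K : Rn n → Rn n → Rn n → ℝ}
    {T : (Rn n → ℝ) → (Rn n → ℝ) → Rn n → ℝ} (hT : CZOp ω D C₀ C₂ K T) {f f' g : Rn n → ℝ}
    (hf' : Integrable f') (hg : Integrable g) (h : f =ᵐ[volume] f') :
    T f g =ᵐ[volume] T f' g := by
  have hf : Integrable f := hf'.congr h.symm
  have hd : Integrable fun y => f y + -1 * f' y := hf.add (hf'.const_mul _)
  have hd0 : l1norm (fun y => f y + -1 * f' y) = 0 := by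
    rw [l1norm, integral_eq_zero_iff_of_nonneg (fun _ => abs_nonneg _) hd.abs]
    filter_upwards [h] with x hx
    simp [hx]
  have hlin := hT.bilin.linear_left hg
  have e : ∀ x, T (fun y => f y + -1 * f' y) g x = T f g x - T f' g x := fun x => by
    have h1 := (hlin x).add _ _ hf (hf'.const_mul (-1))
    simp only [(hlin x).smul _ _ hf'] at h1
    rw [h1]; ring
  have hz : ∀ k : ℕ, ∀ᵐ x, |T f g x - T f' g x| ≤ 1 / ((k : ℝ) + 1) := fun k => by
    have h1 := hT.weak _ g hd hg (1 / ((k : ℝ) + 1)) (by positivity)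
    rw [hd0, mul_zero, zero_mul, zero_div, Real.zero_rpow (by norm_num), ENNReal.ofReal_zero] at h1
    have h2 := measure_eq_zero_iff_ae_notMem.1 (le_antisymm h1 zero_le)
    filter_upwards [h2] with x hx
    rw [not_lt, e] at hx
    exact hx
  filter_upwards [ae_all_iff.2 hz] with x hx
  have h1 : |T f g x - T f' g x| ≤ 0 := ge_of_tendsto' tendsto_one_div_add_atTop_nhds_zero_nat hx
  exact sub_eq_zero.1 (abs_nonpos_iff.1 h1)

lemma CZOp.ae_eq {n : ℕ} {ω : ℝ → ℝ} {D C₀ C₂ : ℝ} {K : Rn n → Rn n → Rn n → ℝ}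
    {T : (Rn n → ℝ) → (Rn n → ℝ) → Rn n → ℝ} (hT : CZOp ω D C₀ C₂ K T) {f f' g g' : Rn n → ℝ}
    (hf' : Integrable f') (hg' : Integrable g') (hf : f =ᵐ[volume] f') (hg : g =ᵐ[volume] g') :
    T f g =ᵐ[volume] T f' g' :=
  (hT.ae_eq_left hf' (hg'.congr hg.symm) hf).trans (hT.swap.ae_eq_left hg' hf' hg)

lemma CZOp.commLR_ae_eq {n : ℕ} {ω : ℝ → ℝ} {D C₀ C₂ : ℝ} {K : Rn n → Rn n → Rn n → ℝ}
    {T : (Rn n → ℝ) → (Rn n → ℝ) → Rn n → ℝ} (hT : CZOp ω D C₀ C₂ K T)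
    {b₁ b₂ f f' g g' : Rn n → ℝ} (hf' : Integrable f') (hg' : Integrable g')
    (hbf' : Integrable fun x => b₁ x * f' x) (hbg' : Integrable fun x => b₂ x * g' x)
    (hf : f =ᵐ[volume] f') (hg : g =ᵐ[volume] g') :
    commLR T b₁ b₂ f g =ᵐ[volume] commLR T b₁ b₂ f' g' := by
  have hbf : (fun x => b₁ x * f x) =ᵐ[volume] fun x => b₁ x * f' x := by
    filter_upwards [hf] with x hx; rw [hx]
  have hbg : (fun x => b₂ x * g x) =ᵐ[volume] fun x => b₂ x * g' x := by
    filter_upwards [hg] with x hx; rw [hx]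
  filter_upwards [hT.ae_eq hf' hg' hf hg, hT.ae_eq hbf' hg' hbf hg, hT.ae_eq hf' hbg' hf hbg,
    hT.ae_eq hbf' hbg' hbf hbg] with x h1 h2 h3 h4
  simp only [commLR, h1, h2, h3, h4]

lemma IsDyadicCube.exists_gridCell {n : ℕ} {Q : Set (Rn n)} (hQ : IsDyadicCube Q) :
    ∃ (l : ℤ) (m : Fin n → ℤ), Q = gridCell (0 : Rn n) 1 l m := by
  obtain ⟨l, m, rfl⟩ := hQ
  refine ⟨l, m, ?_⟩
  ext x
  have hp : 0 < (2 : ℝ) ^ l := by positivity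
  simp only [gridCell, gridIdx, mem_ofPred_eq, funext_iff, Int.floor_eq_iff, PiLp.zero_apply,
    sub_zero, one_mul]
  refine forall_congr' fun i => ?_
  rw [le_div_iff₀ hp, div_lt_iff₀ hp, mul_comm (m i : ℝ), mul_comm ((m i : ℝ) + 1)]

lemma IsH1Atom.exists_isDyAtom {n : ℕ} {l : ℤ} {m : Fin n → ℤ} {a : Rn n → ℝ}
    (ha : IsH1Atom (gridCell (0 : Rn n) 1 l m) a) :
    ∃ a' : Rn n → ℝ, IsDyAtom l m a' ∧ a =ᵐ[volume] a' := by
  obtain ⟨hm, hz, hb, hi⟩ := ha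
  rw [volume_dyCell, ENNReal.toReal_ofReal (by positivity)] at hb
  set S : Set (Rn n) := {x | |a x| ≤ (((2 : ℝ) ^ l) ^ n)⁻¹} with hS
  have hSm : MeasurableSet S := measurableSet_le hm.abs measurable_const
  have he : a =ᵐ[volume] S.indicator a := by
    filter_upwards [hb] with x hx
    rw [indicator_of_mem (show x ∈ S from hx)]
  refine ⟨S.indicator a, ⟨hm.indicator hSm, fun x hx => ?_, fun x => ?_, ?_⟩, he⟩
  · by_cases h : x ∈ S
    · rw [indicator_of_mem h, hz x hx]
    · rw [indicator_of_notMem h]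
  · by_cases h : x ∈ S
    · rw [indicator_of_mem h]; exact h
    · rw [indicator_of_notMem h, abs_zero]; positivity
  · rw [← integral_congr_ae he, hi]

lemma FiniteAtomicSum.exists_decomp {n : ℕ} (hn : 1 ≤ n) {f : Rn n → ℝ} (hf : FiniteAtomicSum f)
    {b : Rn n → ℝ} {M : ℝ} (hb : IsBMO b M) {α : ℝ} (hα : 0 < α) :
    ∃ f' : Rn n → ℝ, f =ᵐ[volume] f' ∧ Nonempty (Decomp (decompConst n M) α b f') := by
  obtain ⟨N, Q, a, lam, hQ, ha, hlam, hfe⟩ := hf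
  choose lev idx hcell using fun k => (hQ k).exists_gridCell
  choose a' ha' hae using fun k => IsH1Atom.exists_isDyAtom (hcell k ▸ ha k)
  refine ⟨_, ?_, _root_.exists_decomp hn ha' lam hlam hb hα⟩
  filter_upwards [ae_all_iff.2 hae] with x hx
  rw [hfe x]
  exact Finset.sum_congr rfl fun k _ => by rw [hx k]

lemma IsBMO.of_le {n : ℕ} {b : Rn n → ℝ} {M M' : ℝ} (hb : LocallyIntegrable b volume)
    (h : OscBound b M) (hM : 0 ≤ M) (hMM' : M ≤ M') : IsBMO b M' :=
  ⟨hb, fun c l hl => (h c l hl).trans hMM', hM.trans hMM'⟩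

/-- The iterated commutator
`T_{Πb}(f₁,f₂) = b₁b₂·T(f₁,f₂) − b₂·T(b₁f₁,f₂) − b₁·T(f₁,b₂f₂) + T(b₁f₁,b₂f₂)`
of a bilinear Calderón–Zygmund operator of `ω` type, with `ω` non-decreasing, doubling and
satisfying the log-Dini(1/4) condition and `b₁, b₂ ∈ BMO`, maps pairs of finite atomic sums
into weak `L^{1/2}`, with constant `C·(C₀+C₁'+C₂)^{1/2}` depending only on `n`, `ω`, the
doubling constant `D` and the BMO bounds. -/
theorem stmt3 (n : ℕ) (hn : 1 ≤ n) (ω : ℝ → ℝ)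
    (hω0 : ∀ t, 0 < t → 0 ≤ ω t)
    (hωmono : ∀ s t : ℝ, 0 < s → s ≤ t → ω s ≤ ω t)
    (D : ℝ) (hD : 0 < D) (hdoub : ∀ t : ℝ, 0 < t → ω (2 * t) ≤ D * ω t)
    (hω_logDini : IntegrableOn
      (fun t => ω t ^ ((1:ℝ)/4) * (1 + Real.log (1 / t)) / t) (Ioo (0:ℝ) 1))
    (M₁ M₂ : ℝ) (hM₁ : 0 ≤ M₁) (hM₂ : 0 ≤ M₂) :
    ∃ C : ℝ, 0 < C ∧
      ∀ (C₀ C₁' C₂ : ℝ) (K : Rn n → Rn n → Rn n → ℝ)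
        (T : (Rn n → ℝ) → (Rn n → ℝ) → Rn n → ℝ) (b₁ b₂ : Rn n → ℝ),
        0 < C₀ → 0 < C₁' → 0 < C₂ →
        IsCZKernel2 C₀ ω K →
        (∀ f g : Rn n → ℝ, Integrable f → Integrable g → Measurable (T f g)) →
        Bilin2 T →
        KernelRep2 K T →
        LocallyIntegrable b₁ volume → OscBound b₁ M₁ →
        LocallyIntegrable b₂ volume → OscBound b₂ M₂ →
        -- weak `L²×L² → L^{1,∞}` bound for the iterated commutator `T_{Πb}`
        (∀ f g : Rn n → ℝ, Measurable f → Measurable g →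
          (∃ A : ℝ, ∀ x, |f x| ≤ A) → (∃ A : ℝ, ∀ x, |g x| ≤ A) →
          HasCompactSupport f → HasCompactSupport g →
          ∀ lam : ℝ, 0 < lam →
            volume {x | lam <
                |b₁ x * b₂ x * T f g x - b₂ x * T (fun y => b₁ y * f y) g x
                  - b₁ x * T f (fun y => b₂ y * g y) x
                  + T (fun y => b₁ y * f y) (fun y => b₂ y * g y) x|} ≤
              ENNReal.ofReal (C₁' * l2norm f * l2norm g / lam)) →
        -- weak `L¹×L¹ → L^{1/2,∞}` bound for `T`
        (∀ f g : Rn n → ℝ, Integrable f → Integrable g → ∀ lam : ℝ, 0 < lam →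
            volume {x | lam < |T f g x|} ≤
              ENNReal.ofReal ((C₂ * l1norm f * l1norm g / lam) ^ ((1:ℝ)/2))) →
        ∀ f₁ f₂ : Rn n → ℝ, FiniteAtomicSum f₁ → FiniteAtomicSum f₂ →
        ∀ lam : ℝ, 0 < lam →
          volume {x | lam <
              |b₁ x * b₂ x * T f₁ f₂ x - b₂ x * T (fun y => b₁ y * f₁ y) f₂ x
                - b₁ x * T f₁ (fun y => b₂ y * f₂ y) x
                + T (fun y => b₁ y * f₁ y) (fun y => b₂ y * f₂ y) x|} ≤
            ENNReal.ofReal (C * (C₀ + C₁' + C₂) ^ ((1:ℝ)/2) * lam ^ (-(1:ℝ)/2)) := by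
  obtain ⟨κ, hκ0, hκ⟩ := (Modulus.of_logDini hω0 hωmono hdoub hω_logDini).exists_volume_commLR_le
    hn (hM₁.trans (le_max_left M₁ M₂))
  refine ⟨κ, hκ0, fun C₀ C₁ C₂ K T b₁ b₂ hC₀ hC₁ hC₂ hK hmeas hbil hrep hb₁ ho₁ hb₂ ho₂ hstrong
    hweak f₁ f₂ hf₁ hf₂ lam hlam => ?_⟩
  have hT : CZOp (extZero ω) (max D 1) C₀ C₂ K T :=
    ⟨hn, Modulus.of_logDini hω0 hωmono hdoub hω_logDini, hC₀, hC₂, hK.extZero, hmeas, hbil, hrep,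
      hweak⟩
  have hB₁ := IsBMO.of_le hb₁ ho₁ hM₁ (le_max_left M₁ M₂)
  have hB₂ := IsBMO.of_le hb₂ ho₂ hM₂ (le_max_right M₁ M₂)
  have hA : 0 < C₀ + C₁ + C₂ := by positivity
  have hα : 0 < √(lam / (C₀ + C₁ + C₂)) := Real.sqrt_pos.2 (div_pos hlam hA)
  obtain ⟨f₁', he₁, ⟨d₁⟩⟩ := hf₁.exists_decomp hn hB₁ hα
  obtain ⟨f₂', he₂, ⟨d₂⟩⟩ := hf₂.exists_decomp hn hB₂ hα
  have hae : commLR T b₁ b₂ f₁ f₂ =ᵐ[volume] commLR T b₁ b₂ f₁' f₂' :=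
    hT.commLR_ae_eq d₁.integrable_f d₂.integrable_f d₁.integrable_bf d₂.integrable_bf he₁ he₂
  have hmain := hκ C₀ C₁ C₂ K T hT hC₁ b₁ b₂ hB₁ hB₂ hstrong _ f₁' f₂' hα d₁ d₂
  rw [Real.sq_sqrt (div_pos hlam hA).le, mul_div_cancel₀ lam hA.ne'] at hmain
  calc volume {x | lam < |commLR T b₁ b₂ f₁ f₂ x|}
      ≤ volume {x | lam < |commLR T b₁ b₂ f₁' f₂' x|} := by
        refine measure_mono_ae ?_
        filter_upwards [hae] with x hx (h : lam < |commLR T b₁ b₂ f₁ f₂ x|)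
        rwa [hx] at h
    _ ≤ ENNReal.ofReal (κ / √(lam / (C₀ + C₁ + C₂))) := hmain
    _ = _ := by
        rw [Real.sqrt_div hlam.le, neg_div, Real.rpow_neg hlam.le, ← Real.sqrt_eq_rpow,
          ← Real.sqrt_eq_rpow]
        congr 1
        have := Real.sqrt_pos.2 hlam
        field_simp
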